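/- Let φ*: G* → F* be a graded minimal morphism between free graded R-modules of ranks t+1 and t respectively (c = 2), M = coker(φ*), ℓ := Σ_{j=1}^{t+1} a_j − Σ_{i=1}^{t} b_i, and assume depth_{I_{t+1−p}(φ)} R = p(p+1). Then the R-dual Hom_R(−, R) of a minimal graded free R-resolution of R/I_{t+1−p}(φ) is a minimal graded free R-resolution of ∧^p M(pℓ). In particular ∧^p M has a minimal graded free R-resolution of length p(p+1). -/

import Mathlib

/-!
Common setup for formalizing "Schur powers of the cokernel of a graded morphism"
by J.O. Kleppe and R.M. Miró-Roig.
-/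

open Matrix TensorProduct CategoryTheory

noncomputable section

namespace KMR

/-- The standard graded polynomial ring `R = k[x₀,…,xₙ]`. -/
abbrev RR (k : Type) [Field k] (n : ℕ) : Type := MvPolynomial (Fin (n + 1)) k

variable {k : Type} [Field k] {n : ℕ}

/-- The irrelevant maximal ideal `𝔪 = (x₀,…,xₙ)`. -/
def mxI (k : Type) [Field k] (n : ℕ) : Ideal (RR k n) :=
  Ideal.span (Set.range MvPolynomial.X)

/-- The ideal `I_j(A)` generated by the `j × j` minors of the matrix `A`. -/
def minors {g t : ℕ} (A : Matrix (Fin g) (Fin t) (RR k n)) (j : ℕ) : Ideal (RR k n) :=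
  Ideal.span {m | ∃ (r : Fin j → Fin g) (c : Fin j → Fin t),
    Function.Injective r ∧ Function.Injective c ∧ m = (A.submatrix r c).det}

/-- The matrix `A` represents a graded morphism `φ : F = ⊕ R(bⱼ) → G = ⊕ R(aᵢ)`,
i.e. each entry `A i j` is homogeneous of degree `aᵢ - bⱼ` (or zero). -/
def IsHomogMatrix {g t : ℕ} (A : Matrix (Fin g) (Fin t) (RR k n))
    (a : Fin g → ℤ) (b : Fin t → ℤ) : Prop :=
  ∀ i j, A i j = 0 ∨ ∃ d : ℕ, (d : ℤ) = a i - b j ∧ (A i j).IsHomogeneous d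

/-- The morphism `φ` is minimal, i.e. `φ(F) ⊆ 𝔪 G`:
all entries of a representing matrix have vanishing constant term. -/
def IsMinMatrix {g t : ℕ} (A : Matrix (Fin g) (Fin t) (RR k n)) : Prop :=
  ∀ i j, MvPolynomial.constantCoeff (A i j) = 0

/-- `depthGE J N d` : there is an `N`-regular sequence of length `d` inside `J`,
i.e. `depth_J N ≥ d`. -/
def depthGE {R : Type} [CommRing R] (J : Ideal R) (N : Type) [AddCommGroup N] [Module R N]
    (d : ℕ) : Prop :=
  ∃ rs : List R, rs.length = d ∧ (∀ x ∈ rs, x ∈ J) ∧ RingTheory.Sequence.IsRegular N rs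

/-- `depthEQ J N d` : the length of a maximal `N`-regular sequence in `J` is exactly `d`. -/
def depthEQ {R : Type} [CommRing R] (J : Ideal R) (N : Type) [AddCommGroup N] [Module R N]
    (d : ℕ) : Prop :=
  depthGE J N d ∧ ¬ depthGE J N (d + 1)

/-- The morphism `φ : F → G` of free modules represented by the matrix `A`. -/
def phi {g t : ℕ} (A : Matrix (Fin g) (Fin t) (RR k n)) :
    (Fin t → RR k n) →ₗ[RR k n] (Fin g → RR k n) := A.mulVecLin

/-- The dual morphism `φ* : G* → F*`, represented by the transposed matrix. -/
def phiStar {g t : ℕ} (A : Matrix (Fin g) (Fin t) (RR k n)) :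
    (Fin g → RR k n) →ₗ[RR k n] (Fin t → RR k n) := A.transpose.mulVecLin

/-- `M = coker (φ*)`. -/
abbrev Mdl {g t : ℕ} (A : Matrix (Fin g) (Fin t) (RR k n)) : Type :=
  (Fin t → RR k n) ⧸ LinearMap.range (phiStar A)

/-- The canonical projection `F* → M = coker φ*`. -/
def MdlProj {g t : ℕ} (A : Matrix (Fin g) (Fin t) (RR k n)) :
    (Fin t → RR k n) →ₗ[RR k n] Mdl A :=
  Submodule.mkQ _

/-- The `i`-th symmetric power of a module, as a quotient of the `i`-th tensor power. -/
abbrev SymPow (R : Type) [CommRing R] (M : Type) [AddCommGroup M] [Module R M] (i : ℕ) : Type :=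
  (⨂[R]^i M) ⧸ Submodule.span R
    {z | ∃ (σ : Equiv.Perm (Fin i)) (f : Fin i → M),
      z = PiTensorProduct.tprod R f - PiTensorProduct.tprod R (f ∘ σ)}

section ExtPow

variable {R M N : Type} [CommRing R] [AddCommGroup M] [Module R M]
  [AddCommGroup N] [Module R N]

lemma extPow_map_mem (p : ℕ) (f : M →ₗ[R] N) {x : ExteriorAlgebra R M}
    (hx : x ∈ ⋀[R]^p M) : ExteriorAlgebra.map f x ∈ ⋀[R]^p N := by
  rw [← ExteriorAlgebra.ιMulti_span_fixedDegree] at hx ⊢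
  induction hx using Submodule.span_induction with
  | mem x h =>
      obtain ⟨v, rfl⟩ := h
      rw [ExteriorAlgebra.map_apply_ιMulti]
      exact Submodule.subset_span ⟨_, rfl⟩
  | zero => simpa using Submodule.zero_mem _
  | add x y _ _ h1 h2 => simpa using Submodule.add_mem _ h1 h2
  | smul r x _ h => simpa using Submodule.smul_mem _ r h

/-- The induced map `⋀^p M → ⋀^p N` of a linear map `f : M → N`. -/
def extPowMap (p : ℕ) (f : M →ₗ[R] N) : (⋀[R]^p M) →ₗ[R] (⋀[R]^p N) :=
  (ExteriorAlgebra.map f).toLinearMap.restrict (fun _ hx => extPow_map_mem p f hx)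

end ExtPow

section Wedge

variable (R L : Type) [CommRing R] [AddCommGroup L] [Module R L]

/-- Auxiliary map `L ⊗ L → Λ(L)`, `x ⊗ y ↦ ι x * ι y`. -/
def wedgeToAlg : L ⊗[R] L →ₗ[R] ExteriorAlgebra R L :=
  (LinearMap.mul' R (ExteriorAlgebra R L)).comp
    (TensorProduct.map (ExteriorAlgebra.ι R) (ExteriorAlgebra.ι R))

lemma wedgeToAlg_mem (z : L ⊗[R] L) : wedgeToAlg R L z ∈ ⋀[R]^2 L := by
  induction z using TensorProduct.induction_on with
  | zero => simpa using Submodule.zero_mem _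
  | tmul x y =>
      have : wedgeToAlg R L (x ⊗ₜ[R] y) =
          ExteriorAlgebra.ι R x * ExteriorAlgebra.ι R y := by
        simp [wedgeToAlg]
      have h2 : (⋀[R]^2 L) =
          LinearMap.range (ExteriorAlgebra.ι R (M := L)) *
            LinearMap.range (ExteriorAlgebra.ι R (M := L)) := pow_two _
      rw [this, h2]
      exact Submodule.mul_mem_mul (LinearMap.mem_range_self _ x) (LinearMap.mem_range_self _ y)
  | add x y h1 h2 => simpa using Submodule.add_mem _ h1 h2

/-- The wedge product map `L ⊗ L → ⋀² L`, `x ⊗ y ↦ x ∧ y`. -/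
def wedge2 : L ⊗[R] L →ₗ[R] (⋀[R]^2 L) :=
  (wedgeToAlg R L).codRestrict _ (wedgeToAlg_mem R L)

end Wedge

section ExtTor

variable (R : Type) [CommRing R]

/-- `Ext^i_R(M, N)` as an object of `ModuleCat R` (via the derived functor `Ext`). -/
abbrev ExtM (i : ℕ) (M N : Type) [AddCommGroup M] [Module R M] [AddCommGroup N] [Module R N] :
    ModuleCat R :=
  ((Ext R (ModuleCat R) i).obj (Opposite.op (ModuleCat.of R M))).obj (ModuleCat.of R N)

/-- `Tor_i^R(M, N)` as an object of `ModuleCat R` (via the derived functor `Tor`). -/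
abbrev TorM (i : ℕ) (M N : Type) [AddCommGroup M] [Module R M] [AddCommGroup N] [Module R N] :
    ModuleCat R :=
  ((Tor (ModuleCat R) i).obj (ModuleCat.of R M)).obj (ModuleCat.of R N)

/-- Isomorphism of `R`-modules, stated for objects of `ModuleCat R`. -/
def misoM {R : Type} [CommRing R] (X Y : ModuleCat R) : Prop := Nonempty (X ≅ Y)

end ExtTor

section Schur

/-- The cells of the Young diagram whose `r`-th row has length `lens r`. -/
abbrev YoungCells (m : ℕ) (lens : Fin m → ℕ) : Type := Σ r : Fin m, Fin (lens r)

variable (R M : Type) [CommRing R] [AddCommGroup M] [Module R M]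

/-- The action of a permutation of the index set on a tensor power. -/
def permAct {ι : Type} [Fintype ι] (σ : Equiv.Perm ι) :
    (⨂[R] _ : ι, M) →ₗ[R] (⨂[R] _ : ι, M) :=
  (PiTensorProduct.reindex R (fun _ : ι => M) σ).toLinearMap

open scoped Classical in
/-- The Young symmetrizer attached to the Young diagram with row lengths `lens`:
`e = Σ_{σ ∈ RowStab} Σ_{τ ∈ ColStab} sgn(τ) • (σ τ)` acting on the tensor power of `M`
indexed by the cells of the diagram.  (We work in characteristic zero, where its image
is the Schur power `Σ^I M` for the partition `I` with conjugate row lengths `lens`.) -/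
def youngSymmetrizer (m : ℕ) (lens : Fin m → ℕ) :
    (⨂[R] _ : YoungCells m lens, M) →ₗ[R] (⨂[R] _ : YoungCells m lens, M) :=
  ∑ σ : Equiv.Perm (YoungCells m lens), ∑ τ : Equiv.Perm (YoungCells m lens),
    if (∀ x, (σ x).1 = x.1) ∧ (∀ x, ((τ x).2 : ℕ) = ((x.2 : ℕ))) then
      ((Equiv.Perm.sign τ : ℤ) • permAct R M (σ * τ))
    else 0

/-- The Schur power `Σ^I M` of `M`, for the partition `I` whose Young diagram has
row lengths `lens` (read as a Young diagram; rows of the diagram of `I`). -/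
abbrev SchurPow (m : ℕ) (lens : Fin m → ℕ) : Type :=
  ↥(LinearMap.range (youngSymmetrizer R M m lens))

end Schur

section SymZ

variable {g t : ℕ} (A : Matrix (Fin g) (Fin t) (RR k n))

/-- Auxiliary: `SZ A 0 = Hom_R(M, R/I_t(A)) = S_{-1}M` and `SZ A (m+1) = S_m M`. -/
def SZ : ℕ → Type
  | 0 => Mdl A →ₗ[RR k n] (RR k n ⧸ minors A t)
  | (m + 1) => SymPow (RR k n) (Mdl A) m

instance : ∀ m, AddCommGroup (SZ A m)
  | 0 => inferInstanceAs (AddCommGroup (Mdl A →ₗ[RR k n] (RR k n ⧸ minors A t)))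
  | (m + 1) => inferInstanceAs (AddCommGroup (SymPow (RR k n) (Mdl A) m))

instance : ∀ m, Module (RR k n) (SZ A m)
  | 0 => inferInstanceAs (Module (RR k n) (Mdl A →ₗ[RR k n] (RR k n ⧸ minors A t)))
  | (m + 1) => inferInstanceAs (Module (RR k n) (SymPow (RR k n) (Mdl A) m))

/-- `S_i M` for `i ∈ ℤ`, `i ≥ -1`:  `SymZ A (-1) = Hom(M, B_t)` and `SymZ A i = S_i M`
for `i ≥ 0` (junk value `Hom(M, B_t)` for `i < -1`). -/
abbrev SymZ (i : ℤ) : Type := SZ A (i + 1).toNat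

end SymZ

section IdealTransform

variable {R : Type} [CommRing R] (J : Ideal R)
variable (N : Type) [AddCommGroup N] [Module R N]

/-- `Hom_R(Jᵛ, N)`. -/
abbrev homPow (ν : ℕ) : Type := ↥(J ^ ν) →ₗ[R] N

/-- Restriction `Hom(Jᵛ, N) → Hom(Jᵘ, N)` along `Jᵘ ⊆ Jᵛ` for `ν ≤ μ`. -/
def homPowMap (ν μ : ℕ) (h : ν ≤ μ) : homPow J N ν →ₗ[R] homPow J N μ :=
  LinearMap.lcomp R N (Submodule.inclusion (Ideal.pow_le_pow_right h))

/-- The ideal transform `D_J(N) = colim_ν Hom_R(Jᵛ, N)`.  By Deligne's formula this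
computes `H⁰_*(U, Ñ)` for `U` the complement of `V(J)`. -/
abbrev IdealTransform : Type := Module.DirectLimit (homPow J N) (homPowMap J N)

end IdealTransform

/-- A homogeneous ideal of `R = k[x₀,…,xₙ]`. -/
def IsHomogIdeal (I : Ideal (RR k n)) : Prop :=
  ∀ f ∈ I, ∀ d : ℕ, MvPolynomial.homogeneousComponent d f ∈ I

/-- The identity element of `V ⊗ V*` for the free module `V = R^m` (both `V` and its
dual realized as `Fin m → R`). -/
def idElem (R : Type) [CommRing R] (m : ℕ) : (Fin m → R) ⊗[R] (Fin m → R) :=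
  ∑ i : Fin m, (Pi.single i 1) ⊗ₜ[R] (Pi.single i 1)

end KMR

namespace KMR

section GenericMatrix

variable (K : Type) [Field K] (a m : ℕ)

/-- The coordinate ring of the space of `a × m` matrices. -/
abbrev GS : Type := MvPolynomial (Fin a × Fin m) K

/-- The generic `a × m` matrix. -/
abbrev gmat : Matrix (Fin a) (Fin m) (GS K a m) := Matrix.of fun i j => MvPolynomial.X (i, j)

/-- The number of elements of `D` below `j`. -/
def cnt (D : Finset ℕ) (j : ℕ) : ℕ := Nat.count (· ∈ D) j

lemma cnt_zero (D : Finset ℕ) : cnt D 0 = 0 := by simp [cnt]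

lemma cnt_succ (D : Finset ℕ) (j : ℕ) : cnt D (j + 1) = cnt D j + if j ∈ D then 1 else 0 :=
  Nat.count_succ _ _

lemma cnt_mono (D : Finset ℕ) {i j : ℕ} (h : i ≤ j) : cnt D i ≤ cnt D j := Nat.count_monotone _ h

lemma cnt_le (D : Finset ℕ) (j : ℕ) : cnt D j ≤ j := Nat.count_le _

/-- The `q × q` minors of the generic matrix supported on the first `j` columns. -/
def colMinors (q j : ℕ) : Set (GS K a m) :=
  {f | ∃ (r : Fin q → Fin a) (c : Fin q → Fin m), (∀ l, (c l : ℕ) < j) ∧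
    f = ((gmat K a m).submatrix r c).det}

/-- The coordinates in rows above `s`, and in row `s` before column `v`. -/
def zeroVars (s v : ℕ) : Set (GS K a m) :=
  {f | ∃ (i : Fin a) (j : Fin m), ((i : ℕ) < s ∨ (i : ℕ) = s ∧ (j : ℕ) < v) ∧
    f = MvPolynomial.X (i, j)}

/-- The ideals of the radical system of Hochster and Eagon. -/
def rsIdeal (s : ℕ) (D : Finset ℕ) (v : ℕ) : Ideal (GS K a m) :=
  Ideal.span (zeroVars K a m s v ∪ ⋃ j, colMinors K a m (cnt D j + 1) j)

variable {K a m}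

lemma zeroVars_subset (s : ℕ) (D : Finset ℕ) (v : ℕ) {f : GS K a m}
    (hf : f ∈ zeroVars K a m s v) : f ∈ rsIdeal K a m s D v :=
  Ideal.subset_span (Or.inl hf)

lemma colMinors_subset (s : ℕ) (D : Finset ℕ) (v j : ℕ) {f : GS K a m}
    (hf : f ∈ colMinors K a m (cnt D j + 1) j) : f ∈ rsIdeal K a m s D v :=
  Ideal.subset_span (Or.inr (Set.mem_iUnion.2 ⟨j, hf⟩))

lemma rsIdeal_le {s : ℕ} {D : Finset ℕ} {v : ℕ} {J : Ideal (GS K a m)}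
    (h0 : ∀ f ∈ zeroVars K a m s v, f ∈ J)
    (h1 : ∀ j, ∀ f ∈ colMinors K a m (cnt D j + 1) j, f ∈ J) : rsIdeal K a m s D v ≤ J := by
  rw [rsIdeal, Ideal.span_le]
  rintro f (hf | hf)
  · exact h0 f hf
  · obtain ⟨j, hj⟩ := Set.mem_iUnion.1 hf
    exact h1 j f hj

lemma colMinors_succ_mem (q j : ℕ) {f : GS K a m} (hf : f ∈ colMinors K a m (q + 1) j) :
    f ∈ Ideal.span (colMinors K a m q j) := by
  obtain ⟨r, c, hc, rfl⟩ := hf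
  rw [Matrix.det_succ_row_zero]
  refine Ideal.sum_mem _ fun l _ => Ideal.mul_mem_left _ _ (Ideal.subset_span ?_)
  exact ⟨r ∘ Fin.succ, c ∘ l.succAbove, fun _ => hc _, rfl⟩

lemma colMinors_mem {q q' j j' : ℕ} (hq : q ≤ q') (hj : j' ≤ j) {f : GS K a m}
    (hf : f ∈ colMinors K a m q' j') : f ∈ Ideal.span (colMinors K a m q j) := by
  have : ∀ d, ∀ f ∈ colMinors K a m (q + d) j, f ∈ Ideal.span (colMinors K a m q j) := by
    intro d
    induction d with
    | zero => exact fun f hf => Ideal.subset_span hf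
    | succ d ih => exact fun f hf => Ideal.span_le.2 ih (colMinors_succ_mem (q + d) j hf)
  obtain ⟨d, rfl⟩ := Nat.exists_eq_add_of_le hq
  obtain ⟨r, c, hc, rfl⟩ := hf
  exact this d _ ⟨r, c, fun l => (hc l).trans_le hj, rfl⟩

lemma colMinors_mem_rsIdeal {s : ℕ} {D : Finset ℕ} {v q j j' : ℕ} (hq : cnt D j + 1 ≤ q)
    (hj : j' ≤ j) {f : GS K a m} (hf : f ∈ colMinors K a m q j') : f ∈ rsIdeal K a m s D v :=
  Ideal.span_le.2 (fun _ h => colMinors_subset s D v j h) (colMinors_mem hq hj hf)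

lemma rsIdeal_mono_left {s : ℕ} {D D' : Finset ℕ} {v : ℕ} (h : ∀ j, cnt D' j ≤ cnt D j) :
    rsIdeal K a m s D v ≤ rsIdeal K a m s D' v :=
  rsIdeal_le (fun _ hf => zeroVars_subset _ _ _ hf)
    fun j _ hf => colMinors_mem_rsIdeal (Nat.succ_le_succ (h j)) le_rfl hf

lemma zeroVars_mono (s : ℕ) {v v' : ℕ} (h : v ≤ v') :
    zeroVars K a m s v ⊆ zeroVars K a m s v' := by
  rintro f ⟨i, j, hij, rfl⟩
  exact ⟨i, j, by omega, rfl⟩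

lemma rsIdeal_mono_right (s : ℕ) (D : Finset ℕ) {v v' : ℕ} (h : v ≤ v') :
    rsIdeal K a m s D v ≤ rsIdeal K a m s D v' :=
  rsIdeal_le (fun _ hf => zeroVars_subset _ _ _ (zeroVars_mono s h hf))
    fun j _ hf => colMinors_subset _ _ _ j hf

lemma rsIdeal_succ {s v : ℕ} (D : Finset ℕ) (hs : s < a) (hv : v < m) :
    rsIdeal K a m s D (v + 1) =
      rsIdeal K a m s D v ⊔ Ideal.span {MvPolynomial.X (⟨s, hs⟩, ⟨v, hv⟩)} := by
  apply le_antisymm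
  · refine rsIdeal_le ?_ fun j f hf => Ideal.mem_sup_left (colMinors_subset _ _ _ j hf)
    rintro f ⟨i, j, hij, rfl⟩
    by_cases h : (i : ℕ) = s ∧ (j : ℕ) = v
    · obtain ⟨rfl, rfl⟩ := h
      exact Ideal.mem_sup_right (Ideal.subset_span rfl)
    · exact Ideal.mem_sup_left (zeroVars_subset _ _ _ ⟨i, j, by omega, rfl⟩)
  · refine sup_le (rsIdeal_mono_right _ _ (Nat.le_succ v)) ?_
    rw [Ideal.span_singleton_le_iff_mem]
    exact zeroVars_subset _ _ _ ⟨_, _, Or.inr ⟨rfl, Nat.lt_succ_self v⟩, rfl⟩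

/-- Moving a pivot to the right. -/
lemma cnt_move {D : Finset ℕ} {u v : ℕ} (hu : u ∈ D) (hv : v ∉ D) (huv : u < v) (j : ℕ) :
    cnt (insert v (D.erase u)) j + (if u < j ∧ j ≤ v then 1 else 0) = cnt D j := by
  induction j with
  | zero => simp [cnt_zero]
  | succ j ih =>
    rw [cnt_succ, cnt_succ, ← ih]
    simp only [Finset.mem_insert, Finset.mem_erase]
    by_cases h1 : j = v
    · subst h1; simp [hv, huv]
    · by_cases h2 : j = u
      · subst h2; simp [hu, h1]; omega
      · simp only [h1, h2, false_or, ne_eq, not_false_eq_true, true_and]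
        split_ifs <;> omega

lemma cnt_const {D : Finset ℕ} {u v : ℕ} (h : ∀ w ∈ D, u ≤ w → v ≤ w) {j : ℕ} (h1 : u ≤ j)
    (h2 : j ≤ v) : cnt D j = cnt D u := by
  induction j, h1 using Nat.le_induction with
  | base => rfl
  | succ j hj ih =>
    rw [cnt_succ, ih (by omega), if_neg fun hjD => ?_]
    · rfl
    · have := h j hjD hj
      omega

lemma mul_rsIdeal_move_le {s v u : ℕ} {D : Finset ℕ} (hs : s < a) (hv : v < m) (hu : u ∈ D)
    (hvD : v ∉ D) (huv : u < v) (hmax : ∀ w ∈ D, u + 1 ≤ w → v ≤ w)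
    {f : GS K a m} (hf : f ∈ rsIdeal K a m s (insert v (D.erase u)) v) :
    MvPolynomial.X (⟨s, hs⟩, ⟨v, hv⟩) * f ∈ rsIdeal K a m s D v := by
  suffices h : rsIdeal K a m s (insert v (D.erase u)) v ≤
      (rsIdeal K a m s D v).colon {MvPolynomial.X (⟨s, hs⟩, ⟨v, hv⟩)} by
    have := h hf
    rw [Submodule.mem_colon_singleton] at this
    rwa [mul_comm]
  refine rsIdeal_le ?_ ?_
  · intro f hf
    rw [Submodule.mem_colon_singleton, smul_eq_mul]
    exact Ideal.mul_mem_right _ _ (zeroVars_subset _ _ _ hf)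
  · intro j f hf
    rw [Submodule.mem_colon_singleton, smul_eq_mul]
    have hc := cnt_move hu hvD huv j
    split_ifs at hc with hj
    · obtain ⟨r, c, hcj, rfl⟩ := hf
      have h1 : cnt D j = cnt D (u + 1) := cnt_const hmax hj.1 hj.2
      have h2 : cnt D v = cnt D (u + 1) := cnt_const hmax huv le_rfl
      have h3 : cnt D (v + 1) = cnt D v := by rw [cnt_succ, if_neg hvD, add_zero]
      have hmin : ((gmat K a m).submatrix (Fin.cons ⟨s, hs⟩ r : Fin _ → Fin a)
          (Fin.cons ⟨v, hv⟩ c : Fin _ → Fin m)).det ∈ rsIdeal K a m s D v := by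
        refine colMinors_mem_rsIdeal (j := v + 1) (by omega) le_rfl ⟨_, _, ?_, rfl⟩
        intro l
        refine Fin.cases ?_ (fun l => ?_) l
        · simp
        · have := hcj l
          simp only [Fin.cons_succ]
          omega
      rw [Matrix.det_succ_row_zero, Fin.sum_univ_succ] at hmin
      rw [mul_comm]
      have hrest : ∀ l : Fin (cnt (insert v (D.erase u)) j + 1), _ ∈ rsIdeal K a m s D v :=
        fun l => zeroVars_subset s D v
          ⟨⟨s, hs⟩, c l, Or.inr ⟨rfl, (hcj l).trans_le hj.2⟩, rfl⟩
      refine (Ideal.add_mem_iff_left _ ?_).1 (by simpa using hmin)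
      refine Ideal.sum_mem _ fun l _ => Ideal.mul_mem_right _ _ (Ideal.mul_mem_left _ _ ?_)
      exact hrest l
    · refine Ideal.mul_mem_right _ _ (colMinors_subset _ _ _ j ?_)
      rw [← hc]
      simpa using hf

lemma X_mem_rsIdeal {s v : ℕ} {D : Finset ℕ} (hs : s < a) (hv : v < m)
    (h : cnt D (v + 1) = 0) :
    (MvPolynomial.X (⟨s, hs⟩, ⟨v, hv⟩) : GS K a m) ∈ rsIdeal K a m s D v := by
  refine colMinors_subset _ _ _ (v + 1) ?_
  rw [h]
  exact ⟨fun _ => ⟨s, hs⟩, fun _ => ⟨v, hv⟩, by simp, by simp⟩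

lemma rsIdeal_succ_row (s : ℕ) (D : Finset ℕ) :
    rsIdeal K a m (s + 1) D 0 = rsIdeal K a m s D m := by
  have : zeroVars K a m (s + 1) 0 = zeroVars K a m s m := by
    ext f
    constructor
    · rintro ⟨i, j, hij, rfl⟩
      exact ⟨i, j, by omega, rfl⟩
    · rintro ⟨i, j, hij, rfl⟩
      exact ⟨i, j, by omega, rfl⟩
  rw [rsIdeal, rsIdeal, this]

lemma cnt_erase {D : Finset ℕ} {u : ℕ} (hu : u ∈ D) (j : ℕ) :
    cnt (D.erase u) j + (if u < j then 1 else 0) = cnt D j := by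
  induction j with
  | zero => simp [cnt_zero]
  | succ j ih =>
    rw [cnt_succ, cnt_succ, ← ih]
    simp only [Finset.mem_erase]
    by_cases h2 : j = u
    · subst h2; simp [hu]
    · simp only [h2, ne_eq, not_false_eq_true, true_and]
      split_ifs <;> omega

lemma cnt_of_le {D : Finset ℕ} {j : ℕ} (h : ∀ w ∈ D, w < j) : cnt D j = D.card := by
  rw [cnt, Nat.count_eq_card_filter_range]
  congr 1
  ext w
  simp only [Finset.mem_filter, Finset.mem_range]
  exact ⟨fun h => h.2, fun hw => ⟨h w hw, hw⟩⟩

/-- Minors involving more rows than are nonzero. -/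
lemma colMinors_mem_of_zero_rows {J : Ideal (GS K a m)} {s q j : ℕ}
    (hz : ∀ (i : Fin a) (l : Fin m), (i : ℕ) < s → (l : ℕ) < j → MvPolynomial.X (i, l) ∈ J)
    (hq : a - s < q) {f : GS K a m} (hf : f ∈ colMinors K a m q j) : f ∈ J := by
  obtain ⟨r, c, hc, rfl⟩ := hf
  by_cases h : ∃ l, (r l : ℕ) < s
  · obtain ⟨l, hl⟩ := h
    rw [Matrix.det_apply]
    refine Ideal.sum_mem _ fun σ _ => ?_
    rw [Units.smul_def, zsmul_eq_mul]
    refine Ideal.mul_mem_left _ _ ?_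
    rw [← Finset.mul_prod_erase _ _ (Finset.mem_univ (σ.symm l))]
    refine Ideal.mul_mem_right _ _ ?_
    simpa using hz (r l) (c (σ.symm l)) hl (hc _)
  · push Not at h
    have : ¬ Function.Injective r := fun hr => by
      have := Fintype.card_le_of_injective (fun l => (⟨(r l : ℕ) - s, by have := h l; omega⟩ : Fin (a - s)))
        (fun x y hxy => hr (Fin.ext (by
          have := congrArg Fin.val hxy
          have := h x
          have := h y
          simp only at *
          omega)))
      simp at this
      omega
    rw [Function.not_injective_iff] at this
    obtain ⟨x, y, hxy, hne⟩ := this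
    rw [Matrix.det_zero_of_row_eq hne]
    · exact Ideal.zero_mem _
    · ext l
      simp [hxy]

lemma colMinors_mem_of_rows {s : ℕ} {D : Finset ℕ} {v q j : ℕ} (hq : a - s < q)
    {f : GS K a m} (hf : f ∈ colMinors K a m q j) : f ∈ rsIdeal K a m s D v :=
  colMinors_mem_of_zero_rows (fun i l hi _ => zeroVars_subset _ _ _ ⟨i, l, Or.inl hi, rfl⟩) hq hf

lemma rsIdeal_erase_max {s u : ℕ} {D : Finset ℕ} (hu : u ∈ D) (hmax : ∀ w ∈ D, w ≤ u)
    (hcard : a - s < D.card) (v : ℕ) :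
    rsIdeal K a m s (D.erase u) v = rsIdeal K a m s D v := by
  apply le_antisymm
  · refine rsIdeal_le (fun f hf => zeroVars_subset _ _ _ hf) fun j f hf => ?_
    have h := cnt_erase hu j
    split_ifs at h with huj
    · have : cnt D j = D.card := cnt_of_le fun w hw => (hmax w hw).trans_lt huj
      exact colMinors_mem_of_rows (by omega) hf
    · exact colMinors_subset _ _ _ j (by rwa [← h])
  · exact rsIdeal_mono_left fun j => by rw [← cnt_erase hu j]; omega

/-- Products `U * V` parametrizing the zero locus of `rsIdeal K a m s D v`. -/
def rsPoint (s : ℕ) (D : Finset ℕ) (v h : ℕ) (U : Matrix (Fin a) (Fin m) K)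
    (V : Matrix (Fin m) (Fin m) K) : Prop :=
  cnt D (v + 1) ≤ h + 1 ∧
  (∀ (i : Fin a) (l : Fin m), ((i : ℕ) < s ∨ (i : ℕ) = s ∧ (l : ℕ) < h) → U i l = 0) ∧
  (∀ (l j : Fin m), (cnt D (j + 1) ≤ (l : ℕ) ∨ (j : ℕ) < v ∧ h ≤ (l : ℕ)) → V l j = 0)

/-- Evaluation of a polynomial at a matrix. -/
abbrev evalM (x : Matrix (Fin a) (Fin m) K) : GS K a m →+* K :=
  MvPolynomial.eval fun ij => x ij.1 ij.2

/-- `f` vanishes on the parametrized locus. -/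
def RsVanish (s : ℕ) (D : Finset ℕ) (v : ℕ) (f : GS K a m) : Prop :=
  ∀ (h : ℕ) (U : Matrix (Fin a) (Fin m) K) (V : Matrix (Fin m) (Fin m) K),
    rsPoint s D v h U V → evalM (U * V) f = 0

lemma RsVanish.of_succ {s v : ℕ} {D : Finset ℕ} {f : GS K a m} (hf : RsVanish s D v f) :
    RsVanish s D (v + 1) f := fun h U V ⟨h1, h2, h3⟩ =>
  hf h U V ⟨(cnt_mono D (Nat.le_succ _)).trans h1, h2, fun l j hlj => h3 l j (by omega)⟩

lemma evalM_det {q : ℕ} (x : Matrix (Fin a) (Fin m) K) (r : Fin q → Fin a) (c : Fin q → Fin m) :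
    evalM x ((gmat K a m).submatrix r c).det = (x.submatrix r c).det := by
  rw [RingHom.map_det]
  congr 1
  ext i j
  simp

lemma det_mul_eq_zero_of_lt {q l : ℕ} (h : l < q) (M : Matrix (Fin q) (Fin l) K)
    (N : Matrix (Fin l) (Fin q) K) : (M * N).det = 0 := by
  by_contra hne
  have h1 : (M * N).rank = q := by
    have := Matrix.rank_of_isUnit (M * N) ((Matrix.isUnit_iff_isUnit_det _).2 (Ne.isUnit hne))
    simpa using this
  have h2 := (Matrix.rank_mul_le_left M N).trans (Matrix.rank_le_card_width M)
  simp at h2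
  omega

lemma rsVanish_of_mem {s v : ℕ} {D : Finset ℕ} {f : GS K a m}
    (hf : f ∈ rsIdeal K a m s D v) : RsVanish s D v f := by
  rintro h U V ⟨h1, h2, h3⟩
  suffices rsIdeal K a m s D v ≤ RingHom.ker (evalM (U * V)) from this hf
  refine rsIdeal_le ?_ ?_
  · rintro _ ⟨i, j, hij, rfl⟩
    rw [RingHom.mem_ker, MvPolynomial.eval_X, Matrix.mul_apply]
    refine Finset.sum_eq_zero fun l _ => ?_
    by_cases hl : (i : ℕ) < s ∨ (i : ℕ) = s ∧ (l : ℕ) < h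
    · rw [h2 i l hl, zero_mul]
    · rw [h3 l j (by omega), mul_zero]
  · rintro j _ ⟨r, c, hc, rfl⟩
    rw [RingHom.mem_ker, evalM_det]
    by_cases hm : m ≤ cnt D j
    · rw [Matrix.submatrix_mul U V r _ c Function.bijective_id]
      exact det_mul_eq_zero_of_lt (by omega) _ _
    · push Not at hm
      have : (U * V).submatrix r c = U.submatrix r (Fin.castLE hm.le) *
          V.submatrix (Fin.castLE hm.le) c := by
        ext x y
        rw [Matrix.submatrix_apply, Matrix.mul_apply, Matrix.mul_apply]
        refine (Finset.sum_of_injOn (Fin.castLE hm.le) (Fin.castLE_injective _).injOn (by simp)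
          ?_ (by simp)).symm
        intro l _ hl
        rw [h3 l (c y), mul_zero]
        left
        by_contra hlt
        push Not at hlt
        have : (l : ℕ) < cnt D j := hlt.trans_le (cnt_mono D (hc y))
        exact hl ⟨⟨l, this⟩, by simp, rfl⟩
      rw [this]
      exact det_mul_eq_zero_of_lt (by omega) _ _

/-- The parametrized locus at a pivot is irreducible. -/
lemma rsVanish_mul [Infinite K] {s v : ℕ} {D : Finset ℕ} (hvD : v ∈ D) {f g : GS K a m}
    (hfg : RsVanish s D v (f * g)) : RsVanish s D v f ∨ RsVanish s D v g := by
  classical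
  let P : Type := (Fin a × Fin m) ⊕ (Fin m × Fin m)
  let U : Matrix (Fin a) (Fin m) (MvPolynomial P K) := Matrix.of fun i l =>
    if (i : ℕ) < s ∨ (i : ℕ) = s ∧ (l : ℕ) < cnt D v then 0 else MvPolynomial.X (Sum.inl (i, l))
  let V : Matrix (Fin m) (Fin m) (MvPolynomial P K) := Matrix.of fun l j =>
    if cnt D (j + 1) ≤ (l : ℕ) then 0 else MvPolynomial.X (Sum.inr (l, j))
  let θ : GS K a m →+* MvPolynomial P K :=
    MvPolynomial.eval₂Hom MvPolynomial.C (fun ij => (U * V) ij.1 ij.2)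
  have hc : cnt D (v + 1) = cnt D v + 1 := by rw [cnt_succ, if_pos hvD]
  have hθ : ∀ (x : P → K) (f : GS K a m), MvPolynomial.eval x (θ f) =
      evalM (U.map (MvPolynomial.eval x) * V.map (MvPolynomial.eval x)) f := by
    intro x f
    rw [← Matrix.map_mul, ← RingHom.comp_apply]
    congr 1
    apply MvPolynomial.ringHom_ext
    · simp [θ]
    · rintro ⟨i, j⟩
      simp [θ, Matrix.mul_apply]
  have key : ∀ f : GS K a m, θ f = 0 ↔ RsVanish s D v f := by
    intro f
    constructor
    · rintro hf h U' V' ⟨h1, h2, h3⟩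
      have := hθ (Sum.elim (fun il => U' il.1 il.2) (fun lj => V' lj.1 lj.2)) f
      rw [hf, map_zero] at this
      rw [this]
      congr 2
      · congr 1
        · ext i l
          simp only [U, Matrix.map_apply, Matrix.of_apply]
          split_ifs with hil
          · rw [map_zero, h2 i l (by omega)]
          · simp
        · ext l j
          simp only [V, Matrix.map_apply, Matrix.of_apply]
          split_ifs with hil
          · rw [map_zero, h3 l j (by omega)]
          · simp
    · intro hf
      apply MvPolynomial.funext
      intro x
      rw [hθ, map_zero]
      refine hf (cnt D v) _ _ ⟨hc.le, ?_, ?_⟩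
      · intro i l hil
        simp [U, hil]
      · intro l j hlj
        have : cnt D (j + 1) ≤ (l : ℕ) := by
          rcases hlj with hlj | ⟨hj, hl⟩
          · exact hlj
          · exact (cnt_mono D hj).trans hl
        simp [V, this]
  rw [← key, ← key]
  have := (key _).2 hfg
  rwa [map_mul, mul_eq_zero] at this

lemma not_rsVanish_X {s v : ℕ} {D : Finset ℕ} (hvD : v ∈ D) (hs : s < a) (hv : v < m) :
    ¬ RsVanish s D v (MvPolynomial.X (⟨s, hs⟩, ⟨v, hv⟩) : GS K a m) := by
  intro hX
  have hc : cnt D (v + 1) = cnt D v + 1 := by rw [cnt_succ, if_pos hvD]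
  have hlt : cnt D v < m := (cnt_le D v).trans_lt hv
  have := hX (cnt D v) (Matrix.single ⟨s, hs⟩ ⟨cnt D v, hlt⟩ 1)
    (Matrix.single ⟨cnt D v, hlt⟩ ⟨v, hv⟩ 1) ⟨hc.le, ?_, ?_⟩
  · rw [evalM, MvPolynomial.eval_X, Matrix.single_mul_single_same] at this
    simp at this
  · intro i l hil
    refine Matrix.single_apply_of_ne _ _ _ _ _ ?_
    simp only [Fin.ext_iff]
    omega
  · intro l j hlj
    refine Matrix.single_apply_of_ne _ _ _ _ _ ?_
    rintro ⟨rfl, rfl⟩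
    simp only at hlj
    omega

lemma RsVanish.of_cnt_le {s v : ℕ} {D D' : Finset ℕ} {f : GS K a m} (hf : RsVanish s D v f)
    (h : ∀ j, cnt D' j ≤ cnt D j) (hv : cnt D (v + 1) ≤ cnt D' (v + 1)) :
    RsVanish s D' v f := fun e U V ⟨h1, h2, h3⟩ =>
  hf e U V ⟨hv.trans h1, h2, fun l j hlj => h3 l j (hlj.imp_left (h _).trans)⟩

lemma RsVanish.of_row {s : ℕ} {D : Finset ℕ} {f : GS K a m} (hf : RsVanish s D m f) :
    RsVanish (s + 1) D 0 f := fun e U V ⟨h1, h2, h3⟩ =>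
  hf (m + 1) U V ⟨(cnt_le D _).trans (by omega), fun i l hil => h2 i l (by omega),
    fun l j hlj => h3 l j (by have := l.isLt; omega)⟩

section Homogeneous

attribute [local instance] MvPolynomial.gradedAlgebra

variable {σ : Type}

lemma homogeneousComponent_mem {J : Ideal (MvPolynomial σ K)} {f : MvPolynomial σ K}
    (hJ : J.IsHomogeneous (MvPolynomial.homogeneousSubmodule σ K)) (hf : f ∈ J) (d : ℕ) :
    MvPolynomial.homogeneousComponent d f ∈ J := by
  have := hJ d hf
  exact (MvPolynomial.decomposition.decompose'_apply f d) ▸ this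

lemma mem_of_mem_sup_pow {J : Ideal (MvPolynomial σ K)}
    (hJ : J.IsHomogeneous (MvPolynomial.homogeneousSubmodule σ K)) (i : σ)
    {f : MvPolynomial σ K} (hf : ∀ N, f ∈ J ⊔ Ideal.span {MvPolynomial.X i ^ N}) : f ∈ J := by
  obtain ⟨g, hg, h, hh, hF⟩ := Submodule.mem_sup.1 (hf (f.totalDegree + 1))
  obtain ⟨q, rfl⟩ := Ideal.mem_span_singleton'.1 hh
  rw [← MvPolynomial.sum_homogeneousComponent f]
  refine Ideal.sum_mem _ fun d hd => ?_
  have : MvPolynomial.homogeneousComponent d (q * MvPolynomial.X i ^ (f.totalDegree + 1)) = 0 := by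
    ext e
    rw [MvPolynomial.coeff_homogeneousComponent, MvPolynomial.coeff_zero]
    split_ifs with he
    · rw [MvPolynomial.X_pow_eq_monomial, MvPolynomial.coeff_mul_monomial']
      rw [if_neg]
      intro hle
      have h1 := hle i
      rw [Finsupp.single_eq_same] at h1
      have h2 := Finsupp.le_degree i e
      have h3 := Finset.mem_range.1 hd
      omega
    · rfl
  rw [← hF, map_add, this, add_zero]
  exact homogeneousComponent_mem hJ hg d

lemma isHomogeneous_minor {q : ℕ} (r : Fin q → Fin a) (c : Fin q → Fin m) :
    ((gmat K a m).submatrix r c).det.IsHomogeneous q := by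
  rw [Matrix.det_apply]
  refine MvPolynomial.IsHomogeneous.sum _ _ _ fun σ _ => ?_
  rw [Units.smul_def]
  refine Submodule.smul_of_tower_mem (MvPolynomial.homogeneousSubmodule _ K q) _ ?_
  have := MvPolynomial.IsHomogeneous.prod (Finset.univ : Finset (Fin q))
    (fun i => (gmat K a m).submatrix r c (σ i) i) (fun _ => 1)
    (fun i _ => MvPolynomial.isHomogeneous_X _ _)
  simpa using this

lemma rsIdeal_isHomogeneous (s : ℕ) (D : Finset ℕ) (v : ℕ) :
    (rsIdeal K a m s D v).IsHomogeneous (MvPolynomial.homogeneousSubmodule _ K) := by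
  refine Ideal.homogeneous_span _ _ ?_
  rintro f (⟨i, j, _, rfl⟩ | hf)
  · exact ⟨1, MvPolynomial.isHomogeneous_X _ _⟩
  · obtain ⟨j, r, c, _, rfl⟩ := Set.mem_iUnion.1 hf
    exact ⟨_, isHomogeneous_minor r c⟩

end Homogeneous

lemma exists_max_pivot {D : Finset ℕ} {v : ℕ} (h : cnt D v ≠ 0) :
    ∃ u ∈ D, u < v ∧ ∀ w ∈ D, u + 1 ≤ w → v ≤ w := by
  classical
  have hne : (D.filter (· < v)).Nonempty := by
    by_contra hne
    rw [Finset.not_nonempty_iff_eq_empty, Finset.filter_eq_empty_iff] at hne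
    apply h
    rw [cnt, Nat.count_iff_forall_not]
    exact fun n hn hnD => hne hnD hn
  refine ⟨_, (Finset.mem_filter.1 (Finset.max'_mem _ hne)).1,
    (Finset.mem_filter.1 (Finset.max'_mem _ hne)).2, fun w hw h1 => ?_⟩
  by_contra h2
  have := Finset.le_max' (D.filter (· < v)) w (Finset.mem_filter.2 ⟨hw, by omega⟩)
  omega

/-- The ideals of the radical system consist of all functions vanishing on their zero loci. -/
theorem mem_rsIdeal_iff [Infinite K] (s : ℕ) (hs : s ≤ a) (v : ℕ) (hv : v ≤ m) (D : Finset ℕ)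
    (hD : ∀ w ∈ D, w < m) (f : GS K a m) :
    f ∈ rsIdeal K a m s D v ↔ RsVanish s D v f := by
  refine ⟨rsVanish_of_mem, ?_⟩
  induction hs using Nat.decreasingInduction generalizing v D f with
  | self =>
    intro hf
    have hf0 := hf (m + 1) 0 0 ⟨(cnt_le D _).trans (by omega), by simp, by simp⟩
    have h1 : f ∈ Ideal.span (Set.range (MvPolynomial.X : Fin a × Fin m → GS K a m)) := by
      rw [← Set.image_univ, MvPolynomial.mem_ideal_span_X_image]
      intro e he
      by_contra! hall
      have : e = 0 := Finsupp.ext fun i => hall i trivial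
      subst this
      rw [MvPolynomial.mem_support_iff] at he
      apply he
      rw [← hf0, Matrix.zero_mul, ← MvPolynomial.constantCoeff_eq, ← MvPolynomial.eval_zero']
      rfl
    refine Ideal.span_le.2 ?_ h1
    rintro _ ⟨⟨i, j⟩, rfl⟩
    exact zeroVars_subset _ _ _ ⟨i, j, Or.inl i.isLt, rfl⟩
  | of_succ s hs ihs =>
    induction hv using Nat.decreasingInduction generalizing D f with
    | self =>
      intro hf
      rw [← rsIdeal_succ_row]
      exact ihs 0 (Nat.zero_le _) D hD f hf.of_row
    | of_succ v hv ihv =>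
      have hprime : ∀ D : Finset ℕ, (∀ w ∈ D, w < m) → v ∈ D → ∀ f : GS K a m, RsVanish s D v f →
          f ∈ rsIdeal K a m s D v := by
        intro D hD hvD f hf
        refine mem_of_mem_sup_pow (rsIdeal_isHomogeneous s D v) (⟨s, hs⟩, ⟨v, hv⟩) fun N => ?_
        suffices ∃ g ∈ rsIdeal K a m s D v, ∃ q, RsVanish s D v q ∧
            f = g + q * MvPolynomial.X (⟨s, hs⟩, ⟨v, hv⟩) ^ N by
          obtain ⟨g, hg, q, -, rfl⟩ := this
          exact Ideal.add_mem _ (Ideal.mem_sup_left hg)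
            (Ideal.mem_sup_right (Ideal.mem_span_singleton'.2 ⟨q, rfl⟩))
        induction N with
        | zero => exact ⟨0, Ideal.zero_mem _, f, hf, by simp⟩
        | succ N ih =>
          obtain ⟨g, hg, q, hq, rfl⟩ := ih
          have h1 := ihv D hD q hq.of_succ
          rw [rsIdeal_succ D hs hv] at h1
          obtain ⟨g', hg', h, hh, rfl⟩ := Submodule.mem_sup.1 h1
          obtain ⟨q', rfl⟩ := Ideal.mem_span_singleton'.1 hh
          refine ⟨g + g' * MvPolynomial.X (⟨s, hs⟩, ⟨v, hv⟩) ^ N,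
            Ideal.add_mem _ hg (Ideal.mul_mem_right _ _ hg'), q', ?_, by ring⟩
          refine (rsVanish_mul hvD (f := q') (g := MvPolynomial.X (⟨s, hs⟩, ⟨v, hv⟩)) ?_).resolve_right
            (not_rsVanish_X hvD hs hv)
          intro e U V huv
          have e1 := hq e U V huv
          rwa [map_add, rsVanish_of_mem hg' e U V huv, zero_add] at e1
      intro hf
      by_cases hvD : v ∈ D
      · exact hprime D hD hvD f hf
      have h1 := ihv D hD f hf.of_succ
      have hc : cnt D (v + 1) = cnt D v := by rw [cnt_succ, if_neg hvD, add_zero]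
      rw [rsIdeal_succ D hs hv] at h1
      by_cases h0 : cnt D v = 0
      · rw [sup_eq_left.2] at h1
        · exact h1
        · rw [Ideal.span_singleton_le_iff_mem]
          exact X_mem_rsIdeal hs hv (by omega)
      obtain ⟨u, hu, huv, hmax⟩ := exists_max_pivot h0
      obtain ⟨g, hg, h, hh, rfl⟩ := Submodule.mem_sup.1 h1
      obtain ⟨q, rfl⟩ := Ideal.mem_span_singleton'.1 hh
      refine Ideal.add_mem _ hg ?_
      have hle : ∀ j, cnt (insert v (D.erase u)) j ≤ cnt D j := fun j => by
        rw [← cnt_move hu hvD huv j]; omega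
      have hD' : ∀ w ∈ insert v (D.erase u), w < m := by
        intro w hw
        rw [Finset.mem_insert, Finset.mem_erase] at hw
        rcases hw with rfl | hw
        · exact hv
        · exact hD w hw.2
      rw [mul_comm]
      refine mul_rsIdeal_move_le hs hv hu hvD huv hmax (hprime _ hD' (Finset.mem_insert_self _ _) q ?_)
      refine (rsVanish_mul (Finset.mem_insert_self _ _) (g := MvPolynomial.X (⟨s, hs⟩, ⟨v, hv⟩))
        ?_).resolve_right (not_rsVanish_X (Finset.mem_insert_self _ _) hs hv)
      have e2 := hf.of_cnt_le hle (by
        have := cnt_move hu hvD huv (v + 1)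
        rw [if_neg (by omega)] at this
        omega)
      intro e U V hUV
      have e1 := e2 e U V hUV
      rwa [map_add, rsVanish_of_mem (rsIdeal_mono_left hle hg) e U V hUV, zero_add] at e1

end GenericMatrix

section ExtVanishing

open CategoryTheory.Abelian

variable {S : Type} [CommRing S]

/-- Vanishing of `Ext^i_S(M, N)`. -/
def ExtZero (S : Type) [CommRing S] (M N : Type) [AddCommGroup M] [Module S M]
    [AddCommGroup N] [Module S N] (i : ℕ) : Prop :=
  ∀ e : Ext (ModuleCat.of S M) (ModuleCat.of S N) i, e = 0

variable {A B C N : Type} [AddCommGroup A] [Module S A] [AddCommGroup B] [Module S B]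
  [AddCommGroup C] [Module S C] [AddCommGroup N] [Module S N]

/-- The short complex of modules attached to an exact pair of linear maps. -/
abbrev sesOf {f : A →ₗ[S] B} {g : B →ₗ[S] C} (h : Function.Exact f g) :
    ShortComplex (ModuleCat.{0} S) :=
  ModuleCat.shortComplexOfCompEqZero f g h.linearMap_comp_eq_zero

lemma sesOf_shortExact {f : A →ₗ[S] B} {g : B →ₗ[S] C} (h : Function.Exact f g)
    (hf : Function.Injective f) (hg : Function.Surjective g) : (sesOf h).ShortExact where
  exact := ModuleCat.shortComplex_exact _ h
  mono_f := (ModuleCat.mono_iff_injective _).2 hf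
  epi_g := (ModuleCat.epi_iff_surjective _).2 hg

section Contravariant

variable {f : A →ₗ[S] B} {g : B →ₗ[S] C}

lemma ExtZero.contra_left
    (h : Function.Exact f g) (hf : Function.Injective f) (hg : Function.Surjective g)
    {i : ℕ} (hB : ExtZero S B N i) (hC : ExtZero S C N (i + 1)) :
    ExtZero S A N i := fun e => by
  obtain ⟨x, hx⟩ := Ext.contravariant_sequence_exact₁ (sesOf_shortExact h hf hg)
    (ModuleCat.of S N) e (add_comm 1 i) (hC _)
  rw [← hx, hB x, Ext.comp_zero]

lemma ExtZero.contra_mid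
    (h : Function.Exact f g) (hf : Function.Injective f) (hg : Function.Surjective g)
    {i : ℕ} (hA : ExtZero S A N i) (hC : ExtZero S C N i) :
    ExtZero S B N i := fun e => by
  obtain ⟨x, hx⟩ := Ext.contravariant_sequence_exact₂ (sesOf_shortExact h hf hg)
    (ModuleCat.of S N) e (hA _)
  rw [← hx, hC x, Ext.comp_zero]

lemma ExtZero.contra_right
    (h : Function.Exact f g) (hf : Function.Injective f) (hg : Function.Surjective g)
    {i : ℕ} (hA : ExtZero S A N i) (hB : ExtZero S B N (i + 1)) :
    ExtZero S C N (i + 1) := fun e => by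
  obtain ⟨x, hx⟩ := Ext.contravariant_sequence_exact₃ (sesOf_shortExact h hf hg)
    (ModuleCat.of S N) e (hB _) (add_comm 1 i)
  rw [← hx, hA x, Ext.comp_zero]

lemma ExtZero.co_mid
    (h : Function.Exact f g) (hf : Function.Injective f) (hg : Function.Surjective g)
    {i : ℕ} (hA : ExtZero S N A i) (hC : ExtZero S N C i) :
    ExtZero S N B i := fun e => by
  obtain ⟨x, hx⟩ := Ext.covariant_sequence_exact₂ (ModuleCat.of S N) (sesOf_shortExact h hf hg)
    e (hC _)
  rw [← hx, hA x, Ext.zero_comp]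

lemma ExtZero.co_right
    (h : Function.Exact f g) (hf : Function.Injective f) (hg : Function.Surjective g)
    {i : ℕ} (hA : ExtZero S N A (i + 1)) (hB : ExtZero S N B i) :
    ExtZero S N C i := fun e => by
  obtain ⟨x, hx⟩ := Ext.covariant_sequence_exact₃ (ModuleCat.of S N) (sesOf_shortExact h hf hg)
    e rfl (hA _)
  rw [← hx, hB x, Ext.zero_comp]

end Contravariant

lemma ExtZero.of_equiv_left (e : A ≃ₗ[S] B) {i : ℕ} (hA : ExtZero S A N i) :
    ExtZero S B N i := fun x => by
  have h1 : x = (Ext.mk₀ (ModuleCat.ofHom e.symm.toLinearMap)).comp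
      ((Ext.mk₀ (ModuleCat.ofHom e.toLinearMap)).comp x (zero_add i)) (zero_add i) := by
    rw [Ext.mk₀_comp_mk₀_assoc, ← ModuleCat.ofHom_comp]
    simp
  rw [h1, hA ((Ext.mk₀ (ModuleCat.ofHom e.toLinearMap)).comp x (zero_add i)), Ext.comp_zero]

lemma ExtZero.of_equiv_right (e : A ≃ₗ[S] B) {i : ℕ} (hA : ExtZero S N A i) :
    ExtZero S N B i := fun x => by
  have h1 : x = (x.comp (Ext.mk₀ (ModuleCat.ofHom e.symm.toLinearMap)) (add_zero i)).comp
      (Ext.mk₀ (ModuleCat.ofHom e.toLinearMap)) (add_zero i) := by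
    rw [Ext.comp_assoc_of_third_deg_zero, Ext.mk₀_comp_mk₀, ← ModuleCat.ofHom_comp]
    simp
  rw [h1, hA (x.comp _ _), Ext.zero_comp]

lemma extZero_of_projective [Module.Projective S A] (i : ℕ) : ExtZero S A N (i + 1) := fun e => by
  have : Projective (ModuleCat.of S A) := (IsProjective.iff_projective (R := S) A).1 inferInstance
  exact Ext.eq_zero_of_projective e

lemma extZero_zero_iff : ExtZero S A N 0 ↔ ∀ φ : A →ₗ[S] N, φ = 0 := by
  constructor
  · intro h φ
    have := h (Ext.mk₀ (ModuleCat.ofHom φ))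
    rw [Ext.mk₀_eq_zero_iff] at this
    exact ModuleCat.hom_ext_iff.1 this
  · intro h e
    obtain ⟨φ, rfl⟩ := Ext.mk₀_bijective _ _ |>.2 e
    have : φ = 0 := ModuleCat.hom_ext (h φ.hom)
    rw [this, Ext.mk₀_zero]

lemma extZero_prod {A' : Type} [AddCommGroup A'] [Module S A'] {i : ℕ}
    (h1 : ExtZero S A N i) (h2 : ExtZero S A' N i) : ExtZero S (A × A') N i :=
  ExtZero.contra_mid (f := LinearMap.inl S A A') (g := LinearMap.snd S A A')
    Function.Exact.inl_snd LinearMap.inl_injective LinearMap.snd_surjective h1 h2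

/-- If `Ext^1(B/A, N) = 0` with `A ⊆ B`, homs extend. -/
lemma exists_extend_of_extZero {f : A →ₗ[S] B} {g : B →ₗ[S] C} (h : Function.Exact f g)
    (hf : Function.Injective f) (hg : Function.Surjective g) (hC : ExtZero S C N 1)
    (φ : A →ₗ[S] N) : ∃ φ' : B →ₗ[S] N, φ'.comp f = φ := by
  obtain ⟨x, hx⟩ := Ext.contravariant_sequence_exact₁ (sesOf_shortExact h hf hg)
    (ModuleCat.of S N) (Ext.mk₀ (ModuleCat.ofHom φ)) (add_comm 1 0) (hC _)
  obtain ⟨φ', rfl⟩ := Ext.mk₀_bijective _ _ |>.2 x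
  rw [Ext.mk₀_comp_mk₀] at hx
  have := (Ext.mk₀_bijective _ _).1 hx
  exact ⟨φ'.hom, ModuleCat.hom_ext_iff.1 this⟩

lemma extZero_one_of_extend {f : A →ₗ[S] B} {g : B →ₗ[S] C} (h : Function.Exact f g)
    (hf : Function.Injective f) (hg : Function.Surjective g) (hB : ExtZero S B N 1)
    (hφ : ∀ φ : A →ₗ[S] N, ∃ φ' : B →ₗ[S] N, φ'.comp f = φ) : ExtZero S C N 1 := fun e => by
  obtain ⟨x, hx⟩ := Ext.contravariant_sequence_exact₃ (sesOf_shortExact h hf hg)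
    (ModuleCat.of S N) e (hB _) (add_comm 1 0)
  obtain ⟨φ, rfl⟩ := Ext.mk₀_bijective _ _ |>.2 x
  obtain ⟨φ', hφ'⟩ := hφ φ.hom
  have : φ = (sesOf h).f ≫ ModuleCat.ofHom φ' := ModuleCat.hom_ext hφ'.symm
  rw [← hx, this, ← Ext.mk₀_comp_mk₀, ShortComplex.ShortExact.extClass_comp_assoc]

/-- Multiplication by `x` is surjective on `Ext^i_S(M, N)`. -/
def ExtSurj (S : Type) [CommRing S] (x : S) (M N : Type) [AddCommGroup M] [Module S M]
    [AddCommGroup N] [Module S N] (i : ℕ) : Prop :=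
  ∀ e : Ext (ModuleCat.of S M) (ModuleCat.of S N) i, ∃ e', e = x • e'

lemma ExtSurj.of_extZero {x : S} {g : A →ₗ[S] C} (h : Function.Exact (LinearMap.lsmul S A x) g)
    (hf : Function.Injective (LinearMap.lsmul S A x)) (hg : Function.Surjective g) {i : ℕ}
    (hC : ExtZero S C N (i + 1)) : ExtSurj S x A N i := fun e => by
  obtain ⟨y, hy⟩ := Ext.contravariant_sequence_exact₁ (sesOf_shortExact h hf hg)
    (ModuleCat.of S N) e (add_comm 1 i) (hC _)
  refine ⟨y, ?_⟩
  have : (sesOf h).f = x • 𝟙 (ModuleCat.of S A) := rfl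
  rw [← hy, this, Ext.mk₀_smul, Ext.smul_comp, Ext.mk₀_id_comp]

lemma ExtSurj.extZero_of_smul_eq_zero {x : S} {i : ℕ} (h : ExtSurj S x A N i)
    (hN : ∀ y : N, x • y = 0) : ExtZero S A N i := fun e => by
  obtain ⟨e', rfl⟩ := h e
  have : x • 𝟙 (ModuleCat.of S N) = 0 := by
    ext y
    exact hN y
  rw [Ext.smul_eq_comp_mk₀, this, Ext.mk₀_zero, Ext.comp_zero]

lemma ExtSurj.zero_exists {x : S} (h : ExtSurj S x A N 0) (φ : A →ₗ[S] N) :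
    ∃ φ' : A →ₗ[S] N, φ = x • φ' := by
  obtain ⟨e', he⟩ := h (Ext.mk₀ (ModuleCat.ofHom φ))
  obtain ⟨φ', rfl⟩ := Ext.mk₀_bijective _ _ |>.2 e'
  rw [← Ext.mk₀_smul] at he
  have := (Ext.mk₀_bijective _ _).1 he
  exact ⟨φ'.hom, ModuleCat.hom_ext_iff.1 this⟩

lemma ExtZero.of_smul_left {x : S} {g : B →ₗ[S] C} (h : Function.Exact (LinearMap.lsmul S B x) g)
    (hf : Function.Injective (LinearMap.lsmul S B x)) (hg : Function.Surjective g)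
    (hN : ∀ y : N, x • y = 0) {i : ℕ} (hC : ∀ j < i, ExtZero S N C j) : ExtZero S N B i := by
  have hs := sesOf_shortExact h hf hg
  intro e
  have h0 : e.comp (Ext.mk₀ (sesOf h).f) (add_zero i) = 0 := by
    have : (sesOf h).f = x • 𝟙 (ModuleCat.of S B) := rfl
    rw [this, ← Ext.smul_eq_comp_mk₀]
    have h1 : x • 𝟙 (ModuleCat.of S N) = 0 := by
      ext y
      exact hN y
    have h2 : x • e = (x • Ext.mk₀ (𝟙 (ModuleCat.of S N))).comp e (zero_add i) := by
      rw [Ext.smul_comp, Ext.mk₀_id_comp]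
    rw [h2, ← Ext.mk₀_smul, h1, Ext.mk₀_zero, Ext.zero_comp]
  cases i with
  | zero =>
    have hm : Mono (sesOf h).f := hs.mono_f
    apply Ext.postcomp_mk₀_injective_of_mono (ModuleCat.of S N) (sesOf h).f
    rw [map_zero]
    exact h0
  | succ i =>
    obtain ⟨y, hy⟩ := Ext.covariant_sequence_exact₁ (ModuleCat.of S N) hs e h0 rfl
    rw [← hy, hC i (Nat.lt_succ_self i) y, Ext.zero_comp]

section Shift

variable {f : A →ₗ[S] B} {g : B →ₗ[S] C} [Module.Projective S B]

lemma ExtSurj.one_exists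
    (h : Function.Exact f g) (hf : Function.Injective f) (hg : Function.Surjective g)
    {x : S} (hC : ExtSurj S x C N 1) (φ : A →ₗ[S] N) :
    ∃ (φ' : A →ₗ[S] N) (u : B →ₗ[S] N), φ = x • φ' + u.comp f := by
  have hs := sesOf_shortExact h hf hg
  obtain ⟨e', he⟩ := hC (hs.extClass.comp (Ext.mk₀ (ModuleCat.ofHom φ)) (add_zero 1))
  obtain ⟨y, hy⟩ := Ext.contravariant_sequence_exact₃ hs (ModuleCat.of S N) e'
    (extZero_of_projective 0 _) (add_comm 1 0)
  obtain ⟨φ', rfl⟩ := Ext.mk₀_bijective _ _ |>.2 y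
  obtain ⟨z, hz⟩ := Ext.contravariant_sequence_exact₁ hs
    (ModuleCat.of S N) (Ext.mk₀ (ModuleCat.ofHom φ) - x • Ext.mk₀ φ') (add_comm 1 0) (by
      rw [sub_eq_add_neg, Ext.comp_add, Ext.comp_neg, he, Ext.comp_smul, hy, add_neg_cancel])
  obtain ⟨u, rfl⟩ := Ext.mk₀_bijective _ _ |>.2 z
  refine ⟨φ'.hom, u.hom, ?_⟩
  rw [Ext.mk₀_comp_mk₀, eq_sub_iff_add_eq, ← Ext.mk₀_smul, ← Ext.mk₀_add] at hz
  have := ModuleCat.hom_ext_iff.1 ((Ext.mk₀_bijective _ _).1 hz)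
  rw [add_comm]
  exact this.symm

lemma ExtSurj.shift
    (h : Function.Exact f g) (hf : Function.Injective f) (hg : Function.Surjective g)
    {x : S} {i : ℕ} (hC : ExtSurj S x C N (i + 2)) :
    ExtSurj S x A N (i + 1) := fun e => by
  have hs := sesOf_shortExact h hf hg
  obtain ⟨e', he⟩ := hC (hs.extClass.comp e (by omega))
  obtain ⟨y, hy⟩ := Ext.contravariant_sequence_exact₃ hs (ModuleCat.of S N) e'
    (extZero_of_projective (i + 1) _) (show 1 + (i + 1) = i + 2 by omega)
  obtain ⟨z, hz⟩ := Ext.contravariant_sequence_exact₁ hs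
    (ModuleCat.of S N) (e - x • y) (show 1 + (i + 1) = i + 2 by omega) (by
      rw [sub_eq_add_neg, Ext.comp_add, Ext.comp_neg, he, Ext.comp_smul, hy, add_neg_cancel])
  refine ⟨y, ?_⟩
  have : z = 0 := extZero_of_projective i _
  rw [this, Ext.comp_zero] at hz
  exact (sub_eq_zero.1 hz.symm)

lemma ExtZero.shift_up
    (h : Function.Exact f g) (hf : Function.Injective f) (hg : Function.Surjective g)
    {i : ℕ} (hA : ExtZero S A N (i + 1)) : ExtZero S C N (i + 2) :=
  ExtZero.contra_right h hf hg hA (extZero_of_projective _)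

lemma ExtZero.shift_down
    (h : Function.Exact f g) (hf : Function.Injective f) (hg : Function.Surjective g)
    {i : ℕ} (hC : ExtZero S C N (i + 2)) : ExtZero S A N (i + 1) :=
  ExtZero.contra_left h hf hg (extZero_of_projective _) hC

end Shift

section Quotients

lemma exact_lsmul_factor (J : Ideal S) (x : S) :
    Function.Exact (LinearMap.lsmul S (S ⧸ J) x)
      (Submodule.factor (le_sup_left : J ≤ J ⊔ Ideal.span {x})) := by
  intro y
  obtain ⟨y, rfl⟩ := Submodule.Quotient.mk_surjective J y
  change Submodule.factor _ (Submodule.mkQ J y) = 0 ↔ _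
  rw [Submodule.factor_mk, Submodule.mkQ_apply, Submodule.Quotient.mk_eq_zero, sup_comm, Submodule.mem_sup]
  constructor
  · rintro ⟨u, hu, v, hv, rfl⟩
    obtain ⟨w, rfl⟩ := Ideal.mem_span_singleton'.1 hu
    refine ⟨Submodule.Quotient.mk w, ?_⟩
    rw [LinearMap.lsmul_apply, ← Submodule.Quotient.mk_smul, Submodule.Quotient.eq, smul_eq_mul,
      mul_comm]
    simpa using J.neg_mem hv
  · rintro ⟨w, hw⟩
    obtain ⟨w, rfl⟩ := Submodule.Quotient.mk_surjective J w
    rw [LinearMap.lsmul_apply, ← Submodule.Quotient.mk_smul, Submodule.Quotient.eq] at hw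
    exact ⟨x * w, Ideal.mem_span_singleton'.2 ⟨w, mul_comm _ _⟩, y - x * w, by
      rw [← neg_sub]; exact J.neg_mem hw, by ring⟩

lemma injective_lsmul_quotient {J : Ideal S} {x : S} (h : ∀ f, x * f ∈ J → f ∈ J) :
    Function.Injective (LinearMap.lsmul S (S ⧸ J) x) := by
  rw [← LinearMap.ker_eq_bot, LinearMap.ker_eq_bot']
  intro y hy
  obtain ⟨y, rfl⟩ := Submodule.Quotient.mk_surjective J y
  rw [LinearMap.lsmul_apply, ← Submodule.Quotient.mk_smul, Submodule.Quotient.mk_eq_zero] at hy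
  exact (Submodule.Quotient.mk_eq_zero _).2 (h _ hy)

/-- `0 → S/(P ∩ Q) → S/P × S/Q → S/(P + Q) → 0`. -/
def quotInfToProd (P Q : Ideal S) : (S ⧸ (P ⊓ Q)) →ₗ[S] (S ⧸ P) × (S ⧸ Q) :=
  (Submodule.factor inf_le_left).prod (Submodule.factor inf_le_right)

/-- The difference map `S/P × S/Q → S/(P + Q)`. -/
def quotProdToSup (P Q : Ideal S) : (S ⧸ P) × (S ⧸ Q) →ₗ[S] (S ⧸ (P ⊔ Q)) :=
  (Submodule.factor le_sup_left).coprod (-(Submodule.factor le_sup_right))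

lemma quotInfToProd_injective (P Q : Ideal S) : Function.Injective (quotInfToProd P Q) := by
  rw [← LinearMap.ker_eq_bot, LinearMap.ker_eq_bot']
  intro y hy
  obtain ⟨y, rfl⟩ := Submodule.Quotient.mk_surjective _ y
  have h1 := congrArg Prod.fst hy
  have h2 := congrArg Prod.snd hy
  rw [Submodule.Quotient.mk_eq_zero]
  exact ⟨(Submodule.Quotient.mk_eq_zero _).1 h1, (Submodule.Quotient.mk_eq_zero _).1 h2⟩

lemma quotProdToSup_surjective (P Q : Ideal S) : Function.Surjective (quotProdToSup P Q) := by
  intro y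
  obtain ⟨y, rfl⟩ := Submodule.factor_surjective (le_sup_left : P ≤ P ⊔ Q) y
  exact ⟨(y, 0), by simp [quotProdToSup]⟩

lemma quotInf_exact (P Q : Ideal S) :
    Function.Exact (quotInfToProd P Q) (quotProdToSup P Q) := by
  rintro ⟨y, z⟩
  obtain ⟨y, rfl⟩ := Submodule.Quotient.mk_surjective _ y
  obtain ⟨z, rfl⟩ := Submodule.Quotient.mk_surjective _ z
  constructor
  · intro h
    have : (Submodule.Quotient.mk (p := P ⊔ Q) y) - Submodule.Quotient.mk z = 0 := by
      rw [sub_eq_add_neg]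
      exact h
    rw [← Submodule.Quotient.mk_sub, Submodule.Quotient.mk_eq_zero, Submodule.mem_sup] at this
    obtain ⟨u, hu, v, hv, huv⟩ := this
    refine ⟨Submodule.Quotient.mk (y - u), ?_⟩
    refine Prod.ext ?_ ?_
    · refine (Submodule.Quotient.eq _).2 ?_
      simpa using P.neg_mem hu
    · refine (Submodule.Quotient.eq _).2 ?_
      have : y - u - z = v := by rw [← sub_eq_iff_eq_add'.2 huv.symm]; ring
      change y - u - z ∈ Q
      rw [this]; exact hv
  · rintro ⟨w, hw⟩
    obtain ⟨w, rfl⟩ := Submodule.Quotient.mk_surjective _ w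
    rw [← hw]
    change (Submodule.Quotient.mk (p := P ⊔ Q) w) + -Submodule.Quotient.mk w = 0
    exact add_neg_cancel _

end Quotients

end ExtVanishing

section Weighted

variable {K σ : Type} [Field K]

attribute [local instance] MvPolynomial.gradedAlgebra in
lemma homogeneousComponent_mul_of_isHomogeneous {f g : MvPolynomial σ K} {e : ℕ}
    (hg : g.IsHomogeneous e) (d : ℕ) :
    MvPolynomial.homogeneousComponent d (f * g) =
      if e ≤ d then MvPolynomial.homogeneousComponent (d - e) f * g else 0 := by
  have h := DirectSum.coe_decompose_mul_of_right_mem (MvPolynomial.homogeneousSubmodule σ K)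
    (a := f) (b := g) (i := e) d hg
  have hd (f : MvPolynomial σ K) (d : ℕ) :
      ((DirectSum.decompose (MvPolynomial.homogeneousSubmodule σ K) f) d : MvPolynomial σ K) =
        MvPolynomial.homogeneousComponent d f := MvPolynomial.decomposition.decompose'_apply f d
  rwa [hd, hd] at h

/-- Homogeneous elements of degree `e` in the free module whose `i`-th basis element has
degree `w i`. -/
def IsHomVec {b : ℕ} (w : Fin b → ℕ) (e : ℕ) (u : Fin b → MvPolynomial σ K) : Prop :=
  ∀ i, (w i ≤ e → (u i).IsHomogeneous (e - w i)) ∧ (e < w i → u i = 0)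

/-- The degree `d` component of an element of a graded free module. -/
def vecComp {b : ℕ} (w : Fin b → ℕ) (d : ℕ) :
    (Fin b → MvPolynomial σ K) →ₗ[K] (Fin b → MvPolynomial σ K) :=
  LinearMap.pi fun i => if w i ≤ d then
    (MvPolynomial.homogeneousComponent (d - w i)) ∘ₗ LinearMap.proj i else 0

lemma vecComp_apply {b : ℕ} (w : Fin b → ℕ) (d : ℕ) (u : Fin b → MvPolynomial σ K) (i : Fin b) :
    vecComp w d u i =
      if w i ≤ d then MvPolynomial.homogeneousComponent (d - w i) (u i) else 0 := by
  unfold vecComp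
  rw [LinearMap.pi_apply]
  split_ifs <;> simp

lemma vecComp_smul_of_isHomVec {b : ℕ} {w : Fin b → ℕ} {e : ℕ} {u : Fin b → MvPolynomial σ K}
    (hu : IsHomVec w e u) (f : MvPolynomial σ K) (d : ℕ) :
    vecComp w d (f • u) =
      (if e ≤ d then MvPolynomial.homogeneousComponent (d - e) f else 0) • u := by
  funext i
  rw [vecComp_apply]
  simp only [Pi.smul_apply, smul_eq_mul]
  rcases le_or_gt (w i) e with h | h
  · rw [homogeneousComponent_mul_of_isHomogeneous ((hu i).1 h)]
    by_cases hd : e ≤ d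
    · rw [if_pos (h.trans hd), if_pos (by omega), if_pos hd, show d - w i - (e - w i) = d - e by omega]
    · rw [if_neg hd, zero_mul]
      split_ifs with h1 h2
      · omega
      · rfl
      · rfl
  · rw [(hu i).2 h]
    simp

lemma isHomVec_vecComp {b : ℕ} (w : Fin b → ℕ) (d : ℕ) (u : Fin b → MvPolynomial σ K) :
    IsHomVec w d (vecComp w d u) := by
  intro i
  rw [vecComp_apply]
  refine ⟨fun h => ?_, fun h => ?_⟩
  · rw [if_pos h]
    exact MvPolynomial.homogeneousComponent_isHomogeneous _ _
  · rw [if_neg (by omega)]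

lemma exists_sum_vecComp {b : ℕ} (w : Fin b → ℕ) (u : Fin b → MvPolynomial σ K) :
    ∃ D, ∀ D', D ≤ D' → ∑ d ∈ Finset.range D', vecComp w d u = u := by
  refine ⟨∑ i, (w i + (u i).totalDegree + 1), fun D' hD => funext fun i => ?_⟩
  rw [Finset.sum_apply]
  have h1 : w i + (u i).totalDegree + 1 ≤ D' :=
    (Finset.single_le_sum (f := fun i => w i + (u i).totalDegree + 1)
      (fun _ _ => Nat.zero_le _) (Finset.mem_univ i)).trans hD
  obtain ⟨k, rfl⟩ : ∃ k, D' = w i + k := ⟨D' - w i, by omega⟩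
  rw [Finset.sum_range_add]
  rw [Finset.sum_eq_zero, zero_add]
  · conv_rhs => rw [← MvPolynomial.sum_homogeneousComponent (u i)]
    rw [← Finset.sum_subset (Finset.range_mono (show (u i).totalDegree + 1 ≤ k by omega))]
    · refine Finset.sum_congr rfl fun d _ => ?_
      rw [vecComp_apply, if_pos (by omega), Nat.add_sub_cancel_left]
    · intro d _ hd
      rw [vecComp_apply, if_pos (by omega), Nat.add_sub_cancel_left]
      exact MvPolynomial.homogeneousComponent_eq_zero _ _ (by simpa using hd)
  · intro d hd
    rw [vecComp_apply, if_neg (by simpa using hd)]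

/-- Graded submodules of a graded free module. -/
def IsGradedSub {b : ℕ} (w : Fin b → ℕ)
    (N : Submodule (MvPolynomial σ K) (Fin b → MvPolynomial σ K)) : Prop :=
  ∀ u ∈ N, ∀ d, vecComp w d u ∈ N

/-- The map of free modules with prescribed images of the basis elements. -/
def genMap {b q : ℕ} (κ : Fin q → (Fin b → MvPolynomial σ K)) :
    (Fin q → MvPolynomial σ K) →ₗ[MvPolynomial σ K] (Fin b → MvPolynomial σ K) :=
  Fintype.linearCombination (MvPolynomial σ K) κ

lemma genMap_apply {b q : ℕ} (κ : Fin q → (Fin b → MvPolynomial σ K))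
    (u : Fin q → MvPolynomial σ K) : genMap κ u = ∑ j, u j • κ j := rfl

lemma range_genMap {b q : ℕ} (κ : Fin q → (Fin b → MvPolynomial σ K)) :
    LinearMap.range (genMap κ) = Submodule.span _ (Set.range κ) :=
  Fintype.range_linearCombination _ _

lemma vecComp_genMap {b q : ℕ} {w : Fin b → ℕ} {e : Fin q → ℕ}
    {κ : Fin q → (Fin b → MvPolynomial σ K)} (hκ : ∀ j, IsHomVec w (e j) (κ j)) (d : ℕ)
    (u : Fin q → MvPolynomial σ K) :
    vecComp w d (genMap κ u) = genMap κ (vecComp e d u) := by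
  rw [genMap_apply, genMap_apply, map_sum]
  refine Finset.sum_congr rfl fun j _ => ?_
  rw [vecComp_smul_of_isHomVec (hκ j), vecComp_apply]

lemma isGradedSub_range {b q : ℕ} {w : Fin b → ℕ} {e : Fin q → ℕ}
    {κ : Fin q → (Fin b → MvPolynomial σ K)} (hκ : ∀ j, IsHomVec w (e j) (κ j)) :
    IsGradedSub w (LinearMap.range (genMap κ)) := by
  rintro _ ⟨u, rfl⟩ d
  rw [vecComp_genMap hκ]
  exact LinearMap.mem_range_self _ _

lemma isGradedSub_ker {b q : ℕ} {w : Fin b → ℕ} {e : Fin q → ℕ}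
    {κ : Fin q → (Fin b → MvPolynomial σ K)} (hκ : ∀ j, IsHomVec w (e j) (κ j)) :
    IsGradedSub e (LinearMap.ker (genMap κ)) := by
  intro u hu d
  rw [LinearMap.mem_ker] at hu ⊢
  rw [← vecComp_genMap hκ, hu, map_zero]

lemma IsGradedSub.exists_gens [Finite σ] {b : ℕ} {w : Fin b → ℕ}
    {N : Submodule (MvPolynomial σ K) (Fin b → MvPolynomial σ K)} (hN : IsGradedSub w N) :
    ∃ (q : ℕ) (e : Fin q → ℕ) (κ : Fin q → (Fin b → MvPolynomial σ K)),
      (∀ j, IsHomVec w (e j) (κ j)) ∧ LinearMap.range (genMap κ) = N := by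
  have hspan : Submodule.span (MvPolynomial σ K) {v | v ∈ N ∧ ∃ e, IsHomVec w e v} = N := by
    refine le_antisymm (Submodule.span_le.2 fun v hv => hv.1) fun u hu => ?_
    obtain ⟨D, hD⟩ := exists_sum_vecComp w u
    rw [← hD D le_rfl]
    exact Submodule.sum_mem _ fun d _ =>
      Submodule.subset_span ⟨hN u hu d, d, isHomVec_vecComp w d u⟩
  have hfg : N.FG := IsNoetherian.noetherian N
  rw [← hspan, Submodule.fg_span_iff_fg_span_finset_subset] at hfg
  obtain ⟨T, hT, hTs⟩ := hfg
  have hc : ∀ v : T, ∃ e, IsHomVec w e (v : Fin b → MvPolynomial σ K) := fun v => (hT v.2).2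
  choose e he using hc
  refine ⟨T.card, fun j => e (T.equivFin.symm j), fun j => (T.equivFin.symm j : _),
    fun j => he _, ?_⟩
  rw [range_genMap, ← hspan, hTs]
  congr 1
  ext v
  constructor
  · rintro ⟨j, rfl⟩
    exact (T.equivFin.symm j).2
  · intro hv
    exact ⟨T.equivFin ⟨v, hv⟩, by simp⟩

lemma IsGradedSub.exists_min_gens [Finite σ] {b : ℕ} {w : Fin b → ℕ}
    {N : Submodule (MvPolynomial σ K) (Fin b → MvPolynomial σ K)} (hN : IsGradedSub w N) :
    ∃ (q : ℕ) (e : Fin q → ℕ) (κ : Fin q → (Fin b → MvPolynomial σ K)),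
      (∀ j, IsHomVec w (e j) (κ j)) ∧ LinearMap.range (genMap κ) = N ∧
      ∀ u, genMap κ u = 0 → ∀ j, MvPolynomial.constantCoeff (u j) = 0 := by
  classical
  have hex := hN.exists_gens
  obtain ⟨e, κ, hκ, hr⟩ := Nat.find_spec hex
  have hmin := fun q' (h : q' < Nat.find hex) => Nat.find_min hex h
  generalize Nat.find hex = q at e κ hκ hr hmin
  refine ⟨q, e, κ, hκ, hr, fun u hu j => ?_⟩
  by_contra hne
  obtain ⟨q, rfl⟩ : ∃ q', q = q' + 1 := ⟨q - 1, by have := j.2; omega⟩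
  refine hmin q (Nat.lt_succ_self q) ⟨e ∘ j.succAbove, κ ∘ j.succAbove, fun i => hκ _, ?_⟩
  set u' := vecComp e (e j) u with hu'
  have h0 : genMap κ u' = 0 := by
    rw [hu', ← vecComp_genMap hκ, hu, map_zero]
  have hj : u' j = MvPolynomial.C (MvPolynomial.constantCoeff (u j)) := by
    rw [hu', vecComp_apply, if_pos le_rfl, Nat.sub_self, MvPolynomial.homogeneousComponent_zero]
    rfl
  rw [genMap_apply, Fin.sum_univ_succAbove _ j, hj] at h0
  have hmem : κ j ∈ LinearMap.range (genMap (κ ∘ j.succAbove)) := by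
    refine ⟨fun i => - (MvPolynomial.C (MvPolynomial.constantCoeff (u j))⁻¹ * u' (j.succAbove i)), ?_⟩
    rw [genMap_apply]
    have h2 : κ j = (MvPolynomial.C (MvPolynomial.constantCoeff (u j))⁻¹ : MvPolynomial σ K) •
        ((MvPolynomial.C (MvPolynomial.constantCoeff (u j)) : MvPolynomial σ K) • κ j) := by
      rw [smul_smul, ← MvPolynomial.C_mul, inv_mul_cancel₀ hne, MvPolynomial.C_1, one_smul]
    rw [h2, eq_neg_of_add_eq_zero_left h0, smul_neg, Finset.smul_sum, ← Finset.sum_neg_distrib]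
    refine Finset.sum_congr rfl fun i _ => ?_
    rw [smul_smul, neg_smul]
    rfl
  rw [← hr]
  apply le_antisymm
  · rw [range_genMap, range_genMap]
    exact Submodule.span_mono (by rintro _ ⟨i, rfl⟩; exact ⟨_, rfl⟩)
  · rw [range_genMap κ, Submodule.span_le]
    rintro _ ⟨i, rfl⟩
    rcases eq_or_ne i j with rfl | hij
    · exact hmem
    · obtain ⟨i', rfl⟩ := Fin.exists_succAbove_eq hij
      rw [SetLike.mem_coe, range_genMap]
      exact Submodule.subset_span ⟨i', rfl⟩

/-- Graded Krull intersection. -/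
lemma IsGradedSub.mem_of_forall_pow {b : ℕ} {w : Fin b → ℕ}
    {N : Submodule (MvPolynomial σ K) (Fin b → MvPolynomial σ K)} (hN : IsGradedSub w N) (x : σ)
    {u : Fin b → MvPolynomial σ K}
    (hu : ∀ n, ∃ v ∈ N, ∃ z, u = v + (MvPolynomial.X x ^ n : MvPolynomial σ K) • z) : u ∈ N := by
  obtain ⟨D, hD⟩ := exists_sum_vecComp w u
  rw [← hD D le_rfl]
  refine Submodule.sum_mem _ fun d hd => ?_
  obtain ⟨v, hv, z, hz⟩ := hu (d + 1)
  have h0 : vecComp w d ((MvPolynomial.X x ^ (d + 1) : MvPolynomial σ K) • z) = 0 := by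
    funext i
    rw [vecComp_apply]
    split_ifs with h
    · rw [Pi.smul_apply, smul_eq_mul, mul_comm,
        homogeneousComponent_mul_of_isHomogeneous (MvPolynomial.isHomogeneous_X_pow x (d + 1)),
        if_neg (by omega)]
      rfl
    · rfl
  rw [hz, map_add, h0, add_zero]
  exact hN v hv d

end Weighted

section GradedExt

variable {K σ : Type} [Field K]

lemma eq_zero_of_forall_X_pow (x : σ) {f : MvPolynomial σ K}
    (hf : ∀ n, ∃ g, f = MvPolynomial.X x ^ n * g) : f = 0 := by
  have h : (fun _ : Fin 1 => f) ∈
      (⊥ : Submodule (MvPolynomial σ K) (Fin 1 → MvPolynomial σ K)) := by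
    refine IsGradedSub.mem_of_forall_pow (w := fun _ => 0) (fun u hu d => ?_) x fun n => ?_
    · rw [Submodule.mem_bot] at hu ⊢
      rw [hu, map_zero]
    · obtain ⟨g, hg⟩ := hf n
      exact ⟨0, Submodule.zero_mem _, fun _ => g, by funext; simpa using hg⟩
  exact congrFun ((Submodule.mem_bot _).1 h) 0

lemma ExtSurj.of_equiv_left {S : Type} [CommRing S] {A B N : Type} [AddCommGroup A] [Module S A]
    [AddCommGroup B] [Module S B] [AddCommGroup N] [Module S N] (e : A ≃ₗ[S] B) {x : S} {i : ℕ}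
    (hA : ExtSurj S x A N i) : ExtSurj S x B N i := fun y => by
  open CategoryTheory.Abelian in
  obtain ⟨z, hz⟩ := hA ((Ext.mk₀ (ModuleCat.ofHom e.toLinearMap)).comp y (zero_add i))
  refine ⟨(Ext.mk₀ (ModuleCat.ofHom e.symm.toLinearMap)).comp z (zero_add i), ?_⟩
  rw [← Ext.comp_smul, ← hz, Ext.mk₀_comp_mk₀_assoc, ← ModuleCat.ofHom_comp]
  simp

/-- The quotient by the relations between generators of a submodule. -/
def quotKerEquiv {S : Type} [CommRing S] {b q : ℕ} {f : (Fin q → S) →ₗ[S] (Fin b → S)}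
    {N : Submodule S (Fin b → S)} (h : LinearMap.range f = N) :
    ((Fin q → S) ⧸ LinearMap.ker f) ≃ₗ[S] N :=
  f.quotKerEquivRange.trans (LinearEquiv.ofEq _ _ h)

lemma exact_subtype_mkQ' {S M : Type} [CommRing S] [AddCommGroup M] [Module S M]
    (N : Submodule S M) : Function.Exact N.subtype N.mkQ := by
  intro y
  simp

lemma isHomVec_transpose {b q : ℕ} {w : Fin b → ℕ} {e : Fin q → ℕ}
    {κ : Fin q → (Fin b → MvPolynomial σ K)} (hκ : ∀ j, IsHomVec w (e j) (κ j)) {E : ℕ}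
    (hE : ∀ j, e j ≤ E) (i : Fin b) :
    IsHomVec (fun j => E - e j) (E - w i) (fun j => κ j i) := by
  intro j
  have := hE j
  refine ⟨fun h => ?_, fun h => (hκ j i).2 (by simp only at h; omega)⟩
  simp only at h
  rcases le_or_gt (w i) (e j) with h1 | h1
  · rw [show E - w i - (E - e j) = e j - w i by omega]
    exact (hκ j i).1 h1
  · change (κ j i).IsHomogeneous _
    rw [(hκ j i).2 h1]
    exact MvPolynomial.isHomogeneous_zero _ _ _

theorem extZero_of_extSurj_graded [Finite σ] (x : σ) (i : ℕ) :
    ∀ {b : ℕ} {w : Fin b → ℕ} {N : Submodule (MvPolynomial σ K) (Fin b → MvPolynomial σ K)}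
      (_ : IsGradedSub w N)
      (_ : ExtSurj (MvPolynomial σ K) (MvPolynomial.X x)
        ((Fin b → MvPolynomial σ K) ⧸ N) (MvPolynomial σ K) i),
      ExtZero (MvPolynomial σ K) ((Fin b → MvPolynomial σ K) ⧸ N) (MvPolynomial σ K) i := by
  induction i with
  | zero =>
    intro b w N hN hs
    rw [extZero_zero_iff]
    intro φ
    refine LinearMap.ext fun y => ?_
    refine eq_zero_of_forall_X_pow x fun n => ?_
    have : ∃ φ', φ = (MvPolynomial.X x ^ n : MvPolynomial σ K) • φ' := by
      induction n with
      | zero => exact ⟨φ, by simp⟩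
      | succ n ih =>
        obtain ⟨φ', h'⟩ := ih
        obtain ⟨φ'', h''⟩ := hs.zero_exists φ'
        exact ⟨φ'', by rw [h', h'', smul_smul, ← pow_succ]⟩
    obtain ⟨φ', h'⟩ := this
    exact ⟨φ' y, by rw [h']; rfl⟩
  | succ i ih =>
    intro b w N hN hs
    have hex := exact_subtype_mkQ' N
    have hi := N.injective_subtype
    have hq := N.mkQ_surjective
    obtain ⟨q, e, κ, hκ, hr⟩ := hN.exists_gens
    cases i with
    | zero =>
      refine extZero_one_of_extend hex hi hq (extZero_of_projective 0) fun φ => ?_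
      have hn : ∀ n, ∃ (φ' : N →ₗ[MvPolynomial σ K] MvPolynomial σ K)
          (u : (Fin b → MvPolynomial σ K) →ₗ[MvPolynomial σ K] MvPolynomial σ K),
          φ = (MvPolynomial.X x ^ n : MvPolynomial σ K) • φ' + u.comp N.subtype := by
        intro n
        induction n with
        | zero => exact ⟨φ, 0, by simp⟩
        | succ n ih =>
          obtain ⟨φ', u, h'⟩ := ih
          obtain ⟨φ'', u', h''⟩ := ExtSurj.one_exists hex hi hq hs φ'
          refine ⟨φ'', (MvPolynomial.X x ^ n : MvPolynomial σ K) • u' + u, ?_⟩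
          rw [h', h'', smul_add, smul_smul, ← pow_succ, LinearMap.add_comp, add_assoc,
            LinearMap.smul_comp]
      have hκN : ∀ j, κ j ∈ N := fun j => by
        rw [← hr, range_genMap]; exact Submodule.subset_span ⟨j, rfl⟩
      have hE : ∀ j, e j ≤ ∑ j, e j := fun j =>
        Finset.single_le_sum (fun _ _ => Nat.zero_le _) (Finset.mem_univ j)
      have key : (fun j => φ ⟨κ j, hκN j⟩) ∈ LinearMap.range (genMap fun i j => κ j i) := by
        refine (isGradedSub_range (isHomVec_transpose hκ hE)).mem_of_forall_pow x fun n => ?_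
        obtain ⟨φ', u, h'⟩ := hn n
        refine ⟨_, ⟨fun i => u (Pi.single i 1), rfl⟩, fun j => φ' ⟨κ j, hκN j⟩, ?_⟩
        funext j
        rw [h', genMap_apply, Pi.add_apply, Finset.sum_apply]
        simp only [LinearMap.add_apply, LinearMap.smul_apply, LinearMap.comp_apply,
          Submodule.subtype_apply, Pi.smul_apply, smul_eq_mul]
        rw [add_comm, LinearMap.pi_apply_eq_sum_univ u (κ j)]
        congr 1
        refine Finset.sum_congr rfl fun i _ => ?_
        rw [smul_eq_mul, mul_comm]
        congr 2
        funext j'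
        simp [Pi.single_apply, eq_comm]
      obtain ⟨v, hv⟩ := key
      refine ⟨Fintype.linearCombination _ v, ?_⟩
      have heq : ∀ (z : Fin b → MvPolynomial σ K) (hz : z ∈ N),
          Fintype.linearCombination (MvPolynomial σ K) v z = φ ⟨z, hz⟩ := by
        intro z hz
        obtain ⟨c, rfl⟩ := hr ▸ hz
        have h1 : (⟨genMap κ c, hz⟩ : N) = ∑ j, c j • ⟨κ j, hκN j⟩ := by
          apply Subtype.ext
          rw [Submodule.coe_sum]
          rfl
        rw [h1, map_sum, genMap_apply, map_sum]
        refine Finset.sum_congr rfl fun j _ => ?_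
        rw [map_smul, map_smul]
        congr 1
        have := congrFun hv j
        rw [← this, genMap_apply, Finset.sum_apply, Fintype.linearCombination_apply]
        refine Finset.sum_congr rfl fun i _ => ?_
        simp [mul_comm]
      ext1 z
      exact heq z.1 z.2
    | succ i =>
      have h1 := ExtSurj.shift hex hi hq hs
      have h2 := h1.of_equiv_left (quotKerEquiv hr).symm
      have h3 := ih (isGradedSub_ker hκ) h2
      exact ExtZero.shift_up hex hi hq (h3.of_equiv_left (quotKerEquiv hr))

end GradedExt

section Perfection

variable {K σ : Type} [Field K]

/-- The residue field at the origin, as a module. -/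
abbrev ResField (K σ : Type) [Field K] : Type :=
  MvPolynomial σ K ⧸ (Ideal.span (Set.range (MvPolynomial.X : σ → MvPolynomial σ K)))

lemma X_smul_resField (x : σ) (y : ResField K σ) :
    (MvPolynomial.X x : MvPolynomial σ K) • y = 0 := by
  obtain ⟨y, rfl⟩ := Submodule.Quotient.mk_surjective _ y
  rw [← Submodule.Quotient.mk_smul, Submodule.Quotient.mk_eq_zero]
  exact Ideal.mul_mem_right _ _ (Ideal.subset_span ⟨x, rfl⟩)

/-- `S/J` is perfect of codimension `g` (in its homological formulation). -/
structure IsPerf (J : Ideal (MvPolynomial σ K)) (g : ℕ) : Prop where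
  res : ∀ i, g < i → ExtZero (MvPolynomial σ K) (MvPolynomial σ K ⧸ J) (ResField K σ) i
  self : ∀ i, i < g → ExtZero (MvPolynomial σ K) (MvPolynomial σ K ⧸ J) (MvPolynomial σ K) i

/-- An ideal as a submodule of the free module of rank one. -/
def idealSub {S : Type} [CommRing S] (J : Ideal S) : Submodule S (Fin 1 → S) :=
  Submodule.comap (LinearMap.proj 0) J

/-- The quotient of the free module of rank one by an ideal. -/
def idealSubEquiv {S : Type} [CommRing S] (J : Ideal S) :
    ((Fin 1 → S) ⧸ idealSub J) ≃ₗ[S] (S ⧸ J) :=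
  Submodule.Quotient.equiv _ _ (LinearEquiv.funUnique (Fin 1) S S) (by
    ext y
    constructor
    · rintro ⟨u, hu, rfl⟩
      exact hu
    · intro hy
      exact ⟨fun _ => y, hy, rfl⟩)

lemma isGradedSub_idealSub {J : Ideal (MvPolynomial σ K)}
    (hJ : ∀ f ∈ J, ∀ d, MvPolynomial.homogeneousComponent d f ∈ J) :
    IsGradedSub (fun _ => 0) (idealSub J) := by
  intro u hu d
  change vecComp (fun _ => 0) d u 0 ∈ J
  rw [vecComp_apply, if_pos (Nat.zero_le _)]
  exact hJ _ hu _

lemma IsPerf.of_sup_X [Finite σ] {J : Ideal (MvPolynomial σ K)} {g : ℕ} {x : σ}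
    (hJ : ∀ f ∈ J, ∀ d, MvPolynomial.homogeneousComponent d f ∈ J)
    (hx : ∀ f, MvPolynomial.X x * f ∈ J → f ∈ J)
    (h : IsPerf (J ⊔ Ideal.span {MvPolynomial.X x}) (g + 1)) : IsPerf J g where
  res i hi := (ExtSurj.of_extZero (exact_lsmul_factor J _) (injective_lsmul_quotient hx)
    (Submodule.factor_surjective _) (h.res (i + 1) (by omega))).extZero_of_smul_eq_zero
      (X_smul_resField x)
  self i hi := by
    have h1 := ExtSurj.of_extZero (exact_lsmul_factor J _) (injective_lsmul_quotient hx)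
      (Submodule.factor_surjective _) (h.self (i + 1) (by omega))
    exact (extZero_of_extSurj_graded x i (isGradedSub_idealSub hJ)
      (h1.of_equiv_left (idealSubEquiv J).symm)).of_equiv_left (idealSubEquiv J)

lemma IsPerf.inf {P Q : Ideal (MvPolynomial σ K)} {g : ℕ} (hP : IsPerf P g) (hQ : IsPerf Q g)
    (hPQ : IsPerf (P ⊔ Q) (g + 1)) : IsPerf (P ⊓ Q) g where
  res i hi := ExtZero.contra_left (quotInf_exact P Q) (quotInfToProd_injective P Q)
    (quotProdToSup_surjective P Q) (extZero_prod (hP.res i hi) (hQ.res i hi))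
    (hPQ.res (i + 1) (by omega))
  self i hi := ExtZero.contra_left (quotInf_exact P Q) (quotInfToProd_injective P Q)
    (quotProdToSup_surjective P Q) (extZero_prod (hP.self i hi) (hQ.self i hi))
    (hPQ.self (i + 1) (by omega))

/-- The ideal generated by a set of variables. -/
def varIdeal (K : Type) {σ : Type} [Field K] (T : Finset σ) : Ideal (MvPolynomial σ K) :=
  Ideal.span (MvPolynomial.X '' (T : Set σ))

lemma varIdeal_insert [DecidableEq σ] (x : σ) (T : Finset σ) :
    varIdeal K (insert x T) = varIdeal K T ⊔ Ideal.span {MvPolynomial.X x} := by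
  rw [varIdeal, Finset.coe_insert, Set.image_insert_eq, Ideal.span_insert, sup_comm, varIdeal]

/-- Variables form a regular sequence. -/
lemma X_mul_mem_varIdeal {T : Finset σ} {x : σ} (hx : x ∉ T) (f : MvPolynomial σ K)
    (h : MvPolynomial.X x * f ∈ varIdeal K T) : f ∈ varIdeal K T := by
  classical
  unfold varIdeal at h ⊢
  rw [MvPolynomial.mem_ideal_span_X_image] at h ⊢
  intro m hm
  obtain ⟨i, hi, hmi⟩ := h (Finsupp.single x 1 + m) (by
    rw [MvPolynomial.mem_support_iff, MvPolynomial.coeff_X_mul]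
    exact MvPolynomial.mem_support_iff.1 hm)
  refine ⟨i, hi, ?_⟩
  have : i ≠ x := fun h => hx (h ▸ hi)
  simpa [Finsupp.single_apply, this.symm] using hmi

/-- `S/(∅) ≃ S`. -/
def quotVarIdealEmpty : (MvPolynomial σ K ⧸ varIdeal K (∅ : Finset σ)) ≃ₗ[MvPolynomial σ K]
    MvPolynomial σ K :=
  Submodule.quotEquivOfEqBot _ (by simp [varIdeal])

lemma extZero_varIdeal (T : Finset σ) (n : ℕ) : ∀ (U : Finset σ), U ⊆ T → T.card ≤ U.card + n →
    ∀ i, i + U.card < T.card → ExtZero (MvPolynomial σ K) (MvPolynomial σ K ⧸ varIdeal K T)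
      (MvPolynomial σ K ⧸ varIdeal K U) i := by
  classical
  induction n with
  | zero => intro U _ h i hi; omega
  | succ n ih =>
    intro U hU hn i hi
    obtain ⟨x, hxT, hxU⟩ := Finset.exists_of_ssubset
      (hU.ssubset_of_ne fun h => by rw [h] at hi; omega)
    have hc := Finset.card_insert_of_notMem hxU
    refine ExtZero.of_smul_left (exact_lsmul_factor (varIdeal K U) (MvPolynomial.X x))
      (injective_lsmul_quotient (X_mul_mem_varIdeal hxU)) (Submodule.factor_surjective _)
      (fun y => ?_) fun j hj => ?_
    · obtain ⟨y, rfl⟩ := Submodule.Quotient.mk_surjective _ y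
      rw [← Submodule.Quotient.mk_smul, Submodule.Quotient.mk_eq_zero]
      exact Ideal.mul_mem_right _ _ (Ideal.subset_span ⟨x, hxT, rfl⟩)
    · rw [← varIdeal_insert]
      exact ih _ (Finset.insert_subset hxT hU) (by omega) j (by omega)

lemma isPerf_varIdeal (T : Finset σ) : IsPerf (varIdeal K T) T.card := by
  classical
  refine ⟨?_, fun i hi => (extZero_varIdeal T T.card ∅ (Finset.empty_subset _) (by simp) i
    (by simpa using hi)).of_equiv_right quotVarIdealEmpty⟩
  induction T using Finset.induction_on with
  | empty =>
    intro i hi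
    obtain ⟨i, rfl⟩ : ∃ j, i = j + 1 := ⟨i - 1, by simp at hi; omega⟩
    exact (extZero_of_projective i).of_equiv_left quotVarIdealEmpty.symm
  | insert x T hx ih =>
    intro i hi
    rw [Finset.card_insert_of_notMem hx] at hi
    obtain ⟨i, rfl⟩ : ∃ j, i = j + 1 := ⟨i - 1, by omega⟩
    have := ExtZero.contra_right (exact_lsmul_factor _ _)
      (injective_lsmul_quotient (X_mul_mem_varIdeal (K := K) hx))
      (Submodule.factor_surjective _) (ih i (by omega)) (ih (i + 1) (by omega))
    rw [varIdeal_insert]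
    exact this

end Perfection

section RadicalSystem

variable {K : Type} [Field K] {a m : ℕ}

/-- The codimension of `rsIdeal K a m s D v`. -/
def rsCodim (a m s : ℕ) (D : Finset ℕ) (v : ℕ) : ℕ :=
  s * m + ∑ j ∈ Finset.range m, (if j ∈ D then 0 else a - s - cnt D j) + cnt D v

lemma cnt_le_card (D : Finset ℕ) (j : ℕ) : cnt D j ≤ D.card := by
  rw [cnt, Nat.count_eq_card_filter_range]
  exact Finset.card_le_card fun w hw => (Finset.mem_filter.1 hw).2

lemma cnt_empty (j : ℕ) : cnt ∅ j = 0 := Nat.le_zero.1 (cnt_le_card ∅ j)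

lemma exists_next_pivot {D : Finset ℕ} {m : ℕ} (hD : ∀ w ∈ D, w < m) {v : ℕ} (hv : v ≤ m) :
    ∃ u, v ≤ u ∧ u ≤ m ∧ (u ∈ D ∨ u = m) ∧ ∀ w ∈ D, v ≤ w → u ≤ w := by
  classical
  by_cases hne : (D.filter (v ≤ ·)).Nonempty
  · have h := Finset.mem_filter.1 (Finset.min'_mem _ hne)
    exact ⟨_, h.2, (hD _ h.1).le, Or.inl h.1, fun w hw hvw =>
      Finset.min'_le _ _ (Finset.mem_filter.2 ⟨hw, hvw⟩)⟩
  · rw [Finset.not_nonempty_iff_eq_empty, Finset.filter_eq_empty_iff] at hne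
    exact ⟨m, hv, le_rfl, Or.inr rfl, fun w hw hvw => absurd hvw (hne hw)⟩

lemma rsIdeal_homogeneousComponent_mem {s : ℕ} {D : Finset ℕ} {v : ℕ} (f : GS K a m)
    (hf : f ∈ rsIdeal K a m s D v) (d : ℕ) :
    MvPolynomial.homogeneousComponent d f ∈ rsIdeal K a m s D v :=
  homogeneousComponent_mem (rsIdeal_isHomogeneous s D v) hf d

lemma mem_rsIdeal_of_mul [Infinite K] {s v : ℕ} {D : Finset ℕ} (hs : s ≤ a) (hv : v < m)
    (hD : ∀ w ∈ D, w < m) (hvD : v ∈ D) {f g : GS K a m} (h : f * g ∈ rsIdeal K a m s D v) :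
    f ∈ rsIdeal K a m s D v ∨ g ∈ rsIdeal K a m s D v := by
  simp only [mem_rsIdeal_iff s hs v hv.le D hD] at h ⊢
  exact rsVanish_mul hvD h

lemma X_mul_mem_rsIdeal [Infinite K] {s v : ℕ} {D : Finset ℕ} (hs : s < a) (hv : v < m)
    (hD : ∀ w ∈ D, w < m) (hvD : v ∈ D) (f : GS K a m)
    (h : MvPolynomial.X (⟨s, hs⟩, ⟨v, hv⟩) * f ∈ rsIdeal K a m s D v) :
    f ∈ rsIdeal K a m s D v :=
  (mem_rsIdeal_of_mul hs.le hv hD hvD h).resolve_left fun h =>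
    not_rsVanish_X hvD hs hv (rsVanish_of_mem h)

lemma cnt_shift {D : Finset ℕ} {v : ℕ} (hv : v ∈ D) (hv1 : v + 1 ∉ D) (j : ℕ) :
    cnt (insert (v + 1) (D.erase v)) j + (if j = v + 1 then 1 else 0) = cnt D j := by
  rw [← cnt_move hv hv1 (Nat.lt_succ_self v) j]
  congr 1
  exact if_congr (by omega) rfl rfl

lemma cnt_shift_le {D : Finset ℕ} {v : ℕ} (hv : v ∈ D) (hv1 : v + 1 ∉ D) (j : ℕ) :
    cnt (insert (v + 1) (D.erase v)) j ≤ cnt D j := by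
  rw [← cnt_shift hv hv1 j]
  exact Nat.le_add_right _ _

lemma rsIdeal_eq_inf [Infinite K] {s v u : ℕ} {D : Finset ℕ} (hs : s ≤ a) (hv : v + 1 < m)
    (hD : ∀ w ∈ D, w < m) (hvD : v ∈ D) (hv1 : v + 1 ∉ D) (hu : v + 1 ≤ u)
    (hnext : ∀ w ∈ D, v + 1 ≤ w → u ≤ w) :
    rsIdeal K a m s D (v + 1) =
      rsIdeal K a m s (insert (v + 1) (D.erase v)) (v + 1) ⊓ rsIdeal K a m s D u := by
  have hD' : ∀ w ∈ insert (v + 1) (D.erase v), w < m := by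
    intro w hw
    rw [Finset.mem_insert, Finset.mem_erase] at hw
    rcases hw with rfl | hw
    · exact hv
    · exact hD w hw.2
  apply le_antisymm (le_inf (rsIdeal_mono_left (cnt_shift_le hvD hv1)) (rsIdeal_mono_right s D hu))
  rintro f ⟨h1, h2⟩
  rw [mem_rsIdeal_iff s hs _ hv.le D hD]
  rintro h U V ⟨hh, hU, hV⟩
  have c1 : cnt D (v + 1) = cnt D v + 1 := by rw [cnt_succ, if_pos hvD]
  have c2 : cnt D (v + 1 + 1) = cnt D v + 1 := by rw [cnt_succ, if_neg hv1, c1]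
  have c3 : cnt D u = cnt D v + 1 := by rw [cnt_const hnext hu le_rfl, c1]
  have c4 : cnt D (u + 1) ≤ cnt D v + 2 := by rw [cnt_succ, c3]; split_ifs <;> omega
  rcases Nat.lt_or_ge (cnt D v) h with hlt | hge
  · refine rsVanish_of_mem h2 h U V ⟨by omega, hU, fun l j hlj => hV l j ?_⟩
    rcases hlj with hlj | ⟨hj, hl⟩
    · exact Or.inl hlj
    · have := cnt_mono D (show (j : ℕ) + 1 ≤ u from hj)
      omega
  · refine rsVanish_of_mem h1 h U V ⟨(cnt_shift_le hvD hv1 _).trans hh, hU, fun l j hlj => hV l j ?_⟩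
    rcases hlj with hlj | hlj
    · have := cnt_shift hvD hv1 ((j : ℕ) + 1)
      split_ifs at this with hj
      · rw [hj] at this hlj
        omega
      · omega
    · exact Or.inr hlj

lemma rsIdeal_sup {s v u : ℕ} {D D' : Finset ℕ} (hvu : v ≤ u) (h : ∀ j, cnt D' j ≤ cnt D j) :
    rsIdeal K a m s D' v ⊔ rsIdeal K a m s D u = rsIdeal K a m s D' u := by
  apply le_antisymm (sup_le (rsIdeal_mono_right s D' hvu) (rsIdeal_mono_left h))
  exact rsIdeal_le (fun f hf => Ideal.mem_sup_right (zeroVars_subset _ _ _ hf))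
    fun j f hf => Ideal.mem_sup_left (colMinors_subset _ _ _ _ hf)

lemma rsIdeal_eq_shift {s v : ℕ} {D : Finset ℕ} (hvD : v ∈ D) (hv1 : v + 1 ∉ D)
    (hmax : ∀ w ∈ D, w ≤ v) (hcard : D.card = a - s) :
    rsIdeal K a m s D (v + 1) = rsIdeal K a m s (insert (v + 1) (D.erase v)) (v + 1) := by
  apply le_antisymm (rsIdeal_mono_left (cnt_shift_le hvD hv1))
  refine rsIdeal_le (fun f hf => zeroVars_subset _ _ _ hf) fun j f hf => ?_
  have h1 := cnt_shift hvD hv1 j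
  split_ifs at h1 with hj
  · subst hj
    have h2 : cnt D (v + 1) = D.card := cnt_of_le fun w hw => Nat.lt_succ_of_le (hmax w hw)
    exact colMinors_mem_of_zero_rows (s := s + 1)
      (fun i l hi hl => zeroVars_subset _ _ _ ⟨i, l, by omega, rfl⟩) (by omega) hf
  · rw [add_zero] at h1
    exact colMinors_subset _ _ _ j (by rwa [← h1])

lemma rsCodim_succ (a m s : ℕ) {D : Finset ℕ} {v : ℕ} (hv : v ∈ D) :
    rsCodim a m s D (v + 1) = rsCodim a m s D v + 1 := by
  rw [rsCodim, rsCodim, cnt_succ, if_pos hv, ← add_assoc]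

lemma rsCodim_eq (a m s : ℕ) {D : Finset ℕ} {v u : ℕ} (h : cnt D u = cnt D v) :
    rsCodim a m s D u = rsCodim a m s D v := by
  rw [rsCodim, rsCodim, h]

lemma rsCodim_shift {a m s : ℕ} {D : Finset ℕ} {v : ℕ} (hvD : v ∈ D) (hv1 : v + 1 ∉ D)
    (hv : v + 1 < m) (hcard : D.card ≤ a - s) :
    rsCodim a m s (insert (v + 1) (D.erase v)) (v + 1) = rsCodim a m s D (v + 1) := by
  have c1 : cnt D (v + 1) = cnt D v + 1 := by rw [cnt_succ, if_pos hvD]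
  have c2 := cnt_le_card D (v + 1)
  have c3 := cnt_shift hvD hv1 (v + 1)
  rw [if_pos rfl] at c3
  have key : ∑ j ∈ Finset.range m, ((if j ∈ insert (v + 1) (D.erase v) then 0 else
        a - s - cnt (insert (v + 1) (D.erase v)) j) + if j = v + 1 then a - s - cnt D (v + 1) else 0)
      = ∑ j ∈ Finset.range m, ((if j ∈ D then 0 else a - s - cnt D j) +
        if j = v then a - s - cnt D v else 0) := by
    refine Finset.sum_congr rfl fun j _ => ?_
    have hj := cnt_shift hvD hv1 j
    by_cases h1 : j = v + 1
    · subst h1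
      simp [hv1]
    · rw [if_neg h1, add_zero] at hj
      by_cases h2 : j = v
      · subst h2
        rw [hj]
        simp [hvD]
      · rw [hj]
        simp [h1, h2]
  rw [Finset.sum_add_distrib, Finset.sum_add_distrib, Finset.sum_ite_eq', Finset.sum_ite_eq',
    if_pos (Finset.mem_range.2 hv), if_pos (Finset.mem_range.2 (by omega))] at key
  rw [rsCodim, rsCodim]
  omega

lemma rsCodim_row {a m s : ℕ} {D D' : Finset ℕ}
    (h : ∀ j < m, (if j ∈ D' then 0 else a - (s + 1) - cnt D' j) + 1 =
      (if j ∈ D then 0 else a - s - cnt D j) + if j ∈ D then 1 else 0) :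
    rsCodim a m s D m = rsCodim a m (s + 1) D' 0 := by
  have key := Finset.sum_congr (rfl : Finset.range m = Finset.range m)
    fun j hj => h j (Finset.mem_range.1 hj)
  rw [Finset.sum_add_distrib, Finset.sum_add_distrib] at key
  have hc : ∑ j ∈ Finset.range m, (if j ∈ D then 1 else 0) = cnt D m := by
    rw [cnt, Nat.count_eq_card_filter_range, Finset.card_filter]
  rw [hc, Finset.sum_const, Finset.card_range, smul_eq_mul, mul_one] at key
  rw [rsCodim, rsCodim, cnt_zero, add_zero, add_mul, one_mul]
  omega

lemma rsIdeal_eq_varIdeal (s v : ℕ) :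
    rsIdeal K a m s ∅ v = varIdeal K (Finset.univ : Finset (Fin a × Fin m)) := by
  apply le_antisymm
  · refine rsIdeal_le ?_ ?_
    · rintro f ⟨i, j, -, rfl⟩
      exact Ideal.subset_span ⟨(i, j), by simp, rfl⟩
    · intro j f hf
      rw [cnt_empty] at hf
      obtain ⟨r, c, -, rfl⟩ := hf
      have : ((gmat K a m).submatrix r c).det = MvPolynomial.X (r 0, c 0) := by
        exact Matrix.det_fin_one ((gmat K a m).submatrix r c : Matrix (Fin 1) (Fin 1) _)
      rw [this]
      exact Ideal.subset_span ⟨(r 0, c 0), by simp, rfl⟩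
  · refine Ideal.span_le.2 ?_
    rintro _ ⟨⟨i, j⟩, -, rfl⟩
    refine Ideal.subset_span (Or.inr (Set.mem_iUnion.2 ⟨m, ?_⟩))
    rw [cnt_empty]
    exact ⟨fun _ => i, fun _ => j, by simp, by simp⟩

lemma rsIdeal_first_pivot {s u : ℕ} {D : Finset ℕ} (hs : s < a)
    (hmin : ∀ w ∈ D, u ≤ w) : rsIdeal K a m s D 0 = rsIdeal K a m s D u := by
  apply le_antisymm (rsIdeal_mono_right s D (Nat.zero_le _))
  refine rsIdeal_le ?_ fun j f hf => colMinors_subset _ _ _ _ hf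
  rintro f ⟨i, j, hi | ⟨hi, hj⟩, rfl⟩
  · exact zeroVars_subset _ _ _ ⟨i, j, Or.inl hi, rfl⟩
  · have hc : cnt D (j + 1) = 0 := by
      rw [cnt_const (u := 0) (v := u) (fun w hw _ => hmin w hw) (Nat.zero_le _) hj, cnt_zero]
    obtain rfl : i = ⟨s, hs⟩ := Fin.ext hi
    exact rsIdeal_mono_right s D (Nat.zero_le _)
      (by
        refine colMinors_subset _ _ _ (j + 1) ?_
        rw [hc]
        exact ⟨fun _ => ⟨s, hs⟩, fun _ => j, by simp, by simp⟩)

lemma isPerf_rsIdeal_empty (s v : ℕ) (hs : s ≤ a) :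
    IsPerf (rsIdeal K a m s ∅ v) (rsCodim a m s ∅ v) := by
  have : rsCodim a m s ∅ v = (Finset.univ : Finset (Fin a × Fin m)).card := by
    rw [rsCodim, cnt_empty]
    simp only [cnt_empty, Finset.notMem_empty, if_false, Finset.sum_const, Finset.card_range,
      Finset.card_univ, Fintype.card_prod, Fintype.card_fin, smul_eq_mul, add_zero, Nat.sub_zero]
    rw [mul_comm m, ← add_mul, Nat.add_sub_cancel' hs]
  rw [rsIdeal_eq_varIdeal s v, this]
  exact isPerf_varIdeal _

/-- The ideals of the radical system at pivots are perfect. -/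
theorem isPerf_rsIdeal [Infinite K] (s : ℕ) (hs : s ≤ a) (v : ℕ) (hv : v ≤ m) (D : Finset ℕ)
    (hD : ∀ w ∈ D, w < m) (hcard : D.card ≤ a - s)
    (hp : v ∈ D ∨ v = m ∧ (D.card < a - s ∨ m - 1 ∈ D)) :
    IsPerf (rsIdeal K a m s D v) (rsCodim a m s D v) := by
  classical
  induction hs using Nat.decreasingInduction generalizing v D with
  | self =>
    rw [Nat.sub_self, Nat.le_zero, Finset.card_eq_zero] at hcard
    subst hcard
    exact isPerf_rsIdeal_empty _ _ le_rfl
  | of_succ s hs ihs =>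
    induction hn : m - v using Nat.strong_induction_on generalizing v D with
    | _ n ihn =>
    rcases D.eq_empty_or_nonempty with rfl | hne
    · exact isPerf_rsIdeal_empty _ _ hs.le
    rcases hp with hvD | ⟨rfl, hp⟩
    · have hvm := hD v hvD
      have hx : IsPerf (rsIdeal K a m s D (v + 1)) (rsCodim a m s D v + 1) := by
        have hcD := rsCodim_succ a m s hvD
        rw [← hcD]
        by_cases h1 : v + 1 ∈ D ∨ v + 1 = m
        · refine ihn (m - (v + 1)) (by omega) (v + 1) hvm D hD hcard ?_ rfl
          rcases h1 with h1 | h1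
          · exact Or.inl h1
          · exact Or.inr ⟨h1, Or.inr (by rwa [← h1, Nat.add_sub_cancel])⟩
        push Not at h1
        obtain ⟨h1, h2⟩ := h1
        have hv1m : v + 1 < m := by omega
        obtain ⟨u, hu, hum, hup, hnext⟩ := exists_next_pivot hD hvm
        have hD' : ∀ w ∈ insert (v + 1) (D.erase v), w < m := by
          intro w hw
          rw [Finset.mem_insert, Finset.mem_erase] at hw
          rcases hw with rfl | hw
          · exact hv1m
          · exact hD w hw.2
        have hcard' : (insert (v + 1) (D.erase v)).card = D.card := by
          rw [Finset.card_insert_of_notMem (fun h => h1 (Finset.mem_of_mem_erase h)),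
            Finset.card_erase_add_one hvD]
        have hP := ihn (m - (v + 1)) (by omega) (v + 1) hvm _ hD' (hcard'.le.trans hcard)
          (Or.inl (Finset.mem_insert_self _ _)) rfl
        rw [rsCodim_shift hvD h1 hv1m hcard] at hP
        by_cases hedge : u = m ∧ D.card = a - s
        · rwa [rsIdeal_eq_shift hvD h1 (fun w hw => ?_) hedge.2]
          by_contra hw'
          have := hnext w hw (by omega)
          have := hD w hw
          omega
        have huv : v + 1 < u := by
          rcases hup with hup | hup
          · exact lt_of_le_of_ne hu fun h => h1 (h ▸ hup)
          · omega
        have hcu : cnt D u = cnt D (v + 1) := cnt_const hnext hu le_rfl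
        have hup' : ∀ D' : Finset ℕ, (u ∈ D → u ∈ D') → D'.card = D.card →
            u ∈ D' ∨ u = m ∧ (D'.card < a - s ∨ m - 1 ∈ D') := by
          intro D' hDD' hc
          rcases hup with hup | hup
          · exact Or.inl (hDD' hup)
          · exact Or.inr ⟨hup, Or.inl (by omega)⟩
        have hQ := ihn (m - u) (by omega) u hum D hD hcard (hup' D id rfl) rfl
        have hPQ := ihn (m - u) (by omega) u hum _ hD' (hcard'.le.trans hcard)
          (hup' _ (fun h => Finset.mem_insert_of_mem (Finset.mem_erase.2 ⟨by omega, h⟩)) hcard') rfl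
        rw [rsCodim_eq a m s hcu] at hQ
        rw [rsIdeal_eq_inf hs.le hv1m hD hvD h1 hu hnext]
        refine IsPerf.inf hP hQ ?_
        rw [rsIdeal_sup hu (cnt_shift_le hvD h1)]
        have c1 := cnt_shift hvD h1 u
        have c2 := cnt_shift hvD h1 (v + 1)
        rw [if_neg (by omega), add_zero] at c1
        rw [if_pos rfl] at c2
        have e1 := rsCodim_shift hvD h1 hv1m hcard
        rw [rsCodim] at hPQ e1
        rwa [show rsCodim a m s D (v + 1) + 1 = s * m + ∑ j ∈ Finset.range m,
          (if j ∈ insert (v + 1) (D.erase v) then 0 else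
            a - s - cnt (insert (v + 1) (D.erase v)) j) + cnt (insert (v + 1) (D.erase v)) u by
            omega]
      refine IsPerf.of_sup_X (x := (⟨s, hs⟩, ⟨v, hvm⟩)) rsIdeal_homogeneousComponent_mem
        (X_mul_mem_rsIdeal hs hvm hD hvD) ?_
      rwa [← rsIdeal_succ D hs hvm]
    · have hrow : ∀ D' : Finset ℕ, (∀ w ∈ D', w < v) → D'.card ≤ a - (s + 1) →
          IsPerf (rsIdeal K a v (s + 1) D' 0) (rsCodim a v (s + 1) D' 0) := by
        intro D' hD' hc'
        rcases D'.eq_empty_or_nonempty with rfl | ⟨w, hw⟩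
        · exact isPerf_rsIdeal_empty _ _ hs
        obtain ⟨u, -, hum, hup, hnext⟩ := exists_next_pivot hD' (Nat.zero_le v)
        have hu : u ∈ D' := hup.resolve_right fun h => by
          have := hnext w hw (Nat.zero_le _)
          have := hD' w hw
          omega
        have hcu : cnt D' u = cnt D' 0 := cnt_const hnext (Nat.zero_le _) le_rfl
        rw [← rsCodim_eq a v (s + 1) hcu, rsIdeal_first_pivot (by
          have := Finset.card_pos.2 ⟨w, hw⟩
          omega)
          fun w hw => hnext w hw (Nat.zero_le _)]
        exact ihs u hum D' hD' hc' (Or.inl hu)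
      by_cases hc : D.card < a - s
      · rw [← rsIdeal_succ_row, rsCodim_row (D' := D)]
        · exact hrow D hD (by omega)
        · intro j _
          have := cnt_le_card D j
          split_ifs <;> omega
      · have hm := hp.resolve_left hc
        have hmax : ∀ w ∈ D, w ≤ v - 1 := fun w hw => by
          have := hD w hw
          omega
        have hec := Finset.card_erase_add_one hm
        rw [← rsIdeal_succ_row, ← rsIdeal_erase_max hm hmax (by omega),
          rsCodim_row (D' := D.erase (v - 1))]
        · exact hrow _ (fun w hw => hD w (Finset.mem_of_mem_erase hw)) (by omega)
        · intro j hj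
          have h1 := cnt_erase hm j
          rw [if_neg (by omega), add_zero] at h1
          have h2 := cnt_le_card (D.erase (v - 1)) j
          rw [h1] at h2
          by_cases hjv : j = v - 1
          · subst hjv
            have h3 : cnt D (v - 1) + 1 = D.card := by
              rw [← cnt_of_le (j := v - 1 + 1) (D := D) fun w hw => Nat.lt_succ_of_le (hmax w hw),
                cnt_succ, if_pos hm]
            simp only [Finset.notMem_erase, if_false, hm, if_true, h1]
            omega
          · simp only [Finset.mem_erase, ne_eq, hjv, not_false_eq_true, true_and, h1]
            split_ifs <;> omega

end RadicalSystem

section Resolution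

variable {K σ : Type} [Field K]

/-- A graded free module together with a graded submodule. -/
structure GradedSub (K σ : Type) [Field K] where
  /-- the rank of the free module -/
  rk : ℕ
  /-- the degrees of the basis elements -/
  wt : Fin rk → ℕ
  /-- the submodule -/
  sub : Submodule (MvPolynomial σ K) (Fin rk → MvPolynomial σ K)
  graded : IsGradedSub wt sub

namespace GradedSub

variable [Finite σ] (N : GradedSub K σ)

/-- The minimal number of generators. -/
def ngens : ℕ := N.graded.exists_min_gens.choose

/-- A minimal system of homogeneous generators. -/
def gens : Fin N.ngens → (Fin N.rk → MvPolynomial σ K) :=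
  N.graded.exists_min_gens.choose_spec.choose_spec.choose

lemma gens_homogeneous : ∀ j, IsHomVec N.wt
    (N.graded.exists_min_gens.choose_spec.choose j) (N.gens j) :=
  N.graded.exists_min_gens.choose_spec.choose_spec.choose_spec.1

lemma range_gens : LinearMap.range (genMap N.gens) = N.sub :=
  N.graded.exists_min_gens.choose_spec.choose_spec.choose_spec.2.1

lemma gens_minimal {u : Fin N.ngens → MvPolynomial σ K} (hu : genMap N.gens u = 0)
    (j : Fin N.ngens) : MvPolynomial.constantCoeff (u j) = 0 :=
  N.graded.exists_min_gens.choose_spec.choose_spec.choose_spec.2.2 u hu j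

/-- The first syzygies. -/
def syz : GradedSub K σ where
  rk := N.ngens
  wt := N.graded.exists_min_gens.choose_spec.choose
  sub := LinearMap.ker (genMap N.gens)
  graded := isGradedSub_ker N.gens_homogeneous

/-- The quotient by the submodule. -/
abbrev Quot : Type := (Fin N.rk → MvPolynomial σ K) ⧸ N.sub

lemma extZero_syz {M : Type} [AddCommGroup M] [Module (MvPolynomial σ K) M] {i : ℕ}
    (h : ExtZero (MvPolynomial σ K) N.Quot M (i + 2)) :
    ExtZero (MvPolynomial σ K) N.syz.Quot M (i + 1) :=
  (ExtZero.shift_down (exact_subtype_mkQ' N.sub) N.sub.injective_subtype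
    N.sub.mkQ_surjective h).of_equiv_left (quotKerEquiv N.range_gens).symm

lemma ngens_eq_zero_of_rk (h : N.rk = 0) : N.ngens = 0 := by
  by_contra hne
  have hz : genMap N.gens (fun _ => 1) = 0 := by
    funext i
    exact absurd i.isLt (by omega)
  simpa using N.gens_minimal hz ⟨0, Nat.pos_of_ne_zero hne⟩

lemma ngens_syz_eq_zero
    (h : ExtZero (MvPolynomial σ K) N.syz.Quot (ResField K σ) 1) : N.syz.ngens = 0 := by
  by_contra hne
  set P := N.syz with hP
  have hcc : ∀ f : MvPolynomial σ K, MvPolynomial.constantCoeff f = 0 →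
      f ∈ Ideal.span (Set.range (MvPolynomial.X : σ → MvPolynomial σ K)) := fun f hf => by
    rw [← Set.image_univ, MvPolynomial.mem_ideal_span_X_image]
    intro e he
    by_contra! hall
    have : e = 0 := Finsupp.ext fun i => hall i trivial
    subst this
    exact MvPolynomial.mem_support_iff.1 he (by rwa [← MvPolynomial.constantCoeff_eq])
  have hcc' : ∀ f ∈ Ideal.span (Set.range (MvPolynomial.X : σ → MvPolynomial σ K)),
      MvPolynomial.constantCoeff f = 0 := by
    intro f hf
    refine (Ideal.span_le (I := RingHom.ker
      (MvPolynomial.constantCoeff : MvPolynomial σ K →+* K))).2 ?_ hf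
    rintro _ ⟨i, rfl⟩
    exact MvPolynomial.constantCoeff_X K i
  let j : Fin P.ngens := ⟨0, Nat.pos_of_ne_zero hne⟩
  let θ : ((Fin P.ngens → MvPolynomial σ K) ⧸ LinearMap.ker (genMap P.gens)) →ₗ[MvPolynomial σ K]
      ResField K σ := Submodule.mapQ _ _ (LinearMap.proj j) fun u hu =>
        hcc _ (P.gens_minimal (LinearMap.mem_ker.1 hu) j)
  obtain ⟨g, hg⟩ := exists_extend_of_extZero (exact_subtype_mkQ' P.sub) P.sub.injective_subtype
    P.sub.mkQ_surjective h (θ.comp (quotKerEquiv P.range_gens).symm.toLinearMap)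
  have hgz : ∀ u ∈ P.sub, g u = 0 := by
    intro u hu
    have hu0 := N.gens_minimal (LinearMap.mem_ker.1 hu)
    have hX : ∀ f ∈ Ideal.span (Set.range (MvPolynomial.X : σ → MvPolynomial σ K)),
        ∀ y : ResField K σ, f • y = 0 := by
      intro f hf y
      obtain ⟨y, rfl⟩ := Submodule.Quotient.mk_surjective _ y
      rw [← Submodule.Quotient.mk_smul, Submodule.Quotient.mk_eq_zero]
      exact Ideal.mul_mem_right _ _ hf
    rw [LinearMap.pi_apply_eq_sum_univ g u]
    exact Finset.sum_eq_zero fun i _ => hX _ (hcc _ (hu0 i)) _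
  have hmem : genMap P.gens (Pi.single j 1) ∈ P.sub := by
    rw [← P.range_gens]
    exact LinearMap.mem_range_self _ _
  have h1 := LinearMap.congr_fun hg ⟨_, hmem⟩
  have h2 : (quotKerEquiv P.range_gens).symm ⟨_, hmem⟩ =
      Submodule.Quotient.mk (Pi.single j 1) := by
    rw [LinearEquiv.symm_apply_eq]
    rfl
  rw [LinearMap.comp_apply, Submodule.subtype_apply, hgz _ hmem, LinearMap.comp_apply,
    LinearEquiv.coe_coe, h2, eq_comm] at h1
  have h3 : (Submodule.Quotient.mk ((Pi.single j 1 : Fin P.ngens → MvPolynomial σ K) j) :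
    ResField K σ) = 0 := h1
  rw [Submodule.Quotient.mk_eq_zero, Pi.single_eq_same] at h3
  simpa using hcc' _ h3

/-- The iterated syzygies. -/
def syzIter (N : GradedSub K σ) : ℕ → GradedSub K σ
  | 0 => N
  | i + 1 => (syzIter N i).syz

/-- The matrices of the minimal resolution. -/
def diff (N : GradedSub K σ) (i : ℕ) :
    Matrix (Fin (N.syzIter i).rk) (Fin (N.syzIter (i + 1)).rk) (MvPolynomial σ K) :=
  Matrix.of fun x j => (N.syzIter i).gens j x

lemma mulVecLin_diff (N : GradedSub K σ) (i : ℕ) :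
    (N.diff i).mulVecLin = (genMap (N.syzIter i).gens :
      (Fin (N.syzIter (i + 1)).rk → MvPolynomial σ K) →ₗ[MvPolynomial σ K] _) := by
  refine LinearMap.ext fun u => funext fun x => ?_
  change ∑ j, (N.syzIter i).gens j x * u j = (∑ j, u j • (N.syzIter i).gens j) x
  rw [Finset.sum_apply]
  exact Finset.sum_congr rfl fun j _ => mul_comm _ _

end GradedSub

/-- A finite free resolution of length at most `c` of `S/J`, given by matrices. -/
structure IsFreeRes {S : Type} [CommRing S] (J : Ideal S) (c : ℕ) (b : ℕ → ℕ)
    (D : ∀ i, Matrix (Fin (b i)) (Fin (b (i + 1))) S) (e₀ : Fin (b 0)) : Prop where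
  eq_base : ∀ j, j = e₀
  mem_iff : ∀ f, f ∈ J ↔ Pi.single e₀ f ∈ LinearMap.range (D 0).mulVecLin
  exact : ∀ i, Function.Exact (D (i + 1)).mulVecLin (D i).mulVecLin
  zero : ∀ i, c < i → b i = 0

/-- Perfect ideals have free resolutions of length equal to the codimension. -/
theorem exists_isFreeRes [Finite σ] {J : Ideal (MvPolynomial σ K)} {c : ℕ} (hc : 0 < c)
    (hJ : ∀ f ∈ J, ∀ d, MvPolynomial.homogeneousComponent d f ∈ J) (h : IsPerf J c) :
    ∃ (b : ℕ → ℕ) (D : ∀ i, Matrix (Fin (b i)) (Fin (b (i + 1))) (MvPolynomial σ K))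
      (e₀ : Fin (b 0)), IsFreeRes J c b D e₀ := by
  let N : GradedSub K σ := ⟨1, _, idealSub J, isGradedSub_idealSub hJ⟩
  have hext : ∀ n i, i + n = c → ExtZero (MvPolynomial σ K) (N.syzIter n).Quot
      (ResField K σ) (i + 1) := by
    intro n
    induction n with
    | zero =>
      rintro i rfl
      exact (h.res (i + 1) (by omega)).of_equiv_left (idealSubEquiv J).symm
    | succ n ih => exact fun i hi => GradedSub.extZero_syz _ (ih (i + 1) (by omega))
  refine ⟨fun i => (N.syzIter i).rk, N.diff,
    (0 : Fin 1), fun j => Subsingleton.elim (α := Fin 1) _ _, fun f => ?_, fun i => ?_, ?_⟩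
  · rw [N.mulVecLin_diff]
    change _ ↔ _ ∈ LinearMap.range (genMap N.gens)
    rw [N.range_gens]
    change _ ↔ (Pi.single (0 : Fin 1) f : Fin 1 → _) 0 ∈ J
    rw [Pi.single_eq_same]
  · rw [N.mulVecLin_diff, N.mulVecLin_diff]
    refine LinearMap.exact_iff.2 ?_
    exact ((N.syzIter i).syz.range_gens).symm
  · intro i hi
    induction i, hi using Nat.le_induction with
    | base =>
      obtain ⟨d, rfl⟩ : ∃ d, c = d + 1 := ⟨c - 1, by omega⟩
      exact GradedSub.ngens_syz_eq_zero (N.syzIter d) (hext (d + 1) 0 (by omega))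
    | succ i _ ih => exact GradedSub.ngens_eq_zero_of_rk _ ih

end Resolution

section Acyclicity

open RingTheory.Sequence

variable {S : Type} [CommRing S]

/-- Cycles of `g` become boundaries of `f` after multiplication by a power of `Δ`. -/
def ExactUpTo {M N P : Type} [AddCommGroup M] [AddCommGroup N] [AddCommGroup P] [Module S M]
    [Module S N] [Module S P] (Δ : S) (f : M →ₗ[S] N) (g : N →ₗ[S] P) : Prop :=
  ∀ y, g y = 0 → ∃ (N : ℕ) (x : M), Δ ^ N • y = f x

theorem exactUpTo_of_regular {ι : Type} (nx : ι → ι) (Δ : S) (i₀ : ι) (fs : List S) :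
    ∀ (C : ι → Type) [∀ i, AddCommGroup (C i)] [∀ i, Module S (C i)]
      (d : ∀ i, C i →ₗ[S] C (nx i)), (∀ i z, d (nx i) (d i z) = 0) → (∀ z : C i₀, z = 0) →
      (∀ i, IsWeaklyRegular (C i) fs) →
      (∀ f ∈ fs, ∀ i z, d (nx i) z = 0 → ∃ (N n : ℕ) (y : C i), Δ ^ N • f ^ n • z = d i y) →
      ∀ j < fs.length, ExactUpTo Δ (d (nx^[j] i₀)) (d (nx (nx^[j] i₀))) := by
  induction fs with
  | nil => intro C _ _ d _ _ _ _ j hj; simp at hj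
  | cons f fs ih =>
    intro C _ _ d hdd h0 hreg hk j hj
    have hf : ∀ i, IsSMulRegular (C i) f := fun i =>
      ((isWeaklyRegular_cons_iff (C i) f fs).1 (hreg i)).1
    have hex : ∀ i (x : C i), (Submodule.Quotient.mk x : QuotSMulTop f (C i)) = 0 →
        ∃ y, x = f • y := by
      intro i x hx
      rw [Submodule.Quotient.mk_eq_zero, Submodule.mem_smul_pointwise_iff_exists] at hx
      obtain ⟨y, -, hy⟩ := hx
      exact ⟨y, hy.symm⟩
    have hmk0 : ∀ i (x : C i), (Submodule.Quotient.mk (f • x) : QuotSMulTop f (C i)) = 0 := by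
      intro i x
      rw [Submodule.Quotient.mk_eq_zero]
      exact Submodule.smul_mem_pointwise_smul _ _ _ trivial
    have key := ih (fun i => QuotSMulTop f (C i)) (fun i => QuotSMulTop.map f (d i))
      (fun i z => by
        obtain ⟨z, rfl⟩ := Submodule.Quotient.mk_surjective _ z
        rw [QuotSMulTop.map_apply_mk, QuotSMulTop.map_apply_mk, hdd]; rfl)
      (fun z => by
        obtain ⟨z, rfl⟩ := Submodule.Quotient.mk_surjective _ z
        rw [h0 z]; rfl)
      (fun i => ((isWeaklyRegular_cons_iff (C i) f fs).1 (hreg i)).2)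
      (fun g hg i z hz => by
        obtain ⟨z, rfl⟩ := Submodule.Quotient.mk_surjective _ z
        rw [QuotSMulTop.map_apply_mk] at hz
        obtain ⟨z₁, hz₁⟩ := hex _ _ hz
        have hc : d (nx (nx i)) z₁ = 0 := by
          refine hf _ ?_
          simp only [smul_zero]
          rw [← map_smul, ← hz₁, hdd]
        obtain ⟨N, n, y₁, hy₁⟩ := hk g (List.mem_cons_of_mem _ hg) (nx i) z₁ hc
        obtain ⟨N', n', y, hy⟩ := hk g (List.mem_cons_of_mem _ hg) i
          (Δ ^ N • g ^ n • z - f • y₁) (by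
            rw [map_sub, map_smul, map_smul, hz₁, map_smul, ← hy₁, smul_comm f, smul_comm f,
              sub_self])
        refine ⟨N' + N, n' + n, Submodule.Quotient.mk y, ?_⟩
        rw [QuotSMulTop.map_apply_mk, ← hy, ← sub_eq_zero, ← Submodule.Quotient.mk_smul,
          ← Submodule.Quotient.mk_smul, ← Submodule.Quotient.mk_sub]
        have : Δ ^ (N' + N) • g ^ (n' + n) • z -
            Δ ^ N' • g ^ n' • (Δ ^ N • g ^ n • z - f • y₁) =
            f • (Δ ^ N' • g ^ n' • y₁) := by
          simp only [pow_add]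
          module
        rw [this, hmk0])
    intro z hz
    obtain ⟨N, n, y, hy⟩ := hk f (List.mem_cons_self) _ z hz
    clear hz
    induction n generalizing N y with
    | zero => exact ⟨N, y, by simpa using hy⟩
    | succ n ihn =>
      cases j with
      | zero =>
        have hy0 : y = 0 := h0 y
        refine ihn N 0 (hf _ ?_)
        simp only
        rw [map_zero, smul_zero, ← map_zero (d (nx^[0] i₀)), ← hy0, ← hy, pow_succ]
        module
      | succ j =>
        have hi := Function.iterate_succ_apply' nx j i₀
        revert hy y z
        rw [hi]
        intro z ihn y hy
        have hyc : QuotSMulTop.map f (d (nx (nx^[j] i₀))) (Submodule.Quotient.mk y) = 0 := by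
          rw [QuotSMulTop.map_apply_mk, ← hy, show Δ ^ N • f ^ (n + 1) • z =
            f • (Δ ^ N • f ^ n • z) by rw [pow_succ]; module, hmk0]
        obtain ⟨M, x, hx⟩ := key j (by simpa using hj) _ hyc
        obtain ⟨x, rfl⟩ := Submodule.Quotient.mk_surjective _ x
        rw [QuotSMulTop.map_apply_mk, ← sub_eq_zero, ← Submodule.Quotient.mk_smul,
          ← Submodule.Quotient.mk_sub] at hx
        obtain ⟨y₂, hy₂⟩ := hex _ _ hx
        refine ihn (M + N) y₂ (hf _ ?_)
        simp only
        rw [← map_smul, ← hy₂, map_sub, hdd, sub_zero, map_smul, ← hy, pow_add, pow_succ]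
        module

/-- A chain of modules shifted by one, with a trivial module in position `0`. -/
def Shifted (P : ℕ → Type) : ℕ → Type
  | 0 => PUnit
  | i + 1 => P i

instance (P : ℕ → Type) [∀ i, AddCommGroup (P i)] : ∀ i, AddCommGroup (Shifted P i)
  | 0 => inferInstanceAs (AddCommGroup PUnit)
  | i + 1 => inferInstanceAs (AddCommGroup (P i))

instance (P : ℕ → Type) [∀ i, AddCommGroup (P i)] [∀ i, Module S (P i)] :
    ∀ i, Module S (Shifted P i)
  | 0 => inferInstanceAs (Module S PUnit)
  | i + 1 => inferInstanceAs (Module S (P i))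

variable {P : ℕ → Type} [∀ i, AddCommGroup (P i)] [∀ i, Module S (P i)]

lemma isWeaklyRegular_of_subsingleton (M : Type) [AddCommGroup M] [Module S M]
    (h : ∀ z : M, z = 0) (fs : List S) : IsWeaklyRegular M fs := by
  induction fs generalizing M with
  | nil => exact IsWeaklyRegular.nil _ _
  | cons f fs ih =>
    refine (isWeaklyRegular_cons_iff _ _ _).2 ⟨fun a b _ => (h a).trans (h b).symm, ih _ ?_⟩
    intro z
    obtain ⟨z, rfl⟩ := Submodule.Quotient.mk_surjective _ z
    rw [h z]; rfl

/-- The differential of a shifted chain complex. -/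
def shiftedChain (d : ∀ i, P (i + 1) →ₗ[S] P i) : ∀ i, Shifted P i →ₗ[S] Shifted P (i - 1)
  | 0 => 0
  | 1 => 0
  | i + 2 => d i

/-- The differential of a shifted cochain complex. -/
def shiftedCochain (d : ∀ i, P i →ₗ[S] P (i + 1)) : ∀ i, Shifted P i →ₗ[S] Shifted P (i + 1)
  | 0 => 0
  | i + 1 => d i

theorem chain_exactUpTo (Δ : S) (fs : List S) (d : ∀ i, P (i + 1) →ₗ[S] P i)
    (hdd : ∀ i z, d i (d (i + 1) z) = 0) (h0 : ∀ z : P (fs.length + 1), z = 0)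
    (hreg : ∀ i, IsWeaklyRegular (P i) fs)
    (hk0 : ∀ f ∈ fs, ∀ z, ∃ (N n : ℕ) (y : P 1), Δ ^ N • f ^ n • z = d 0 y)
    (hk : ∀ f ∈ fs, ∀ i z, d i z = 0 →
      ∃ (N n : ℕ) (y : P (i + 2)), Δ ^ N • f ^ n • z = d (i + 1) y) :
    ∀ i < fs.length, ExactUpTo Δ (d (i + 1)) (d i) := by
  intro i hi
  have key := exactUpTo_of_regular (S := S) (fun i => i - 1) Δ (fs.length + 2) fs (Shifted P)
    (shiftedChain d)
    (fun i z => match i, z with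
      | 0, z => rfl
      | 1, z => rfl
      | 2, z => rfl
      | i + 3, z => hdd i z)
    h0
    (fun i => match i with
      | 0 => isWeaklyRegular_of_subsingleton _ (fun _ => rfl) _
      | i + 1 => hreg i)
    (fun f hf i z hz => match i, z, hz with
      | 0, z, hz => ⟨0, 0, 0, rfl⟩
      | 1, z, hz => ⟨0, 0, 0, rfl⟩
      | 2, z, hz => hk0 f hf z
      | i + 3, z, hz => hk f hf i z hz)
    (fs.length - 1 - i) (by omega)
  have hit : ∀ j m : ℕ, (fun i => i - 1)^[j] m = m - j := by
    intro j
    induction j with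
    | zero => intro m; rfl
    | succ j ih => intro m; rw [Function.iterate_succ_apply, ih]; omega
  rw [hit, show fs.length + 2 - (fs.length - 1 - i) = i + 3 by omega] at key
  exact key

theorem cochain_exactUpTo (Δ : S) (fs : List S) (d : ∀ i, P i →ₗ[S] P (i + 1))
    (hdd : ∀ i z, d (i + 1) (d i z) = 0)
    (hreg : ∀ i, IsWeaklyRegular (P i) fs)
    (hk0 : ∀ f ∈ fs, ∀ z, d 0 z = 0 → ∃ (N n : ℕ), Δ ^ N • f ^ n • z = 0)
    (hk : ∀ f ∈ fs, ∀ i z, d (i + 1) z = 0 →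
      ∃ (N n : ℕ) (y : P i), Δ ^ N • f ^ n • z = d i y) :
    (0 < fs.length → ∀ z, d 0 z = 0 → ∃ N : ℕ, Δ ^ N • z = 0) ∧
    ∀ i, i + 1 < fs.length → ExactUpTo Δ (d i) (d (i + 1)) := by
  have key := exactUpTo_of_regular (S := S) (fun i => i + 1) Δ 0 fs (Shifted P)
    (shiftedCochain d)
    (fun i z => match i, z with
      | 0, z => by
        change d 0 ((0 : Shifted P 0 →ₗ[S] Shifted P 1) z) = 0
        rw [LinearMap.zero_apply]; exact map_zero _
      | i + 1, z => hdd i z)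
    (fun _ => rfl)
    (fun i => match i with
      | 0 => isWeaklyRegular_of_subsingleton _ (fun _ => rfl) _
      | i + 1 => hreg i)
    (fun f hf i z hz => match i, z, hz with
      | 0, z, hz => by
        obtain ⟨N, n, h⟩ := hk0 f hf z hz
        exact ⟨N, n, 0, h.trans (map_zero _).symm⟩
      | i + 1, z, hz => hk f hf i z hz)
  have hit : ∀ j m : ℕ, (fun i => i + 1)^[j] m = m + j := by
    intro j
    induction j with
    | zero => intro m; rfl
    | succ j ih => intro m; rw [Function.iterate_succ_apply, ih]; omega
  constructor
  · intro h z hz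
    obtain ⟨N, x, hx⟩ := key 0 h z hz
    exact ⟨N, hx⟩
  · intro i hi
    have := key (i + 1) hi
    rw [hit, zero_add] at this
    exact this

end Acyclicity

section ChainMaps

open RingTheory.Sequence

variable {S : Type} [CommRing S]

lemma isWeaklyRegular_of_flat (M : Type) [AddCommGroup M] [Module S M] [Module.Flat S M]
    {fs : List S} (h : IsWeaklyRegular S fs) : IsWeaklyRegular M fs :=
  ((TensorProduct.rid S M).isWeaklyRegular_congr fs).1 (h.isWeaklyRegular_lTensor (M₂ := M))

lemma exists_lift_free {P M N : Type} [AddCommGroup P] [AddCommGroup M] [AddCommGroup N]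
    [Module S P] [Module S M] [Module S N] [Module.Free S P] [Module.Finite S P] (Δ : S)
    (d : M →ₗ[S] N) (g : P →ₗ[S] N) (h : ∀ x, ∃ (N : ℕ) (y : M), Δ ^ N • g x = d y) :
    ∃ (N : ℕ) (u : P →ₗ[S] M), Δ ^ N • g = d ∘ₗ u := by
  classical
  let b := Module.Free.chooseBasis S P
  choose n y hy using fun i => h (b i)
  refine ⟨∑ i, n i, b.constr S fun i => Δ ^ (∑ j ∈ Finset.univ.erase i, n j) • y i,
    b.ext fun i => ?_⟩
  rw [LinearMap.comp_apply, b.constr_basis, map_smul, ← hy, smul_smul, ← pow_add,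
    Finset.sum_erase_add _ _ (Finset.mem_univ i), LinearMap.smul_apply]

variable {P Q : ℕ → Type} [∀ i, AddCommGroup (P i)] [∀ i, Module S (P i)]
  [∀ i, AddCommGroup (Q i)] [∀ i, Module S (Q i)]

lemma exactUpTo_one {M N P : Type} [AddCommGroup M] [AddCommGroup N] [AddCommGroup P]
    [Module S M] [Module S N] [Module S P] {f : M →ₗ[S] N} {g : N →ₗ[S] P}
    (h : ∀ y, g y = 0 → ∃ x, y = f x) : ExactUpTo 1 f g := fun y hy => by
  obtain ⟨x, hx⟩ := h y hy
  exact ⟨0, x, by simpa using hx⟩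

lemma ExactUpTo.exists_eq {M N P : Type} [AddCommGroup M] [AddCommGroup N] [AddCommGroup P]
    [Module S M] [Module S N] [Module S P] {f : M →ₗ[S] N} {g : N →ₗ[S] P}
    (h : ExactUpTo 1 f g) {y : N} (hy : g y = 0) : ∃ x, y = f x := by
  obtain ⟨N, x, hx⟩ := h y hy
  exact ⟨x, by simpa using hx⟩

/-- `h` is a homotopy in degrees at most `k` contracting multiplication by `f`. -/
def IsContraction (d : ∀ i, P (i + 1) →ₗ[S] P i) (k : ℕ) (f : S)
    (h : ∀ i, P i →ₗ[S] P (i + 1)) : Prop :=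
  (∀ x, f • x = d 0 (h 0 x)) ∧ ∀ i < k, ∀ x, f • x = d (i + 1) (h (i + 1) x) + h i (d i x)

/-- A finite complex on which the elements of a regular sequence act by zero up to homotopy
is acyclic. -/
theorem chain_exact_of_contraction (fs : List S) (d : ∀ i, P (i + 1) →ₗ[S] P i)
    (hdd : ∀ i z, d i (d (i + 1) z) = 0) (h0 : ∀ i, fs.length < i → ∀ z : P i, z = 0)
    (hreg : ∀ i, IsWeaklyRegular (P i) fs) (hh : ∀ f ∈ fs, ∃ h, IsContraction d fs.length f h) :
    ∀ i, ExactUpTo 1 (d (i + 1)) (d i) := by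
  intro i
  rcases Nat.lt_or_ge i fs.length with hi | hi
  · refine chain_exactUpTo 1 fs d hdd (h0 _ (by omega)) hreg (fun f hf z => ?_)
      (fun f hf i z hz => ?_) i hi
    · obtain ⟨h, h1, h2⟩ := hh f hf
      exact ⟨0, 1, h 0 z, by simpa using h1 z⟩
    · obtain ⟨h, h1, h2⟩ := hh f hf
      rcases Nat.lt_or_ge i fs.length with hi' | hi'
      · exact ⟨0, 1, h (i + 1) z, by simpa [hz] using h2 i hi' z⟩
      · exact ⟨0, 0, 0, by rw [h0 (i + 1) (by omega) z]; simp⟩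
  · exact exactUpTo_one fun y _ => ⟨0, by rw [h0 (i + 1) (by omega) y, map_zero]⟩

theorem dual_exact_of_contraction (fs : List S) (d : ∀ i, P (i + 1) →ₗ[S] P i)
    (hdd : ∀ i z, d i (d (i + 1) z) = 0)
    (hreg : ∀ i, IsWeaklyRegular (Module.Dual S (P i)) fs)
    (hh : ∀ f ∈ fs, ∀ k, ∃ h, IsContraction d k f h) :
    (0 < fs.length → Function.Injective (d 0).dualMap) ∧
      ∀ i, i + 1 < fs.length → Function.Exact (d i).dualMap (d (i + 1)).dualMap := by
  have hdd' : ∀ i (z : Module.Dual S (P i)), (d (i + 1)).dualMap ((d i).dualMap z) = 0 := by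
    intro i z
    ext x
    simp [hdd]
  obtain ⟨k1, k2⟩ := cochain_exactUpTo (P := fun i => Module.Dual S (P i)) 1 fs
    (fun i => (d i).dualMap) hdd' hreg
    (fun f hf z hz => by
      obtain ⟨h, h1, h2⟩ := hh f hf 0
      refine ⟨0, 1, ?_⟩
      ext x
      have : z (d 0 (h 0 x)) = 0 := LinearMap.congr_fun hz _
      simp only [pow_zero, pow_one, one_smul, LinearMap.smul_apply, LinearMap.zero_apply]
      rw [← map_smul, h1, this])
    (fun f hf i z hz => by
      obtain ⟨h, h1, h2⟩ := hh f hf (i + 1)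
      refine ⟨0, 1, (h i).dualMap z, ?_⟩
      ext x
      have : z (d (i + 1) (h (i + 1) x)) = 0 := LinearMap.congr_fun hz _
      simp only [pow_zero, pow_one, one_smul, LinearMap.smul_apply, LinearMap.dualMap_apply]
      rw [← map_smul, h2 i (by omega), map_add, this, zero_add])
  refine ⟨fun h => (injective_iff_map_eq_zero _).2 fun z hz => ?_, fun i hi => ?_⟩
  · obtain ⟨N, hN⟩ := k1 h z hz
    simpa using hN
  · intro z
    constructor
    · intro hz
      obtain ⟨x, hx⟩ := (k2 i hi).exists_eq hz
      exact ⟨x, hx.symm⟩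
    · rintro ⟨x, rfl⟩
      exact hdd' i x

/-- Multiplication by a contractible element kills the dual cokernels. -/
lemma IsContraction.smul_dual_mem {d : ∀ i, P (i + 1) →ₗ[S] P i} {k : ℕ} {f : S}
    {h : ∀ i, P i →ₗ[S] P (i + 1)} (hh : IsContraction d k f h) {i : ℕ} (hi : i < k)
    (h0 : ∀ z : P (i + 2), z = 0) (μ : Module.Dual S (P (i + 1))) :
    f • μ ∈ LinearMap.range (d i).dualMap := by
  refine ⟨(h i).dualMap μ, ?_⟩
  ext x
  have := hh.2 i hi x
  rw [h0 (h (i + 1) x), map_zero, zero_add] at this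
  simp only [LinearMap.dualMap_apply, LinearMap.smul_apply]
  rw [← this, map_smul]

variable [∀ i, Module.Free S (P i)] [∀ i, Module.Finite S (P i)]

/-- Lifting of chain maps up to powers of `Δ`. -/
theorem exists_chainMap (Δ : S) (dP : ∀ i, P (i + 1) →ₗ[S] P i) (dQ : ∀ i, Q (i + 1) →ₗ[S] Q i)
    (hP : ∀ i x, dP i (dP (i + 1) x) = 0) (f₀ : P 0 →ₗ[S] Q 0)
    (h₀ : ∀ x, ∃ (N : ℕ) (y : Q 1), Δ ^ N • f₀ (dP 0 x) = dQ 0 y) (k : ℕ)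
    (hQ : ∀ i < k, ExactUpTo Δ (dQ (i + 1)) (dQ i)) :
    ∃ (N : ℕ) (f : ∀ i, P i →ₗ[S] Q i), f 0 = Δ ^ N • f₀ ∧
      ∀ i ≤ k, ∀ x, dQ i (f (i + 1) x) = f i (dP i x) := by
  induction k with
  | zero =>
    obtain ⟨N, u, hu⟩ := exists_lift_free Δ (dQ 0) (f₀ ∘ₗ dP 0) h₀
    refine ⟨N, fun i => match i with
      | 0 => Δ ^ N • f₀
      | 1 => u
      | i + 2 => 0, rfl, fun i hi x => ?_⟩
    obtain rfl : i = 0 := by omega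
    exact (LinearMap.congr_fun hu x).symm
  | succ k ih =>
    obtain ⟨N, f, hf0, hf⟩ := ih fun i hi => hQ i (by omega)
    obtain ⟨N', u, hu⟩ := exists_lift_free Δ (dQ (k + 1)) (f (k + 1) ∘ₗ dP (k + 1)) (fun x =>
      hQ k (by omega) _ (by
        rw [LinearMap.comp_apply, hf k le_rfl, hP, map_zero]))
    refine ⟨N' + N, Function.update (fun i => Δ ^ N' • f i) (k + 2) u, ?_, fun i hi x => ?_⟩
    · rw [Function.update_of_ne (by omega), hf0, smul_smul, pow_add]
    · rcases Nat.lt_or_ge i (k + 1) with h | h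
      · rw [Function.update_of_ne (by omega), Function.update_of_ne (by omega)]
        simp only [LinearMap.smul_apply, map_smul, hf i (by omega)]
      · obtain rfl : i = k + 1 := by omega
        rw [Function.update_self, Function.update_of_ne (by omega)]
        exact (LinearMap.congr_fun hu x).symm

/-- Uniqueness of lifts up to homotopy and up to powers of `Δ`. -/
theorem exists_homotopy (Δ : S) (dP : ∀ i, P (i + 1) →ₗ[S] P i) (dQ : ∀ i, Q (i + 1) →ₗ[S] Q i)
    (f : ∀ i, P i →ₗ[S] Q i) (h₀ : ∀ x, ∃ (N : ℕ) (y : Q 1), Δ ^ N • f 0 x = dQ 0 y) (k : ℕ)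
    (hP : ∀ i x, dP i (dP (i + 1) x) = 0)
    (hQ : ∀ i < k, ExactUpTo Δ (dQ (i + 1)) (dQ i))
    (hf : ∀ i < k, ∀ x, dQ i (f (i + 1) x) = f i (dP i x)) :
    ∃ (N : ℕ) (h : ∀ i, P i →ₗ[S] Q (i + 1)), (∀ x, Δ ^ N • f 0 x = dQ 0 (h 0 x)) ∧
      ∀ i < k, ∀ x, Δ ^ N • f (i + 1) x = dQ (i + 1) (h (i + 1) x) + h i (dP i x) := by
  induction k with
  | zero =>
    obtain ⟨N, u, hu⟩ := exists_lift_free Δ (dQ 0) (f 0) h₀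
    refine ⟨N, fun i => match i with
      | 0 => u
      | i + 1 => 0, fun x => LinearMap.congr_fun hu x, fun i hi => by omega⟩
  | succ k ih =>
    obtain ⟨N, h, hh0, hh⟩ := ih (fun i hi => hQ i (by omega)) (fun i hi => hf i (by omega))
    obtain ⟨N', u, hu⟩ := exists_lift_free Δ (dQ (k + 1)) (Δ ^ N • f (k + 1) - h k ∘ₗ dP k)
      (fun x => hQ k (by omega) _ (by
        have hk := hf k (by omega) x
        rw [LinearMap.sub_apply, LinearMap.smul_apply, map_sub, map_smul, hk,
          LinearMap.comp_apply, sub_eq_zero]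
        cases k with
        | zero => exact hh0 _
        | succ k => rw [hh k (by omega), hP, map_zero, add_zero]))
    refine ⟨N' + N, Function.update (fun i => Δ ^ N' • h i) (k + 1) u, fun x => ?_,
      fun i hi x => ?_⟩
    · rw [Function.update_of_ne (by omega), pow_add, mul_smul, hh0]; simp
    · rcases Nat.lt_or_ge i k with h' | h'
      · rw [Function.update_of_ne (by omega), Function.update_of_ne (by omega), pow_add, mul_smul,
          hh i h']
        simp
      · obtain rfl : i = k := by omega
        rw [Function.update_self, Function.update_of_ne (by omega)]
        have := LinearMap.congr_fun hu x
        simp only [LinearMap.smul_apply, LinearMap.sub_apply, LinearMap.comp_apply,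
          smul_sub] at this ⊢
        rw [← this, pow_add, mul_smul, sub_add_cancel]

lemma exists_isContraction (d : ∀ i, P (i + 1) →ₗ[S] P i) (k : ℕ) (f : S)
    (hd : ∀ i x, d i (d (i + 1) x) = 0) (hex : ∀ i < k, ExactUpTo 1 (d (i + 1)) (d i))
    (h₀ : ∀ x, ∃ y, f • x = d 0 y) : ∃ h, IsContraction d k f h := by
  obtain ⟨N, h, h1, h2⟩ := exists_homotopy 1 d d (fun i => f • LinearMap.id)
    (fun x => by obtain ⟨y, hy⟩ := h₀ x; exact ⟨0, y, by simpa using hy⟩) k hd hex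
    (fun i _ x => by simp)
  exact ⟨h, by simpa using h1, by simpa using h2⟩

/-- Two finite free resolutions of the same module have isomorphic top dual cokernels. -/
theorem nonempty_dualCoker_equiv [∀ i, Module.Free S (Q i)] [∀ i, Module.Finite S (Q i)]
    (dP : ∀ i, P (i + 1) →ₗ[S] P i) (dQ : ∀ i, Q (i + 1) →ₗ[S] Q i)
    {M : Type} [AddCommGroup M] [Module S M] (εP : P 0 →ₗ[S] M) (εQ : Q 0 →ₗ[S] M)
    (sP : Function.Surjective εP) (sQ : Function.Surjective εQ)
    (eP : Function.Exact (dP 0) εP) (eQ : Function.Exact (dQ 0) εQ)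
    (xP : ∀ i, Function.Exact (dP (i + 1)) (dP i)) (xQ : ∀ i, Function.Exact (dQ (i + 1)) (dQ i))
    (c : ℕ) (zP : ∀ z : P (c + 2), z = 0) (zQ : ∀ z : Q (c + 2), z = 0) :
    Nonempty ((Module.Dual S (P (c + 1)) ⧸ LinearMap.range (dP c).dualMap) ≃ₗ[S]
      (Module.Dual S (Q (c + 1)) ⧸ LinearMap.range (dQ c).dualMap)) := by
  have main : ∀ {P Q : ℕ → Type} [∀ i, AddCommGroup (P i)] [∀ i, Module S (P i)]
      [∀ i, AddCommGroup (Q i)] [∀ i, Module S (Q i)]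
      [∀ i, Module.Free S (P i)] [∀ i, Module.Finite S (P i)]
      (dP : ∀ i, P (i + 1) →ₗ[S] P i) (dQ : ∀ i, Q (i + 1) →ₗ[S] Q i)
      (εP : P 0 →ₗ[S] M) (εQ : Q 0 →ₗ[S] M) (_ : Function.Surjective εQ)
      (_ : Function.Exact (dP 0) εP) (_ : Function.Exact (dQ 0) εQ)
      (_ : ∀ i, Function.Exact (dP (i + 1)) (dP i)) (_ : ∀ i, Function.Exact (dQ (i + 1)) (dQ i)),
      ∃ f : ∀ i, P i →ₗ[S] Q i, (∀ x, εQ (f 0 x) = εP x) ∧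
        ∀ i ≤ c, ∀ x, dQ i (f (i + 1) x) = f i (dP i x) := by
    intro P Q _ _ _ _ _ _ dP dQ εP εQ sQ eP eQ xP xQ
    obtain ⟨N, f₀, hf₀⟩ := exists_lift_free (1 : S) εQ εP (fun x => by
      obtain ⟨y, hy⟩ := sQ (εP x)
      exact ⟨0, y, by simp [hy]⟩)
    rw [one_pow, one_smul] at hf₀
    obtain ⟨N, f, hf, hf'⟩ := exists_chainMap 1 dP dQ (fun i x => (xP i _).2 ⟨x, rfl⟩) f₀ (fun x => by
      have : εQ (f₀ (dP 0 x)) = 0 := by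
        rw [← LinearMap.comp_apply, ← hf₀]; exact (eP _).2 ⟨x, rfl⟩
      obtain ⟨y, hy⟩ := (eQ _).1 this
      exact ⟨0, y, by simp [hy]⟩) c
      (fun i _ => exactUpTo_one fun y hy => by
        obtain ⟨x, hx⟩ := (xQ i y).1 hy
        exact ⟨x, hx.symm⟩)
    refine ⟨f, fun x => ?_, hf'⟩
    rw [hf, one_pow, one_smul, hf₀, LinearMap.comp_apply]
  obtain ⟨f, hf0, hf⟩ := main dP dQ εP εQ sQ eP eQ xP xQ
  obtain ⟨g, hg0, hg⟩ := main dQ dP εQ εP sP eQ eP xQ xP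
  have hom : ∀ {P Q : ℕ → Type} [∀ i, AddCommGroup (P i)] [∀ i, Module S (P i)]
      [∀ i, AddCommGroup (Q i)] [∀ i, Module S (Q i)]
      [∀ i, Module.Free S (P i)] [∀ i, Module.Finite S (P i)]
      (dP : ∀ i, P (i + 1) →ₗ[S] P i) (dQ : ∀ i, Q (i + 1) →ₗ[S] Q i)
      (εP : P 0 →ₗ[S] M) (εQ : Q 0 →ₗ[S] M)
      (_ : Function.Exact (dP 0) εP)
      (_ : ∀ i, Function.Exact (dP (i + 1)) (dP i))
      (f : ∀ i, P i →ₗ[S] Q i) (g : ∀ i, Q i →ₗ[S] P i) (_ : ∀ x, εQ (f 0 x) = εP x)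
      (_ : ∀ x, εP (g 0 x) = εQ x)
      (_ : ∀ i ≤ c, ∀ x, dQ i (f (i + 1) x) = f i (dP i x))
      (_ : ∀ i ≤ c, ∀ x, dP i (g (i + 1) x) = g i (dQ i x))
      (_ : ∀ z : P (c + 2), z = 0) (z : Module.Dual S (P (c + 1))),
      ∃ y, z - (f (c + 1)).dualMap ((g (c + 1)).dualMap z) = (dP c).dualMap y := by
    intro P Q _ _ _ _ _ _ dP dQ εP εQ eP xP f g hf0 hg0 hf hg zP z
    obtain ⟨N, h, -, hh⟩ := exists_homotopy 1 dP dP (fun i => LinearMap.id - g i ∘ₗ f i)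
      (fun x => by
        have : εP (x - g 0 (f 0 x)) = 0 := by rw [map_sub, hg0, hf0, sub_self]
        obtain ⟨y, hy⟩ := (eP _).1 this
        exact ⟨0, y, by simp [hy]⟩) (c + 1) (fun i x => (xP i _).2 ⟨x, rfl⟩)
      (fun i _ => exactUpTo_one fun y hy => by
        obtain ⟨x, hx⟩ := (xP i y).1 hy
        exact ⟨x, hx.symm⟩)
      (fun i hi x => by
        simp only [LinearMap.sub_apply, LinearMap.id_apply, LinearMap.comp_apply, map_sub]
        rw [hg i (by omega), hf i (by omega)])
    refine ⟨(h c).dualMap z, ?_⟩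
    ext x
    have := hh c (by omega) x
    rw [zP (h (c + 1) x), map_zero, zero_add, one_pow, one_smul] at this
    simp only [LinearMap.sub_apply, LinearMap.dualMap_apply, ← this, map_sub, LinearMap.id_apply,
      LinearMap.comp_apply]
  have hfm : LinearMap.range (dQ c).dualMap ≤
      (LinearMap.range (dP c).dualMap).comap (f (c + 1)).dualMap := by
    rintro _ ⟨y, rfl⟩
    refine ⟨(f c).dualMap y, ?_⟩
    ext x
    simp [hf c le_rfl]
  have hgm : LinearMap.range (dP c).dualMap ≤
      (LinearMap.range (dQ c).dualMap).comap (g (c + 1)).dualMap := by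
    rintro _ ⟨y, rfl⟩
    refine ⟨(g c).dualMap y, ?_⟩
    ext x
    simp [hg c le_rfl]
  refine ⟨LinearEquiv.ofLinearMap (Submodule.mapQ _ _ _ hgm) (Submodule.mapQ _ _ _ hfm) ?_ ?_⟩
  · ext z
    obtain ⟨y, hy⟩ := hom dQ dP εQ εP eQ xQ g f hg0 hf0 hg hf zQ z
    simp only [LinearMap.comp_apply, Submodule.mkQ_apply, Submodule.mapQ_apply, LinearMap.id_apply]
    rw [eq_comm, Submodule.Quotient.eq, hy]
    exact ⟨y, rfl⟩
  · ext z
    obtain ⟨y, hy⟩ := hom dP dQ εP εQ eP xP f g hf0 hg0 hf hg zP z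
    simp only [LinearMap.comp_apply, Submodule.mkQ_apply, Submodule.mapQ_apply, LinearMap.id_apply]
    rw [eq_comm, Submodule.Quotient.eq, hy]
    exact ⟨y, rfl⟩

end ChainMaps

section BaseChange

open RingTheory.Sequence

variable {S R' : Type} [CommRing S] [CommRing R']

lemma exists_matrix_of_mulVec {l m n : Type} [Fintype m] [Fintype n] [DecidableEq n] (Q : Matrix l m S) (M : Matrix l n S)
    (h : ∀ x, ∃ y, M *ᵥ x = Q *ᵥ y) : ∃ β : Matrix m n S, M = Q * β := by
  choose y hy using fun j => h (Pi.single j 1)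
  refine ⟨Matrix.of fun i j => y j i, Matrix.ext_of_mulVec_single fun j => ?_⟩
  rw [hy, ← mulVec_mulVec]
  congr 1
  ext i
  simp

/-- An isomorphism of cokernels of matrices is preserved under base change. -/
theorem nonempty_coker_map_equiv {m n m' n' : Type} [Fintype m] [Fintype n] [Fintype m']
    [Fintype n'] [DecidableEq m] [DecidableEq n] [DecidableEq m'] [DecidableEq n']
    (φ : S →+* R') (P : Matrix m n S) (Q : Matrix m' n' S)
    (e : ((m → S) ⧸ LinearMap.range P.mulVecLin) ≃ₗ[S] ((m' → S) ⧸ LinearMap.range Q.mulVecLin)) :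
    Nonempty (((m → R') ⧸ LinearMap.range (P.map φ).mulVecLin) ≃ₗ[R']
      ((m' → R') ⧸ LinearMap.range (Q.map φ).mulVecLin)) := by
  have lift : ∀ {m n m' n' : Type} [Fintype m] [Fintype n] [Fintype m']
      [Fintype n'] [DecidableEq m] [DecidableEq n] [DecidableEq m'] [DecidableEq n']
      (P : Matrix m n S) (Q : Matrix m' n' S)
      (e : ((m → S) ⧸ LinearMap.range P.mulVecLin) →ₗ[S] ((m' → S) ⧸ LinearMap.range Q.mulVecLin)),
      ∃ (α : Matrix m' m S), (∀ x, e (Submodule.Quotient.mk x) = Submodule.Quotient.mk (α *ᵥ x)) ∧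
        ∃ β : Matrix n' n S, α * P = Q * β := by
    intro m n m' n' _ _ _ _ _ _ _ _ P Q e
    obtain ⟨u, hu⟩ := Module.projective_lifting_property (Submodule.mkQ (LinearMap.range Q.mulVecLin))
      (e ∘ₗ Submodule.mkQ (LinearMap.range P.mulVecLin)) (Submodule.mkQ_surjective _)
    have hα : ∀ x, e (Submodule.Quotient.mk x) =
        Submodule.Quotient.mk ((LinearMap.toMatrix' u) *ᵥ x) := by
      intro x
      rw [LinearMap.toMatrix'_mulVec]
      exact (LinearMap.congr_fun hu x).symm
    refine ⟨LinearMap.toMatrix' u, hα, exists_matrix_of_mulVec _ _ fun x => ?_⟩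
    have h1 : (Submodule.Quotient.mk (P *ᵥ x) : (m → S) ⧸ LinearMap.range P.mulVecLin) = 0 :=
      (Submodule.Quotient.mk_eq_zero _).2 ⟨x, rfl⟩
    have h2 := hα (P *ᵥ x)
    rw [h1, map_zero, eq_comm, Submodule.Quotient.mk_eq_zero] at h2
    obtain ⟨y, hy⟩ := h2
    exact ⟨y, by rw [← mulVec_mulVec]; exact hy.symm⟩
  obtain ⟨α, hα, β, hβ⟩ := lift P Q e.toLinearMap
  obtain ⟨α', hα', β', hβ'⟩ := lift Q P e.symm.toLinearMap
  have inv : ∀ {m n m' n' : Type} [Fintype m] [Fintype n] [Fintype m']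
      [Fintype n'] [DecidableEq m] [DecidableEq n] [DecidableEq m'] [DecidableEq n']
      (P : Matrix m n S) (Q : Matrix m' n' S) (e : ((m → S) ⧸ LinearMap.range P.mulVecLin) ≃ₗ[S]
        ((m' → S) ⧸ LinearMap.range Q.mulVecLin)) (α : Matrix m' m S) (α' : Matrix m m' S)
      (_ : ∀ x, e (Submodule.Quotient.mk x) = Submodule.Quotient.mk (α *ᵥ x))
      (_ : ∀ x, e.symm (Submodule.Quotient.mk x) = Submodule.Quotient.mk (α' *ᵥ x)),
      ∃ γ : Matrix n m S, α' * α - 1 = P * γ := by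
    intro m n m' n' _ _ _ _ _ _ _ _ P Q e α α' h h'
    refine exists_matrix_of_mulVec _ _ fun x => ?_
    have : (Submodule.Quotient.mk (α' *ᵥ (α *ᵥ x)) : (m → S) ⧸ LinearMap.range P.mulVecLin) =
        Submodule.Quotient.mk x := by
      rw [← h', ← h, e.symm_apply_apply]
    rw [Submodule.Quotient.eq] at this
    obtain ⟨y, hy⟩ := this
    exact ⟨y, by rw [sub_mulVec, ← mulVec_mulVec, one_mulVec]; exact hy.symm⟩
  obtain ⟨γ, hγ⟩ := inv P Q e α α' hα hα'
  obtain ⟨γ', hγ'⟩ := inv Q P e.symm α' α hα' (by simpa using hα)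
  have hle : ∀ {m n m' n' : Type} [Fintype m] [Fintype n] [Fintype m']
      [Fintype n'] (P : Matrix m n S) (Q : Matrix m' n' S)
      (α : Matrix m' m S) (β : Matrix n' n S) (_ : α * P = Q * β),
      LinearMap.range (P.map φ).mulVecLin ≤
        (LinearMap.range (Q.map φ).mulVecLin).comap (α.map φ).mulVecLin := by
    rintro m n m' n' _ _ _ _ P Q α β h _ ⟨x, rfl⟩
    refine ⟨(β.map φ) *ᵥ x, ?_⟩
    rw [mulVecLin_apply, mulVecLin_apply, mulVecLin_apply, mulVec_mulVec, mulVec_mulVec,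
      ← Matrix.map_mul, ← Matrix.map_mul, h]
  have hid : ∀ {m n m' : Type} [Fintype m] [Fintype n] [Fintype m'] [DecidableEq m]
      (P : Matrix m n S) (α : Matrix m' m S) (α' : Matrix m m' S) (γ : Matrix n m S)
      (_ : α' * α - 1 = P * γ) (x : m → R'),
      (α'.map φ) *ᵥ ((α.map φ) *ᵥ x) - x ∈ LinearMap.range (P.map φ).mulVecLin := by
    intro m n m' _ _ _ _ P α α' γ h x
    refine ⟨(γ.map φ) *ᵥ x, ?_⟩
    rw [mulVecLin_apply, mulVec_mulVec, mulVec_mulVec, ← Matrix.map_mul, ← Matrix.map_mul, ← h,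
      Matrix.map_sub _ (map_sub φ), sub_mulVec, Matrix.map_one _ (map_zero φ) (map_one φ),
      one_mulVec]
  refine ⟨LinearEquiv.ofLinearMap
    (Submodule.mapQ _ _ (α.map φ).mulVecLin (hle P Q α β hβ))
    (Submodule.mapQ _ _ (α'.map φ).mulVecLin (hle Q P α' β' hβ')) ?_ ?_⟩
  · refine Submodule.linearMap_qext _ (LinearMap.ext fun x => ?_)
    simp only [LinearMap.comp_apply, Submodule.mkQ_apply, Submodule.mapQ_apply, LinearMap.id_apply]
    rw [Submodule.Quotient.eq]
    exact hid Q α' α γ' hγ' x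
  · refine Submodule.linearMap_qext _ (LinearMap.ext fun x => ?_)
    simp only [LinearMap.comp_apply, Submodule.mkQ_apply, Submodule.mapQ_apply, LinearMap.id_apply]
    rw [Submodule.Quotient.eq]
    exact hid P α α' γ hγ x

namespace IsFreeRes

variable {J : Ideal S} {c : ℕ} {b : ℕ → ℕ} {D : ∀ i, Matrix (Fin (b i)) (Fin (b (i + 1))) S}
  {e₀ : Fin (b 0)}

lemma mulVec_mulVec_eq_zero (h : IsFreeRes J c b D e₀) (i : ℕ) (x : Fin (b (i + 1 + 1)) → S) :
    (D i).mulVecLin ((D (i + 1)).mulVecLin x) = 0 :=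
  (h.exact i _).2 ⟨x, rfl⟩

lemma eq_zero (h : IsFreeRes J c b D e₀) {i : ℕ} (hi : c < i) (z : Fin (b i) → S) : z = 0 := by
  funext j
  have := h.zero i hi
  exact absurd j.2 (by omega)

lemma exactUpTo_one (h : IsFreeRes J c b D e₀) (i : ℕ) :
    ExactUpTo 1 (D (i + 1)).mulVecLin (D i).mulVecLin :=
  KMR.exactUpTo_one fun y hy => by
    obtain ⟨x, hx⟩ := (h.exact i y).1 hy
    exact ⟨x, hx.symm⟩

lemma single_base (h : IsFreeRes J c b D e₀) (x : Fin (b 0) → S) : x = Pi.single e₀ (x e₀) := by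
  funext j
  rw [h.eq_base j, Pi.single_eq_same]

lemma smul_mem_range (h : IsFreeRes J c b D e₀) {f : S} (hf : f ∈ J) (x : Fin (b 0) → S) :
    ∃ y, f • x = (D 0).mulVecLin y := by
  obtain ⟨y, hy⟩ := (h.mem_iff f).1 hf
  refine ⟨x e₀ • y, ?_⟩
  rw [map_smul, hy]
  funext j
  rw [h.eq_base j]
  simp [mul_comm]

lemma exists_isContraction (h : IsFreeRes J c b D e₀) {f : S} (hf : f ∈ J) (k : ℕ) :
    ∃ u, IsContraction (P := fun i => Fin (b i) → S) (fun i => (D i).mulVecLin) k f u :=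
  KMR.exists_isContraction (P := fun i => Fin (b i) → S) _ k f h.mulVec_mulVec_eq_zero
    (fun i _ => h.exactUpTo_one i) (h.smul_mem_range hf)

lemma exists_isContraction_map (h : IsFreeRes J c b D e₀) (φ : S →+* R') {f : R'}
    (hf : f ∈ J.map φ) (k : ℕ) :
    ∃ u, IsContraction (P := fun i => Fin (b i) → R')
      (fun i => ((D i).map φ).mulVecLin) k f u := by
  refine Submodule.span_induction (fun f hf => ?_) ?_ (fun f g _ _ hf hg => ?_)
    (fun a f _ hf => ?_) hf
  · obtain ⟨f, hf, rfl⟩ := hf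
    obtain ⟨u, h1, h2⟩ := h.exists_isContraction hf k
    have e1 : f • (1 : Matrix (Fin (b 0)) (Fin (b 0)) S) = D 0 * LinearMap.toMatrix' (u 0) := by
      refine Matrix.ext_of_mulVec_single fun j => ?_
      rw [smul_mulVec, one_mulVec, ← mulVec_mulVec, LinearMap.toMatrix'_mulVec]
      exact h1 _
    have e2 : ∀ i < k, f • (1 : Matrix (Fin (b (i + 1))) (Fin (b (i + 1))) S) =
        D (i + 1) * LinearMap.toMatrix' (u (i + 1)) + LinearMap.toMatrix' (u i) * D i := by
      intro i hi
      refine Matrix.ext_of_mulVec_single fun j => ?_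
      rw [smul_mulVec, one_mulVec, add_mulVec, ← mulVec_mulVec, LinearMap.toMatrix'_mulVec,
        ← mulVec_mulVec, LinearMap.toMatrix'_mulVec]
      exact h2 i hi _
    have hs : ∀ (n : ℕ) , (f • (1 : Matrix (Fin n) (Fin n) S)).map φ =
        φ f • (1 : Matrix (Fin n) (Fin n) R') := by
      intro n
      ext i j
      simp [Matrix.one_apply, apply_ite φ]
    refine ⟨fun i => ((LinearMap.toMatrix' (u i)).map φ).mulVecLin, fun x => ?_, fun i hi x => ?_⟩
    · have := congrArg (fun M : Matrix _ _ S => M.map φ) e1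
      simp only [hs, Matrix.map_mul] at this
      have := congrArg (fun M : Matrix _ _ R' => M *ᵥ x) this
      simpa only [smul_mulVec, one_mulVec, ← mulVec_mulVec, mulVecLin_apply] using this
    · have := congrArg (fun M : Matrix _ _ S => M.map φ) (e2 i hi)
      simp only [hs, Matrix.map_mul, Matrix.map_add _ (map_add φ)] at this
      have := congrArg (fun M : Matrix _ _ R' => M *ᵥ x) this
      simpa only [smul_mulVec, one_mulVec, ← mulVec_mulVec, add_mulVec, mulVecLin_apply] using this
  · exact ⟨fun i => 0, fun x => by simp, fun i hi x => by simp⟩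
  · obtain ⟨u, h1, h2⟩ := hf
    obtain ⟨v, h3, h4⟩ := hg
    refine ⟨fun i => u i + v i, fun x => ?_, fun i hi x => ?_⟩
    · rw [add_smul, h1, h3, ← map_add]; rfl
    · rw [add_smul, h2 i hi, h4 i hi, LinearMap.add_apply, LinearMap.add_apply, map_add]
      abel
  · obtain ⟨u, h1, h2⟩ := hf
    refine ⟨fun i => a • u i, fun x => ?_, fun i hi x => ?_⟩
    · rw [smul_eq_mul, mul_smul, h1, ← map_smul]; rfl
    · rw [smul_eq_mul, mul_smul, h2 i hi, LinearMap.smul_apply, LinearMap.smul_apply, map_smul,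
        smul_add]

/-- Free resolutions of perfect ideals are preserved under base change to a ring in which the
extended ideal contains a weakly regular sequence of the same length. -/
theorem baseChange (h : IsFreeRes J c b D e₀) (φ : S →+* R') (fs : List R')
    (hlen : fs.length = c) (hfs : ∀ f ∈ fs, f ∈ J.map φ) (hreg : IsWeaklyRegular R' fs) :
    IsFreeRes (J.map φ) c b (fun i => (D i).map φ) e₀ := by
  have hdd : ∀ i (z : Fin (b (i + 1 + 1)) → R'),
      ((D i).map φ).mulVecLin (((D (i + 1)).map φ).mulVecLin z) = 0 := by
    intro i z
    have h0 : D i * D (i + 1) = 0 := Matrix.ext_of_mulVec_single fun j => by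
      rw [← mulVec_mulVec, zero_mulVec]
      exact h.mulVec_mulVec_eq_zero i _
    rw [mulVecLin_apply, mulVecLin_apply, mulVec_mulVec, ← Matrix.map_mul, h0]
    simp
  have hz : ∀ i, c < i → ∀ z : Fin (b i) → R', z = 0 := by
    intro i hi z
    funext j
    have := h.zero i hi
    exact absurd j.2 (by omega)
  have hex := chain_exact_of_contraction (P := fun i => Fin (b i) → R') fs
    (fun i => ((D i).map φ).mulVecLin) hdd (fun i hi => hz i (by omega))
    (fun i => isWeaklyRegular_of_flat _ hreg)
    (fun f hf => h.exists_isContraction_map φ (hfs f hf) _)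
  refine ⟨h.eq_base, fun f => ⟨fun hf => ?_, ?_⟩, fun i z => ⟨fun hz => ?_, ?_⟩, h.zero⟩
  · obtain ⟨u, h1, -⟩ := h.exists_isContraction_map φ hf 0
    refine ⟨u 0 (Pi.single e₀ 1), ?_⟩
    rw [← h1, ← Pi.single_smul, smul_eq_mul, mul_one]
  · rintro ⟨y, hy⟩
    have : f = ∑ j, φ (D 0 e₀ j) * y j := by
      have := congrFun hy e₀
      rw [Pi.single_eq_same] at this
      rw [← this]; rfl
    rw [this]
    refine Ideal.sum_mem _ fun j _ => Ideal.mul_mem_right _ _ (Ideal.mem_map_of_mem _ ?_)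
    refine (h.mem_iff _).2 ⟨Pi.single j 1, ?_⟩
    rw [h.single_base ((D 0).mulVecLin _)]
    simp
  · obtain ⟨x, hx⟩ := (hex i).exists_eq hz
    exact ⟨x, hx.symm⟩
  · rintro ⟨x, rfl⟩
    exact hdd i x

/-- The augmentation of the resolution of `S ⧸ J`. -/
def aug (J : Ideal S) (e₀ : Fin (b 0)) : (Fin (b 0) → S) →ₗ[S] S ⧸ J :=
  Submodule.mkQ J ∘ₗ LinearMap.proj e₀

lemma aug_surjective (J : Ideal S) (e₀ : Fin (b 0)) : Function.Surjective (aug (b := b) J e₀) := by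
  intro y
  obtain ⟨y, rfl⟩ := Submodule.mkQ_surjective J y
  exact ⟨Pi.single e₀ y, by simp [aug]⟩

lemma exact_aug (h : IsFreeRes J c b D e₀) :
    Function.Exact (D 0).mulVecLin (aug J e₀) := by
  intro x
  rw [← LinearMap.coe_range, SetLike.mem_coe, h.single_base x, ← h.mem_iff]
  simp [aug, Ideal.Quotient.eq_zero_iff_mem]

end IsFreeRes

end BaseChange

section Koszul

variable {S : Type} [CommRing S] {M N : Type} [AddCommGroup M] [Module S M]
  [AddCommGroup N] [Module S N]

/-- Contraction of the exterior algebra by a linear functional. -/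
def ctr (F : Module.Dual S M) : ExteriorAlgebra S M →ₗ[S] ExteriorAlgebra S M :=
  CliffordAlgebra.contractLeft (Q := (0 : QuadraticForm S M)) F

lemma ctr_ι_mul (F : Module.Dual S M) (v : M) (x : ExteriorAlgebra S M) :
    ctr F (ExteriorAlgebra.ι S v * x) = F v • x - ExteriorAlgebra.ι S v * ctr F x :=
  CliffordAlgebra.contractLeft_ι_mul _ _ _

lemma ctr_algebraMap (F : Module.Dual S M) (s : S) : ctr F (algebraMap S _ s) = 0 :=
  CliffordAlgebra.contractLeft_algebraMap _ _ _

lemma ctr_ctr (F : Module.Dual S M) (x : ExteriorAlgebra S M) : ctr F (ctr F x) = 0 :=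
  CliffordAlgebra.contractLeft_contractLeft _ _

lemma ctr_comm (F G : Module.Dual S M) (x : ExteriorAlgebra S M) :
    ctr F (ctr G x) = -ctr G (ctr F x) :=
  CliffordAlgebra.contractLeft_comm _ _ _

/-- Induction on homogeneous elements of the exterior algebra. -/
lemma exteriorPower_induction {C : ∀ n, ExteriorAlgebra S M → Prop}
    (scalar : ∀ s, C 0 (algebraMap S _ s))
    (add : ∀ n x y, C n x → C n y → C n (x + y))
    (mul : ∀ n v x, x ∈ ⋀[S]^n M → C n x → C (n + 1) (ExteriorAlgebra.ι S v * x))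
    (n : ℕ) (x : ExteriorAlgebra S M) (hx : x ∈ ⋀[S]^n M) : C n x := by
  induction n generalizing x with
  | zero =>
    rw [ExteriorAlgebra.exteriorPower, pow_zero, Submodule.mem_one] at hx
    obtain ⟨s, rfl⟩ := hx
    exact scalar s
  | succ n ih =>
    rw [ExteriorAlgebra.exteriorPower, pow_succ'] at hx
    refine Submodule.mul_induction_on hx ?_ (add _)
    rintro _ ⟨v, rfl⟩ x hx
    exact mul n v x hx (ih x hx)

lemma ι_mul_mem (n : ℕ) (v : M) {x : ExteriorAlgebra S M} (hx : x ∈ ⋀[S]^n M) :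
    ExteriorAlgebra.ι S v * x ∈ ⋀[S]^(n + 1) M := by
  rw [ExteriorAlgebra.exteriorPower, pow_succ']
  exact Submodule.mul_mem_mul ⟨v, rfl⟩ hx

lemma ctr_mem (F : Module.Dual S M) (n : ℕ) (x : ExteriorAlgebra S M) (hx : x ∈ ⋀[S]^n M) :
    ctr F x ∈ ⋀[S]^(n - 1) M ∧ (n = 0 → ctr F x = 0) := by
  refine exteriorPower_induction (C := fun n x => ctr F x ∈ ⋀[S]^(n - 1) M ∧
    (n = 0 → ctr F x = 0)) (fun s => ?_) (fun n x y h h' => ?_) (fun n v x hx h => ?_) n x hx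
  · rw [ctr_algebraMap]
    exact ⟨zero_mem _, fun _ => rfl⟩
  · rw [map_add]
    exact ⟨add_mem h.1 h'.1, fun h0 => by rw [h.2 h0, h'.2 h0, add_zero]⟩
  · refine ⟨?_, fun h0 => by omega⟩
    rw [ctr_ι_mul]
    refine sub_mem (Submodule.smul_mem _ _ hx) ?_
    obtain _ | n := n
    · rw [h.2 rfl, mul_zero]
      exact zero_mem _
    · exact ι_mul_mem n v h.1

/-- The Koszul differential. -/
def koszul (F : Module.Dual S M) (i : ℕ) : (⋀[S]^(i + 1) M) →ₗ[S] (⋀[S]^i M) :=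
  (ctr F).restrict fun x hx => (ctr_mem F (i + 1) x hx).1

@[simp] lemma coe_koszul (F : Module.Dual S M) (i : ℕ) (x : ⋀[S]^(i + 1) M) :
    (koszul F i x : ExteriorAlgebra S M) = ctr F x := rfl

lemma koszul_koszul (F : Module.Dual S M) (i : ℕ) (x : ⋀[S]^(i + 1 + 1) M) :
    koszul F i (koszul F (i + 1) x) = 0 := Subtype.ext (ctr_ctr F _)

/-- Left multiplication by a vector. -/
def wedgeL (v : M) (i : ℕ) (x : ⋀[S]^i M) : ⋀[S]^(i + 1) M :=
  ⟨ExteriorAlgebra.ι S v * x, ι_mul_mem i v x.2⟩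

lemma koszul_wedgeL (F : Module.Dual S M) (v : M) (i : ℕ) (x : ⋀[S]^(i + 1) M) :
    koszul F (i + 1) (wedgeL v (i + 1) x) = F v • x - wedgeL v i (koszul F i x) :=
  Subtype.ext (ctr_ι_mul F v _)

lemma koszul_wedgeL_zero (F : Module.Dual S M) (v : M) (x : ⋀[S]^0 M) :
    koszul F 0 (wedgeL v 0 x) = F v • x := by
  refine Subtype.ext ((ctr_ι_mul F v _).trans ?_)
  rw [(ctr_mem F 0 x x.2).2 rfl, mul_zero, sub_zero]
  rfl

lemma coe_exteriorPower_map (T : M →ₗ[S] N) (i : ℕ) (x : ⋀[S]^i M) :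
    (exteriorPower.map i T x : ExteriorAlgebra S N) = ExteriorAlgebra.map T x := by
  have : (⋀[S]^i N).subtype ∘ₗ exteriorPower.map i T =
      (ExteriorAlgebra.map T).toLinearMap ∘ₗ (⋀[S]^i M).subtype := by
    refine exteriorPower.linearMap_ext ?_
    ext v
    simp [ExteriorAlgebra.map_apply_ιMulti]
  exact LinearMap.congr_fun this x

lemma ctr_map (F : Module.Dual S N) (T : M →ₗ[S] N) (x : ExteriorAlgebra S M) :
    ctr F (ExteriorAlgebra.map T x) = ExteriorAlgebra.map T (ctr (F ∘ₗ T) x) := by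
  induction x using CliffordAlgebra.left_induction with
  | algebraMap s =>
    change ctr F (ExteriorAlgebra.map T (algebraMap S _ s)) =
      ExteriorAlgebra.map T (ctr (F ∘ₗ T) (algebraMap S _ s))
    rw [AlgHom.commutes, ctr_algebraMap, ctr_algebraMap, map_zero]
  | add x y hx hy => simp only [map_add, hx, hy]
  | ι_mul x v hx =>
    change ctr F (ExteriorAlgebra.map T (ExteriorAlgebra.ι S v * x)) =
      ExteriorAlgebra.map T (ctr (F ∘ₗ T) (ExteriorAlgebra.ι S v * x))
    rw [map_mul, ExteriorAlgebra.map_apply_ι, ctr_ι_mul, ctr_ι_mul, map_sub, map_mul,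
      ExteriorAlgebra.map_apply_ι, hx, map_smul]
    rfl

lemma koszul_map (F : Module.Dual S N) (T : M →ₗ[S] N) (i : ℕ) (x : ⋀[S]^(i + 1) M) :
    koszul F i (exteriorPower.map (i + 1) T x) = exteriorPower.map i T (koszul (F ∘ₗ T) i x) := by
  refine Subtype.ext ?_
  rw [coe_koszul, coe_exteriorPower_map, ctr_map, coe_exteriorPower_map]
  rfl

open RingTheory.Sequence in
/-- The Koszul complex of `F` is exact up to powers of `Δ` when the ideal generated by the values
of `F` contains, up to powers of `Δ`, a regular sequence of maximal length. -/
theorem koszul_exactUpTo [Module.Free S M] [Module.Finite S M] (F : Module.Dual S M) (Δ : S)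
    (fs : List S) (hreg : IsWeaklyRegular S fs) (hfs : ∀ f ∈ fs, ∃ (n : ℕ) (v : M), Δ ^ n * f = F v)
    (h0 : ∀ z : ⋀[S]^(fs.length + 1) M, z = 0) :
    ∀ i < fs.length, ExactUpTo Δ (koszul F (i + 1)) (koszul F i) := by
  refine chain_exactUpTo (P := fun i => ⋀[S]^i M) Δ fs (koszul F) (koszul_koszul F) h0
    (fun i => isWeaklyRegular_of_flat _ hreg) (fun f hf z => ?_) (fun f hf i z hz => ?_)
  · obtain ⟨n, v, hv⟩ := hfs f hf
    exact ⟨n, 1, wedgeL v 0 z, by rw [koszul_wedgeL_zero, ← hv, pow_one, mul_smul]⟩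
  · obtain ⟨n, v, hv⟩ := hfs f hf
    refine ⟨n, 1, wedgeL v (i + 1) z, ?_⟩
    rw [koszul_wedgeL, hz, ← hv, pow_one, mul_smul]
    have : wedgeL v i (0 : ⋀[S]^i M) = 0 := Subtype.ext (mul_zero _)
    rw [this, sub_zero]

/-- The values of the contraction by `F` have coefficients in any ideal containing the values
of `F`. -/
lemma koszul_mem_smul_top (F : Module.Dual S M) (J : Ideal S) (hF : ∀ v, F v ∈ J) (i : ℕ)
    (x : ⋀[S]^(i + 1) M) : koszul F i x ∈ J • (⊤ : Submodule S (⋀[S]^i M)) := by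
  have key : ∀ n (x : ExteriorAlgebra S M), x ∈ ⋀[S]^n M → n ≠ 0 →
      ctr F x ∈ J • (⋀[S]^(n - 1) M) := by
    intro n x hx
    refine exteriorPower_induction (C := fun n x => n ≠ 0 → ctr F x ∈ J • (⋀[S]^(n - 1) M))
      (fun s h => absurd rfl h) (fun n x y h h' hn => ?_) (fun n v x hx h _ => ?_) n x hx
    · rw [map_add]
      exact add_mem (h hn) (h' hn)
    · rw [ctr_ι_mul]
      refine sub_mem (Submodule.smul_mem_smul (hF v) hx) ?_
      obtain _ | n := n
      · rw [(ctr_mem F 0 x hx).2 rfl, mul_zero]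
        exact zero_mem _
      · have := h n.succ_ne_zero
        refine Submodule.smul_induction_on this (fun j hj y hy => ?_) (fun y z hy hz => ?_)
        · rw [mul_smul_comm]
          exact Submodule.smul_mem_smul hj (ι_mul_mem n v hy)
        · rw [mul_add]
          exact add_mem hy hz
  have h1 := key (i + 1) x x.2 i.succ_ne_zero
  have h2 : (⋀[S]^i M).map LinearMap.id = Submodule.map (⋀[S]^i M).subtype ⊤ := by simp
  rw [Submodule.map_id] at h2
  have h3 : (koszul F i x : ExteriorAlgebra S M) ∈
      Submodule.map (⋀[S]^i M).subtype (J • (⊤ : Submodule S (⋀[S]^i M))) := by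
    rw [Submodule.map_smul'', ← h2]
    exact h1
  obtain ⟨y, hy, hyx⟩ := h3
  rwa [← Subtype.ext hyx]

section Top

variable {c : ℕ} (e : Module.Basis (Fin c) S M)

/-- The top exterior power is spanned by the product of a basis. -/
lemma ιMulti_eq_det_smul (v : Fin c → M) :
    exteriorPower.ιMulti S c v = e.det v • exteriorPower.ιMulti S c e := by
  have : exteriorPower.ιMulti S c (M := M) =
      (LinearMap.toSpanSingleton S _ (exteriorPower.ιMulti S c e)).compAlternatingMap e.det := by
    refine Module.Basis.ext_alternating e fun w hw => ?_
    obtain ⟨σ, rfl⟩ : ∃ σ : Equiv.Perm (Fin c), w = σ :=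
      ⟨Equiv.ofBijective w (Finite.injective_iff_bijective.1 hw), rfl⟩
    have h1 := (exteriorPower.ιMulti S c (M := M)).map_perm e σ
    have h2 := e.det.map_perm e σ
    simp only [LinearMap.compAlternatingMap_apply, LinearMap.toSpanSingleton_apply]
    change exteriorPower.ιMulti S c (e ∘ σ) = e.det (e ∘ σ) • _
    rw [h1, h2, e.det_self, smul_assoc, one_smul]
  exact congrArg (fun g => g v) this

/-- The coordinate on the top exterior power. -/
def topCoord : (⋀[S]^c M) →ₗ[S] S := exteriorPower.alternatingMapLinearEquiv e.det

lemma topCoord_top : topCoord e (exteriorPower.ιMulti S c e) = 1 := by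
  rw [topCoord, exteriorPower.alternatingMapLinearEquiv_apply_ιMulti, e.det_self]

lemma eq_topCoord_smul (x : ⋀[S]^c M) : x = topCoord e x • exteriorPower.ιMulti S c e := by
  have : LinearMap.id = (LinearMap.toSpanSingleton S _ (exteriorPower.ιMulti S c e)) ∘ₗ
      topCoord e := by
    refine exteriorPower.linearMap_ext ?_
    ext1 v
    simp only [LinearMap.compAlternatingMap_apply, LinearMap.id_apply, LinearMap.comp_apply,
      LinearMap.toSpanSingleton_apply, topCoord,
      exteriorPower.alternatingMapLinearEquiv_apply_ιMulti]
    exact ιMulti_eq_det_smul e v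
  exact LinearMap.congr_fun this x

lemma map_top (T : M →ₗ[S] M) : exteriorPower.map c T (exteriorPower.ιMulti S c e) =
    LinearMap.det T • exteriorPower.ιMulti S c e := by
  rw [exteriorPower.map_apply_ιMulti, ιMulti_eq_det_smul e, Module.Basis.det_comp, e.det_self,
    mul_one]

lemma exteriorPower_succ_eq_zero (e : Module.Basis (Fin c) S M) (z : ⋀[S]^(c + 1) M) : z = 0 := by
  have : LinearMap.id = (0 : (⋀[S]^(c + 1) M) →ₗ[S] _) := by
    refine exteriorPower.linearMap_ext (Module.Basis.ext_alternating e fun w hw => ?_)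
    have := Fintype.card_le_of_injective _ hw
    simp at this
  exact LinearMap.congr_fun this z

end Top

end Koszul

section Chart

variable {S : Type} [CommRing S] {M : Type} [AddCommGroup M] [Module S M]

lemma LinearMap.apply_mem_of_mem_smul_top {P : Type} [AddCommGroup P] [Module S P] {J : Ideal S}
    {x : P} (hx : x ∈ J • (⊤ : Submodule S P)) (ν : P →ₗ[S] S) : ν x ∈ J := by
  have h1 : ν x ∈ (J • (⊤ : Submodule S P)).map ν := Submodule.mem_map_of_mem hx
  rw [Submodule.map_smul''] at h1
  exact Submodule.smul_le.2 (fun r hr m _ => J.mul_mem_right m hr) h1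

variable {J : Ideal S} {c : ℕ} {b : ℕ → ℕ} (D : ∀ i, Matrix (Fin (b i)) (Fin (b (i + 1))) S)
  (e₀ : Fin (b 0))

variable (M) in
/-- The identification of the degree zero parts of the Koszul complex and of a resolution. -/
def chartBase (e₀ : Fin (b 0)) : (⋀[S]^0 M) →ₗ[S] (Fin (b 0) → S) :=
  LinearMap.single S (fun _ => S) e₀ ∘ₗ (exteriorPower.zeroEquiv S M).toLinearMap

/-- The vector `w` is the image of the top element under a chain map from the Koszul complex of
`F` to the complex `D`. -/
def IsChartVec (e : Module.Basis (Fin (c + 1)) S M) (F : Module.Dual S M)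
    (w : Fin (b (c + 1)) → S) : Prop :=
  ∃ κ : ∀ i, (⋀[S]^i M) →ₗ[S] (Fin (b i) → S), κ 0 = chartBase M e₀ ∧
    (∀ i ≤ c, ∀ x, (D i).mulVecLin (κ (i + 1) x) = κ i (koszul F i x)) ∧
    κ (c + 1) (exteriorPower.ιMulti S (c + 1) e) = w

variable {D e₀} {e : Module.Basis (Fin (c + 1)) S M} {F : Module.Dual S M}
  {w w' : Fin (b (c + 1)) → S}

lemma zeroEquiv_koszul_mem (hF : ∀ v, F v ∈ J) (x : ⋀[S]^1 M) :
    exteriorPower.zeroEquiv S M (koszul F 0 x) ∈ J :=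
  LinearMap.apply_mem_of_mem_smul_top (koszul_mem_smul_top F J hF 0 x)
    (exteriorPower.zeroEquiv S M).toLinearMap

lemma IsChartVec.dual_mem (hw : IsChartVec D e₀ e F w) (hF : ∀ v, F v ∈ J)
    (ν : Module.Dual S (Fin (b c) → S)) : ν ((D c).mulVecLin w) ∈ J := by
  obtain ⟨κ, -, hκ, rfl⟩ := hw
  rw [hκ c le_rfl]
  exact LinearMap.apply_mem_of_mem_smul_top (koszul_mem_smul_top F J hF c _) (ν ∘ₗ κ c)

lemma IsChartVec.comp (hw : IsChartVec D e₀ e F w) (T : M →ₗ[S] M) :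
    IsChartVec D e₀ e (F ∘ₗ T) (LinearMap.det T • w) := by
  obtain ⟨κ, h0, hκ, rfl⟩ := hw
  refine ⟨fun i => κ i ∘ₗ exteriorPower.map i T, ?_, fun i hi x => ?_, ?_⟩
  · dsimp only
    rw [h0, chartBase, LinearMap.comp_assoc, exteriorPower.zeroEquiv_naturality]
  · rw [LinearMap.comp_apply, LinearMap.comp_apply, hκ i hi, koszul_map]
  · rw [LinearMap.comp_apply, map_top, map_smul]

variable [Module.Free S M]

lemma IsChartVec.smul (hw : IsChartVec D e₀ e F w) (a : S) :
    IsChartVec D e₀ e (a • F) (a ^ (c + 1) • w) := by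
  have h := hw.comp (a • LinearMap.id)
  rw [LinearMap.det_smul, LinearMap.det_id, mul_one] at h
  have h1 : a ^ Module.finrank S M • w = a ^ (c + 1) • w := by
    rcases subsingleton_or_nontrivial S with hS | hS
    · exact Subsingleton.elim _ _
    · rw [Module.finrank_eq_card_basis e, Fintype.card_fin]
  rw [h1] at h
  convert h using 1
  refine LinearMap.ext fun v => ?_
  simp

variable [Module.Finite S M]

lemma exists_isChartVec (h : IsFreeRes J (c + 1) b D e₀) (e : Module.Basis (Fin (c + 1)) S M)
    (hF : ∀ v, F v ∈ J) : ∃ w, IsChartVec D e₀ e F w := by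
  obtain ⟨N, f, hf0, hf⟩ := exists_chainMap (P := fun i => ⋀[S]^i M) (Q := fun i => Fin (b i) → S)
    (1 : S) (koszul F) (fun i => (D i).mulVecLin) (koszul_koszul F) (chartBase M e₀)
    (fun x => by
      obtain ⟨y, hy⟩ := (h.mem_iff _).1 (zeroEquiv_koszul_mem hF x)
      exact ⟨0, y, by rw [hy, pow_zero, one_smul]; rfl⟩) c
    (fun i _ => h.exactUpTo_one i)
  rw [one_pow, one_smul] at hf0
  exact ⟨_, f, hf0, hf, rfl⟩

lemma IsChartVec.sub_mem (h : IsFreeRes J (c + 1) b D e₀) (hF : ∀ v, F v ∈ J)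
    (hw : IsChartVec D e₀ e F w) (hw' : IsChartVec D e₀ e F w') (j : Fin (b (c + 1))) :
    w j - w' j ∈ J := by
  obtain ⟨κ, h0, hκ, rfl⟩ := hw
  obtain ⟨κ', h0', hκ', rfl⟩ := hw'
  obtain ⟨N, u, -, hu⟩ := exists_homotopy (P := fun i => ⋀[S]^i M) (Q := fun i => Fin (b i) → S)
    (1 : S) (koszul F) (fun i => (D i).mulVecLin) (fun i => κ i - κ' i)
    (fun x => ⟨0, 0, by rw [h0, h0']; simp⟩) (c + 1) (koszul_koszul F)
    (fun i _ => h.exactUpTo_one i)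
    (fun i hi x => by
      rw [LinearMap.sub_apply, LinearMap.sub_apply, map_sub, hκ i (by omega), hκ' i (by omega)])
  have h1 := hu c (by omega) (exteriorPower.ιMulti S (c + 1) e)
  rw [h.eq_zero (by omega) (u (c + 1) _), map_zero, zero_add, one_pow, one_smul,
    LinearMap.sub_apply] at h1
  have h2 := LinearMap.apply_mem_of_mem_smul_top
    (koszul_mem_smul_top F J hF c (exteriorPower.ιMulti S (c + 1) e)) (LinearMap.proj j ∘ₗ u c)
  rw [LinearMap.comp_apply, ← h1] at h2
  exact h2

open RingTheory.Sequence in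
/-- Up to powers of `Δ`, the top dual cokernel of a resolution of `S/J` is free of rank one over
`S/J`, by evaluation at the chart vector. -/
theorem IsChartVec.dual_eval (h : IsFreeRes J (c + 1) b D e₀) (hF : ∀ v, F v ∈ J)
    (hw : IsChartVec D e₀ e F w) (Δ : S) (hΔ : ∀ f ∈ J, ∃ (n : ℕ) (v : M), Δ ^ n * f = F v)
    (fs : List S) (hreg : IsWeaklyRegular S fs) (hlen : fs.length = c + 1)
    (hfs : ∀ f ∈ fs, f ∈ J) :
    (∃ N : ℕ, ∀ s : S, ∃ μ : Module.Dual S (Fin (b (c + 1)) → S), μ w - Δ ^ N * s ∈ J) ∧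
    ∀ μ : Module.Dual S (Fin (b (c + 1)) → S), μ w ∈ J →
      ∃ N : ℕ, Δ ^ N • μ ∈ LinearMap.range (D c).mulVecLin.dualMap := by
  obtain ⟨κ, h0, hκ, rfl⟩ := hw
  have hK : ∀ i < c + 1, ExactUpTo Δ (koszul F (i + 1)) (koszul F i) := hlen ▸
    koszul_exactUpTo F Δ fs hreg (fun f hf => hΔ f (hfs f hf))
      (hlen ▸ exteriorPower_succ_eq_zero e)
  obtain ⟨N, β, hβ0, hβ⟩ := exists_chainMap (P := fun i => Fin (b i) → S)
    (Q := fun i => ⋀[S]^i M) Δ (fun i => (D i).mulVecLin) (koszul F) h.mulVec_mulVec_eq_zero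
    ((exteriorPower.zeroEquiv S M).symm.toLinearMap ∘ₗ LinearMap.proj e₀)
    (fun x => by
      obtain ⟨n, v, hv⟩ := hΔ ((D 0).mulVecLin x e₀) ((h.mem_iff _).2 ⟨x, h.single_base _⟩)
      refine ⟨n, wedgeL v 0 ((exteriorPower.zeroEquiv S M).symm 1), ?_⟩
      rw [koszul_wedgeL_zero, ← hv, LinearMap.comp_apply, LinearMap.proj_apply,
        LinearEquiv.coe_coe, ← map_smul, ← map_smul, smul_eq_mul, smul_eq_mul, mul_one]) c
    (fun i hi => hK i (by omega))
  have hκβ : κ 0 ∘ₗ β 0 = Δ ^ N • LinearMap.id := by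
    refine LinearMap.ext fun x => ?_
    rw [hβ0, h0, LinearMap.comp_apply, LinearMap.smul_apply, map_smul]
    congr 1
    simp only [chartBase, LinearMap.comp_apply, LinearEquiv.coe_coe, LinearEquiv.apply_symm_apply]
    exact (h.single_base x).symm
  have hβκ : β 0 ∘ₗ κ 0 = Δ ^ N • LinearMap.id := by
    refine LinearMap.ext fun x => ?_
    rw [hβ0, h0, LinearMap.comp_apply, LinearMap.smul_apply]
    simp [chartBase]
  have hw0 : ∀ y, κ (c + 1) (β (c + 1) y) =
      topCoord e (β (c + 1) y) • κ (c + 1) (exteriorPower.ιMulti S (c + 1) e) := by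
    intro y
    rw [← map_smul, ← eq_topCoord_smul]
  constructor
  · obtain ⟨N', u, -, hu⟩ := exists_homotopy (P := fun i => ⋀[S]^i M) (Q := fun i => ⋀[S]^i M)
      Δ (koszul F) (koszul F) (fun i => β i ∘ₗ κ i - Δ ^ N • LinearMap.id)
      (fun x => ⟨0, 0, by rw [hβκ]; simp⟩) (c + 1) (koszul_koszul F) hK
      (fun i hi x => by
        simp only [LinearMap.sub_apply, LinearMap.comp_apply, map_sub, LinearMap.smul_apply,
          map_smul, LinearMap.id_apply]
        rw [hβ i (by omega), hκ i (by omega)])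
    refine ⟨N' + N, fun s => ⟨(Δ ^ N' * s) • (topCoord e ∘ₗ β (c + 1)), ?_⟩⟩
    have h1 := hu c (by omega) (exteriorPower.ιMulti S (c + 1) e)
    rw [exteriorPower_succ_eq_zero e (u (c + 1) _), map_zero, zero_add] at h1
    have h2 := congrArg (topCoord e) h1
    have h3 := LinearMap.apply_mem_of_mem_smul_top
      (koszul_mem_smul_top F J hF c (exteriorPower.ιMulti S (c + 1) e)) (topCoord e ∘ₗ u c)
    rw [LinearMap.comp_apply, ← h2] at h3
    simp only [map_smul, LinearMap.sub_apply, map_sub, LinearMap.comp_apply, LinearMap.smul_apply,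
      LinearMap.id_apply, topCoord_top, smul_eq_mul] at h3 ⊢
    have h4 := J.mul_mem_left s h3
    ring_nf at h4 ⊢
    exact h4
  · intro μ hμ
    obtain ⟨N', u, -, hu⟩ := exists_homotopy (P := fun i => Fin (b i) → S)
      (Q := fun i => Fin (b i) → S) (1 : S) (fun i => (D i).mulVecLin)
      (fun i => (D i).mulVecLin) (fun i => κ i ∘ₗ β i - Δ ^ N • LinearMap.id)
      (fun x => ⟨0, 0, by rw [hκβ]; simp⟩) (c + 1) h.mulVec_mulVec_eq_zero
      (fun i _ => h.exactUpTo_one i)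
      (fun i hi x => by
        simp only [LinearMap.sub_apply, LinearMap.comp_apply, map_sub, LinearMap.smul_apply,
          map_smul, LinearMap.id_apply]
        rw [hκ i (by omega), hβ i (by omega)])
    obtain ⟨v, hv⟩ := h.exists_isContraction hμ (c + 1)
    obtain ⟨ν, hν⟩ := hv.smul_dual_mem (i := c) (by omega) (h.eq_zero (by omega))
      (topCoord e ∘ₗ β (c + 1))
    refine ⟨N, ν - μ ∘ₗ u c, ?_⟩
    rw [map_sub, hν]
    refine LinearMap.ext fun y => ?_
    have h1 := hu c (by omega) y
    rw [h.eq_zero (by omega) (u (c + 1) _), map_zero, zero_add, one_pow, one_smul,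
      LinearMap.sub_apply, LinearMap.comp_apply, hw0] at h1
    have h2 := congrArg μ h1
    simp only [map_sub, map_smul, LinearMap.smul_apply, LinearMap.id_apply, smul_eq_mul] at h2
    simp only [LinearMap.sub_apply, LinearMap.smul_apply, LinearMap.comp_apply,
      LinearMap.dualMap_apply, smul_eq_mul]
    rw [← h2]
    ring

end Chart

section MatrixChart

variable {S : Type} [CommRing S] {ι κ α β β' : Type} [Fintype ι] [DecidableEq ι] [Fintype κ]
  [DecidableEq κ] [Fintype α] [DecidableEq α] [Fintype β] [DecidableEq β] [Fintype β']
  [DecidableEq β']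

/-- The pivot of a chart. -/
def pivot (Y : Matrix ι κ S) (ρ : α ⊕ β ≃ ι) (γ : α ⊕ β' ≃ κ) : S :=
  (Y.submatrix (ρ ∘ Sum.inl) (γ ∘ Sum.inl)).det

/-- The Schur complement of a chart, multiplied by the pivot. -/
def schur (Y : Matrix ι κ S) (ρ : α ⊕ β ≃ ι) (γ : α ⊕ β' ≃ κ) : Matrix β β' S :=
  pivot Y ρ γ • Y.submatrix (ρ ∘ Sum.inr) (γ ∘ Sum.inr) -
    Y.submatrix (ρ ∘ Sum.inr) (γ ∘ Sum.inl) *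
      (Y.submatrix (ρ ∘ Sum.inl) (γ ∘ Sum.inl)).adjugate *
        Y.submatrix (ρ ∘ Sum.inl) (γ ∘ Sum.inr)

lemma pivot_transpose (Y : Matrix ι κ S) (ρ : α ⊕ β ≃ ι) (γ : α ⊕ β' ≃ κ) :
    pivot Yᵀ γ ρ = pivot Y ρ γ := by
  rw [pivot, pivot, ← det_transpose]
  rfl

lemma schur_transpose (Y : Matrix ι κ S) (ρ : α ⊕ β ≃ ι) (γ : α ⊕ β' ≃ κ) :
    schur Yᵀ γ ρ = (schur Y ρ γ)ᵀ := by
  rw [schur, schur, pivot_transpose, transpose_sub, transpose_smul, transpose_mul, transpose_mul,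
    adjugate_transpose, Matrix.mul_assoc]
  rfl

/-- The projection away from the pivot rows. -/
def proj (Z : Matrix ι α S) (ρ : α ⊕ β ≃ ι) : Matrix ι ι S :=
  (Z.submatrix (ρ ∘ Sum.inl) id).det • (1 : Matrix ι ι S) -
    Z * (Z.submatrix (ρ ∘ Sum.inl) id).adjugate *
      (1 : Matrix ι ι S).submatrix (ρ ∘ Sum.inl) id

variable (Z : Matrix ι α S) (ρ ρ' : α ⊕ β ≃ ι)

lemma one_submatrix_mul {τ : Type} (f : τ → ι) {σ : Type} (W : Matrix ι σ S) :
    (1 : Matrix ι ι S).submatrix f id * W = W.submatrix f id := by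
  ext i j
  simp [Matrix.mul_apply, Matrix.one_apply]

lemma proj_mul : proj Z ρ * Z = 0 := by
  rw [proj, Matrix.sub_mul, Matrix.smul_mul, Matrix.one_mul, Matrix.mul_assoc, one_submatrix_mul,
    Matrix.mul_assoc, adjugate_mul, Matrix.mul_smul, Matrix.mul_one, sub_self]

lemma submatrix_proj : (proj Z ρ).submatrix (ρ ∘ Sum.inl) id = 0 := by
  rw [← one_submatrix_mul (ρ ∘ Sum.inl) (proj Z ρ), proj, Matrix.mul_sub, Matrix.mul_smul,
    Matrix.mul_one, ← Matrix.mul_assoc, ← Matrix.mul_assoc, one_submatrix_mul _ Z, mul_adjugate,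
    Matrix.smul_mul, Matrix.one_mul, sub_self]

lemma proj_mul_proj : proj Z ρ' * proj Z ρ =
    (Z.submatrix (ρ ∘ Sum.inl) id).det • proj Z ρ' := by
  conv_lhs => rw [proj.eq_1 Z ρ]
  rw [Matrix.mul_sub, Matrix.mul_smul, Matrix.mul_one, Matrix.mul_assoc Z, ← Matrix.mul_assoc,
    proj_mul, Matrix.zero_mul, sub_zero]

lemma schur_eq (Y : Matrix ι κ S) (γ : α ⊕ β' ≃ κ) :
    schur Y ρ γ = (proj (Y.submatrix id (γ ∘ Sum.inl)) ρ *
      Y.submatrix id (γ ∘ Sum.inr)).submatrix (ρ ∘ Sum.inr) id := by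
  rw [proj, Matrix.sub_mul, Matrix.smul_mul, Matrix.one_mul, Matrix.mul_assoc,
    one_submatrix_mul]
  rfl

/-- The transition matrix between two charts with the same pivot columns. -/
def trans : Matrix β β S := (proj Z ρ').submatrix (ρ' ∘ Sum.inr) (ρ ∘ Sum.inr)

lemma smul_schur (Y : Matrix ι κ S) (γ : α ⊕ β' ≃ κ) :
    pivot Y ρ γ • schur Y ρ' γ =
      trans (Y.submatrix id (γ ∘ Sum.inl)) ρ ρ' * schur Y ρ γ := by
  set Z := Y.submatrix id (γ ∘ Sum.inl)
  set W := Y.submatrix id (γ ∘ Sum.inr)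
  have h1 : pivot Y ρ γ • proj Z ρ' = proj Z ρ' * proj Z ρ := (proj_mul_proj Z ρ ρ').symm
  rw [schur_eq, schur_eq]
  change pivot Y ρ γ • (proj Z ρ' * W).submatrix _ id = trans Z ρ ρ' * (proj Z ρ * W).submatrix _ id
  have h2 : pivot Y ρ γ • (proj Z ρ' * W).submatrix (ρ' ∘ Sum.inr) id =
      (proj Z ρ' * (proj Z ρ * W)).submatrix (ρ' ∘ Sum.inr) id := by
    rw [← Matrix.mul_assoc, ← h1, Matrix.smul_mul]
    rfl
  have h3 : (proj Z ρ * W).submatrix (ρ ∘ Sum.inl) id = 0 := by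
    have := congrArg (· * W) (submatrix_proj Z ρ)
    rw [Matrix.zero_mul] at this
    exact this
  rw [h2]
  ext i j
  simp only [submatrix_apply, Matrix.mul_apply (M := proj Z ρ') , Matrix.mul_apply (M := trans Z ρ ρ')]
  rw [← ρ.sum_comp, Fintype.sum_sum_type, Finset.sum_eq_zero, zero_add]
  · rfl
  · intro a _
    have := congrFun (congrFun h3 a) j
    have h4 : (proj Z ρ * W) (ρ (Sum.inl a)) j = 0 := this
    exact (congrArg _ h4).trans (mul_zero _)

lemma det_trans : ∃ ε : S, IsUnit ε ∧
    (Z.submatrix (ρ' ∘ Sum.inl) id).det * (trans Z ρ ρ').det =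
      ε * ((Z.submatrix (ρ' ∘ Sum.inl) id).det ^ Fintype.card β *
        (Z.submatrix (ρ ∘ Sum.inl) id).det) := by
  let H : Matrix (α ⊕ β) ι S := fromRows ((1 : Matrix ι ι S).submatrix (ρ' ∘ Sum.inl) id)
    ((proj Z ρ').submatrix (ρ' ∘ Sum.inr) id)
  let G : Matrix ι (α ⊕ β) S := fromCols Z ((1 : Matrix ι ι S).submatrix id (ρ ∘ Sum.inr))
  have hHG : H * G = fromBlocks (Z.submatrix (ρ' ∘ Sum.inl) id)
      ((1 : Matrix ι ι S).submatrix (ρ' ∘ Sum.inl) (ρ ∘ Sum.inr)) 0 (trans Z ρ ρ') := by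
    rw [fromRows_mul_fromCols, one_submatrix_mul, one_submatrix_mul]
    congr 1
    · have := congrArg (fun M => M.submatrix (ρ' ∘ Sum.inr) (id : α → α)) (proj_mul Z ρ')
      exact this
    · ext i j
      simp [Matrix.mul_apply, Matrix.one_apply, trans]
  have hH : (H.submatrix id ρ').det = (Z.submatrix (ρ' ∘ Sum.inl) id).det ^ Fintype.card β := by
    have : H.submatrix id ρ' = fromBlocks 1 0
        ((proj Z ρ').submatrix (ρ' ∘ Sum.inr) (ρ' ∘ Sum.inl))
        ((Z.submatrix (ρ' ∘ Sum.inl) id).det • 1) := by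
      ext (i | i) (j | j)
      · simp [H, Matrix.one_apply]
      · simp [H]
      · simp [H]
      · simp only [submatrix_apply, id, H, fromRows_apply_inr, Function.comp_apply, proj,
          Matrix.sub_apply, Matrix.smul_apply, fromBlocks_apply₂₂]
        rw [Matrix.mul_apply, Finset.sum_eq_zero, sub_zero]
        · simp [Matrix.one_apply]
        · intro a _
          simp
    rw [this, det_fromBlocks_zero₁₂, det_one, one_mul, det_smul, det_one, mul_one]
  have hG : (G.submatrix ρ id).det = (Z.submatrix (ρ ∘ Sum.inl) id).det := by
    have : G.submatrix ρ id = fromBlocks (Z.submatrix (ρ ∘ Sum.inl) id) 0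
        (Z.submatrix (ρ ∘ Sum.inr) id) 1 := by
      ext (i | i) (j | j) <;> simp [G, Matrix.one_apply]
    rw [this, det_fromBlocks_zero₁₂, det_one, mul_one]
  have hG' : G.submatrix ρ' id = (G.submatrix ρ id).submatrix (ρ'.trans ρ.symm) id := by
    ext i j
    simp
  have key : (H.submatrix id ρ').det * (G.submatrix ρ' id).det = (H * G).det := by
    rw [← det_mul, submatrix_mul_equiv H G id ρ' id, submatrix_id_id]
  rw [hHG, det_fromBlocks_zero₂₁, hH, hG', det_permute, hG] at key
  refine ⟨((Equiv.Perm.sign (ρ'.trans ρ.symm) : ℤ) : S),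
    (Units.isUnit _).map (Int.castRingHom S), ?_⟩
  rw [← key]
  ring

/-- The linear functional with given coefficients. -/
def coeffFun (Φ : Matrix β β' S) : Module.Dual S (β × β' → S) :=
  Fintype.linearCombination S (fun ij : β × β' => Φ ij.1 ij.2)

lemma coeffFun_apply (Φ : Matrix β β' S) (v : β × β' → S) :
    coeffFun Φ v = ∑ i, ∑ j, v (i, j) * Φ i j := by
  simp [coeffFun, Fintype.linearCombination_apply, Fintype.sum_prod_type]

lemma coeffFun_smul (a : S) (Φ : Matrix β β' S) : coeffFun (a • Φ) = a • coeffFun Φ := by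
  ext v
  simp [coeffFun_apply, Finset.mul_sum, mul_left_comm]

lemma coeffFun_mul_left (T : Matrix β β S) (Φ : Matrix β β' S) :
    coeffFun (T * Φ) = coeffFun Φ ∘ₗ (kroneckerMap (· * ·) Tᵀ (1 : Matrix β' β' S)).toLin' := by
  refine LinearMap.ext fun v => ?_
  simp only [LinearMap.comp_apply, coeffFun_apply, Matrix.mul_apply, toLin'_apply, mulVec,
    dotProduct, Fintype.sum_prod_type, kroneckerMap_apply, transpose_apply, Matrix.one_apply,
    mul_ite, ite_mul, mul_one, mul_zero, zero_mul, Finset.sum_ite_eq, Finset.mem_univ, if_true,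
    Finset.sum_mul, Finset.mul_sum]
  have h1 : ∀ i : β, (∑ j, ∑ k, v (i, j) * (T i k * Φ k j)) =
      ∑ k, ∑ j, v (i, j) * (T i k * Φ k j) := fun i => Finset.sum_comm
  rw [Finset.sum_congr rfl fun i _ => h1 i, Finset.sum_comm]
  refine Finset.sum_congr rfl fun k _ => ?_
  rw [Finset.sum_comm]
  exact Finset.sum_congr rfl fun j _ => Finset.sum_congr rfl fun i _ => by ring

lemma coeffFun_mul_right (T : Matrix β' β' S) (Φ : Matrix β β' S) :
    coeffFun (Φ * T) = coeffFun Φ ∘ₗ (kroneckerMap (· * ·) (1 : Matrix β β S) T).toLin' := by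
  refine LinearMap.ext fun v => ?_
  have h1 : ∀ i k, (kroneckerMap (· * ·) (1 : Matrix β β S) T *ᵥ v) (i, k) =
      ∑ j, T k j * v (i, j) := by
    intro i k
    simp only [mulVec, dotProduct, Fintype.sum_prod_type, kroneckerMap_apply, Matrix.one_apply,
      ite_mul, one_mul, zero_mul]
    rw [Finset.sum_eq_single i (fun x _ hx => Finset.sum_eq_zero fun j _ => if_neg hx.symm)
      (fun h => absurd (Finset.mem_univ i) h)]
    simp
  simp only [LinearMap.comp_apply, coeffFun_apply, Matrix.mul_apply, toLin'_apply, h1,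
    Finset.sum_mul, Finset.mul_sum]
  refine Finset.sum_congr rfl fun k _ => ?_
  rw [Finset.sum_comm]
  exact Finset.sum_congr rfl fun j _ => Finset.sum_congr rfl fun i _ => by ring

lemma det_kron_left (T : Matrix β β S) :
    LinearMap.det (kroneckerMap (· * ·) Tᵀ (1 : Matrix β' β' S)).toLin' =
      T.det ^ Fintype.card β' := by
  rw [LinearMap.det_toLin', det_kronecker, det_transpose, det_one, one_pow, mul_one]

lemma det_kron_right (T : Matrix β' β' S) :
    LinearMap.det (kroneckerMap (· * ·) (1 : Matrix β β S) T).toLin' =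
      T.det ^ Fintype.card β := by
  rw [LinearMap.det_toLin', det_kronecker, det_one, one_pow, one_mul]

end MatrixChart

section SchurMinors

variable {S : Type} [CommRing S]

lemma det_mul_eq_zero_of_succ {r : ℕ} (M : Matrix (Fin (r + 1)) (Fin r) S)
    (N : Matrix (Fin r) (Fin (r + 1)) S) : (M * N).det = 0 := by
  let M' : Matrix (Fin (r + 1)) (Fin (r + 1)) S := Matrix.of fun i => Fin.snoc (M i) 0
  let N' : Matrix (Fin (r + 1)) (Fin (r + 1)) S := Matrix.of (Fin.snoc (fun i => N i) 0)
  have h : M * N = M' * N' := by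
    ext i j
    rw [Matrix.mul_apply, Matrix.mul_apply, Fin.sum_univ_castSucc]
    simp [M', N']
  rw [h, det_mul, det_eq_zero_of_column_eq_zero (Fin.last r) (fun i => by simp [M']), zero_mul]

variable {ι κ β β' : Type} [Fintype ι] [DecidableEq ι] [Fintype κ]
  [DecidableEq κ] [Fintype β] [DecidableEq β] [Fintype β'] [DecidableEq β'] {r : ℕ}

lemma pow_mul_det_eq_zero_of_schur (Y : Matrix ι κ S) (ρ : Fin r ⊕ β ≃ ι) (γ : Fin r ⊕ β' ≃ κ)
    (h : schur Y ρ γ = 0) (f : Fin (r + 1) → ι) (g : Fin (r + 1) → κ) :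
    pivot Y ρ γ ^ (r + 1) * (Y.submatrix f g).det = 0 := by
  set Z := Y.submatrix id (γ ∘ Sum.inl)
  have h1 : proj Z ρ * Y = 0 := by
    ext i j
    obtain ⟨j, rfl⟩ := γ.surjective j
    obtain j | j := j
    · exact congrFun (congrFun (proj_mul Z ρ) i) j
    · obtain ⟨i, rfl⟩ := ρ.surjective i
      obtain i | i := i
      · rw [Matrix.mul_apply]
        refine Finset.sum_eq_zero fun x _ => ?_
        have : proj Z ρ (ρ (Sum.inl i)) x = 0 := congrFun (congrFun (submatrix_proj Z ρ) i) x
        rw [this, zero_mul]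
      · have h2 := congrFun (congrFun (schur_eq ρ Y γ) i) j
        rw [h] at h2
        exact h2.symm
  rw [proj, Matrix.sub_mul, Matrix.smul_mul, Matrix.one_mul, sub_eq_zero, Matrix.mul_assoc,
    one_submatrix_mul] at h1
  have h2 : pivot Y ρ γ • Y.submatrix f g =
      (Z * (Z.submatrix (ρ ∘ Sum.inl) id).adjugate).submatrix f id *
        Y.submatrix (ρ ∘ Sum.inl) g := congrArg (fun M => M.submatrix f g) h1
  have h3 := congrArg Matrix.det h2
  rw [det_mul_eq_zero_of_succ, det_smul, Fintype.card_fin] at h3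
  exact h3

lemma pivot_map {S' : Type} [CommRing S'] (π : S →+* S') (Y : Matrix ι κ S) (ρ : Fin r ⊕ β ≃ ι)
    (γ : Fin r ⊕ β' ≃ κ) : pivot (Y.map π) ρ γ = π (pivot Y ρ γ) := by
  rw [pivot, pivot, RingHom.map_det]
  rfl

lemma schur_map {S' : Type} [CommRing S'] (π : S →+* S') (Y : Matrix ι κ S) (ρ : Fin r ⊕ β ≃ ι)
    (γ : Fin r ⊕ β' ≃ κ) : schur (Y.map π) ρ γ = (schur Y ρ γ).map π := by
  have h := (π.map_adjugate (Y.submatrix (ρ ∘ Sum.inl) (γ ∘ Sum.inl))).symm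
  have hsm : ∀ (x : S) (M : Matrix β β' S), (x • M).map π = π x • M.map π := fun x M => by
    ext i j
    simp
  rw [RingHom.mapMatrix_apply, RingHom.mapMatrix_apply] at h
  rw [schur, schur, pivot_map, Matrix.map_sub _ (map_sub π), hsm, Matrix.map_mul, Matrix.map_mul,
    ← h]
  rfl

lemma exists_pow_mul_det_eq (Y : Matrix ι κ S) (ρ : Fin r ⊕ β ≃ ι) (γ : Fin r ⊕ β' ≃ κ)
    (f : Fin (r + 1) → ι) (g : Fin (r + 1) → κ) :
    pivot Y ρ γ ^ (r + 1) * (Y.submatrix f g).det ∈ LinearMap.range (coeffFun (schur Y ρ γ)) := by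
  let J : Ideal S := LinearMap.range (coeffFun (schur Y ρ γ))
  have h0 : schur (Y.map (Ideal.Quotient.mk J)) ρ γ = 0 := by
    rw [schur_map]
    ext i j
    refine Ideal.Quotient.eq_zero_iff_mem.2 ⟨Pi.single (i, j) 1, ?_⟩
    simp [coeffFun, Fintype.linearCombination_apply_single]
  have h1 := pow_mul_det_eq_zero_of_schur _ ρ γ h0 f g
  rw [pivot_map, submatrix_map, ← RingHom.mapMatrix_apply, ← RingHom.map_det, ← map_pow,
    ← map_mul, Ideal.Quotient.eq_zero_iff_mem] at h1
  exact h1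

lemma schur_mul_eq_zero (U : Matrix ι (Fin r) S) (V : Matrix (Fin r) κ S)
    (ρ : Fin r ⊕ β ≃ ι) (γ : Fin r ⊕ β' ≃ κ) : schur (U * V) ρ γ = 0 := by
  have hs : ∀ {τ σ : Type} (f : τ → ι) (g : σ → κ), (U * V).submatrix f g =
    U.submatrix f id * V.submatrix id g := fun f g => rfl
  rw [schur, pivot]
  simp only [hs]
  rw [det_mul, adjugate_mul_distrib, sub_eq_zero]
  have h1 : ∀ (U₂ : Matrix β (Fin r) S) (U₁ V₁ : Matrix (Fin r) (Fin r) S)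
      (V₂ : Matrix (Fin r) β' S), U₂ * V₁ * (V₁.adjugate * U₁.adjugate) * (U₁ * V₂) =
      U₂ * (V₁ * V₁.adjugate) * (U₁.adjugate * U₁) * V₂ := fun U₂ U₁ V₁ V₂ => by
    simp only [Matrix.mul_assoc]
  rw [h1, mul_adjugate, adjugate_mul]
  simp only [Matrix.mul_smul, Matrix.smul_mul, Matrix.mul_one, smul_smul]

end SchurMinors

section MinorIdeal

variable (K : Type) [Field K] (a m : ℕ)

/-- The ideal of `q × q` minors of the generic matrix. -/
def minorIdeal (q : ℕ) : Ideal (GS K a m) := Ideal.span (colMinors K a m q m)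

variable {K a m}

lemma det_mem_minorIdeal {q : ℕ} (f : Fin q → Fin a) (g : Fin q → Fin m) :
    ((gmat K a m).submatrix f g).det ∈ minorIdeal K a m q :=
  Ideal.subset_span ⟨f, g, fun l => (g l).2, rfl⟩

lemma cnt_range (r j : ℕ) : cnt (Finset.range r) j = min j r := by
  induction j with
  | zero => simp [cnt_zero]
  | succ j ih =>
    rw [cnt_succ, ih]
    by_cases h : j < r
    · rw [if_pos (Finset.mem_range.2 h)]
      omega
    · rw [if_neg (fun h' => h (Finset.mem_range.1 h'))]
      omega

lemma colMinors_eq_zero {q j : ℕ} (hj : j < q) {f : GS K a m} (hf : f ∈ colMinors K a m q j) :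
    f = 0 := by
  obtain ⟨ρ, γ, hγ, rfl⟩ := hf
  have : ¬ Function.Injective fun l => (⟨γ l, hγ l⟩ : Fin j) := fun h => by
    have := Fintype.card_le_of_injective _ h
    simp at this
    omega
  rw [Function.not_injective_iff] at this
  obtain ⟨x, y, hxy, hne⟩ := this
  have hxy' : γ x = γ y := Fin.ext (Fin.mk.inj_iff.1 hxy)
  exact det_zero_of_column_eq hne fun i => by simp [hxy']

lemma rsIdeal_range {r : ℕ} (hr : r ≤ m) :
    rsIdeal K a m 0 (Finset.range r) 0 = minorIdeal K a m (r + 1) := by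
  apply le_antisymm
  · refine rsIdeal_le ?_ fun j f hf => ?_
    · rintro f ⟨i, j, h, -⟩
      omega
    · rw [cnt_range] at hf
      rcases Nat.lt_or_ge j r with hj | hj
      · rw [min_eq_left hj.le] at hf
        rw [colMinors_eq_zero (Nat.lt_succ_self j) hf]
        exact zero_mem _
      · rw [min_eq_right hj] at hf
        obtain ⟨ρ, γ, -, rfl⟩ := hf
        exact det_mem_minorIdeal ρ γ
  · refine Ideal.span_le.2 fun f hf => colMinors_subset _ _ _ m ?_
    rwa [cnt_range, min_eq_right hr]

lemma evalM_eq_zero_of_mem {r : ℕ} {f : GS K a m} (hf : f ∈ minorIdeal K a m (r + 1))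
    (U : Matrix (Fin a) (Fin r) K) (V : Matrix (Fin r) (Fin m) K) : evalM (U * V) f = 0 := by
  have h : minorIdeal K a m (r + 1) ≤ RingHom.ker (evalM (U * V)) := by
    refine Ideal.span_le.2 ?_
    rintro _ ⟨ρ, γ, -, rfl⟩
    exact (evalM_det _ ρ γ).trans
      (det_mul_eq_zero_of_lt (Nat.lt_succ_self r) (U.submatrix ρ id) (V.submatrix id γ))
  exact h hf

lemma mem_minorIdeal_of_evalM [Infinite K] {r : ℕ} (hr : r ≤ m) {f : GS K a m}
    (hf : ∀ (U : Matrix (Fin a) (Fin r) K) (V : Matrix (Fin r) (Fin m) K),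
      evalM (U * V) f = 0) : f ∈ minorIdeal K a m (r + 1) := by
  rw [← rsIdeal_range hr, mem_rsIdeal_iff 0 (Nat.zero_le _) 0 (Nat.zero_le _) _
    (fun w hw => (Finset.mem_range.1 hw).trans_le hr)]
  rintro h U V ⟨-, -, hV⟩
  have h1 : U * V = U.submatrix id (Fin.castLE hr) * V.submatrix (Fin.castLE hr) id := by
    ext i j
    rw [Matrix.mul_apply, Matrix.mul_apply]
    refine (Finset.sum_of_injOn (Fin.castLE hr) (Fin.castLE_injective hr).injOn
      (fun _ _ => Finset.mem_univ _) (fun l _ hl => ?_) fun _ _ => rfl).symm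
    rw [hV l j (Or.inl ?_), mul_zero]
    rw [cnt_range]
    by_contra hlt
    exact hl ⟨⟨l, by omega⟩, Finset.mem_coe.2 (Finset.mem_univ _), rfl⟩
  rw [h1]
  exact hf _ _

instance minorIdeal_isPrime [Infinite K] {r : ℕ} [hr : Fact (r ≤ m)] :
    (minorIdeal K a m (r + 1)).IsPrime := by
  let T := MvPolynomial ((Fin a × Fin r) ⊕ (Fin r × Fin m)) K
  let Φ : GS K a m →+* T := (MvPolynomial.aeval fun ij => ∑ l, MvPolynomial.X (Sum.inl (ij.1, l)) *
    MvPolynomial.X (Sum.inr (l, ij.2)) : GS K a m →ₐ[K] T).toRingHom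
  have h1 : ∀ (x : _ → K) (f : GS K a m), MvPolynomial.eval x (Φ f) =
      evalM (Matrix.of (fun i l => x (Sum.inl (i, l))) * Matrix.of fun l j => x (Sum.inr (l, j)))
        f := by
    intro x f
    have : (MvPolynomial.eval x).comp Φ = evalM (Matrix.of (fun i l => x (Sum.inl (i, l))) *
        Matrix.of fun l j => x (Sum.inr (l, j))) := by
      refine MvPolynomial.ringHom_ext (fun c => ?_) fun ij => ?_
      · simp only [Φ, T, RingHom.comp_apply, AlgHom.toRingHom_eq_coe, RingHom.coe_coe]
        exact (congrArg _ (MvPolynomial.aeval_C _ c)).trans (by simp [MvPolynomial.algebraMap_eq])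
      · simp [Φ, Matrix.mul_apply]
    exact RingHom.congr_fun this f
  have h2 : minorIdeal K a m (r + 1) = RingHom.ker Φ := by
    refine le_antisymm (fun f hf => ?_) fun f hf => ?_
    · refine MvPolynomial.funext fun x => ?_
      rw [h1, map_zero]
      exact evalM_eq_zero_of_mem hf _ _
    · refine mem_minorIdeal_of_evalM hr.out fun U V => ?_
      have := h1 (Sum.elim (fun il => U il.1 il.2) fun lj => V lj.1 lj.2) f
      rw [RingHom.mem_ker.1 hf, map_zero] at this
      exact this.symm
  rw [h2]
  exact RingHom.ker_isPrime Φ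

end MinorIdeal

section ExtVanish

variable {S : Type} [CommRing S] (J : Ideal S)

/-- `Ext^i(S/J, M)` vanishes for `i < d`. -/
def ExtVanish (M : Type) [AddCommGroup M] [Module S M] (d : ℕ) : Prop :=
  ∀ i < d, ExtZero S (S ⧸ J) M i

variable {J} {L M N : Type} [AddCommGroup L] [Module S L] [AddCommGroup M] [Module S M]
  [AddCommGroup N] [Module S N]

lemma ExtVanish.of_subsingleton [Subsingleton M] (d : ℕ) : ExtVanish J M d := by
  intro i _ e
  have h : (𝟙 (ModuleCat.of S M)) = 0 := by
    ext x
    exact Subsingleton.elim (α := M) _ _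
  rw [← Abelian.Ext.comp_mk₀_id e, h, Abelian.Ext.mk₀_zero, Abelian.Ext.comp_zero]

lemma ExtVanish.mono {d d' : ℕ} (h : ExtVanish J M d) (hd : d' ≤ d) : ExtVanish J M d' :=
  fun i hi => h i (by omega)

lemma ExtVanish.of_equiv (e : M ≃ₗ[S] N) {d : ℕ} (h : ExtVanish J M d) : ExtVanish J N d :=
  fun i hi => (h i hi).of_equiv_right e

lemma ExtVanish.quotient {d : ℕ} {f : L →ₗ[S] M} (hf : Function.Injective f)
    (hL : ExtVanish J L (d + 1)) (hM : ExtVanish J M d) :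
    ExtVanish J (M ⧸ LinearMap.range f) d := fun i hi =>
  ExtZero.co_right (f := f) (g := (LinearMap.range f).mkQ) (LinearMap.exact_map_mkQ_range f) hf
    (Submodule.mkQ_surjective _) (hL (i + 1) (by omega)) (hM i hi)

lemma ExtVanish.coker {d : ℕ} {f : L →ₗ[S] M} {g : M →ₗ[S] N} (h : Function.Exact f g)
    (hL : ExtVanish J (M ⧸ LinearMap.range f) (d + 1)) (hN : ExtVanish J N d) :
    ExtVanish J (N ⧸ LinearMap.range g) d := by
  have hk : LinearMap.range f = LinearMap.ker g := h.linearMap_ker_eq.symm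
  have h1 : LinearMap.range ((LinearMap.range f).liftQ g hk.le) = LinearMap.range g :=
    Submodule.range_liftQ _ _ _
  have := ExtVanish.quotient (f := (LinearMap.range f).liftQ g hk.le)
    (LinearMap.ker_eq_bot.1 (Submodule.ker_liftQ_eq_bot _ _ _ hk.ge)) hL hN
  rwa [h1] at this

lemma ExtVanish.prod {d : ℕ} (hM : ExtVanish J M d) (hN : ExtVanish J N d) :
    ExtVanish J (M × N) d := fun i hi =>
  ExtZero.co_mid (f := LinearMap.inl S M N) (g := LinearMap.snd S M N)
    Function.Exact.inl_snd LinearMap.inl_injective LinearMap.snd_surjective (hM i hi) (hN i hi)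

lemma ExtVanish.pi {d : ℕ} (h : ExtVanish J S d) (n : ℕ) : ExtVanish J (Fin n → S) d := by
  induction n with
  | zero => exact ExtVanish.of_subsingleton d
  | succ n ih => exact (h.prod ih).of_equiv (Fin.consLinearEquiv S fun _ => S)

lemma ExtVanish.eq_zero [IsNoetherianRing S] (h : ExtVanish J M 1) {G : Set S}
    (hG : J = Ideal.span G) {x : M} (hx : ∀ g ∈ G, ∃ n : ℕ, g ^ n • x = 0) : x = 0 := by
  have h0 : ∀ y : M, (∀ g ∈ J, g • y = 0) → y = 0 := by
    intro y hy
    have := extZero_zero_iff.1 (h 0 one_pos)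
      (J.liftQ (LinearMap.toSpanSingleton S M y) fun g hg => hy g hg)
    exact (one_smul S y).symm.trans (LinearMap.congr_fun this (Submodule.Quotient.mk 1))
  have hr : J ≤ (Ideal.torsionOf S M x).radical := by
    rw [hG, Ideal.span_le]
    exact fun g hg => hx g hg
  obtain ⟨n, hn⟩ := Ideal.exists_pow_le_of_le_radical_of_fg hr (IsNoetherian.noetherian J)
  have : ∀ k ≤ n, ∀ g ∈ J ^ (n - k), g • x = 0 := by
    intro k
    induction k with
    | zero => exact fun _ g hg => hn hg
    | succ k ih =>
      intro hk g hg
      refine h0 _ fun g' hg' => ?_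
      rw [smul_smul]
      refine ih (by omega) _ ?_
      rw [show n - k = (n - (k + 1)) + 1 by omega, pow_succ']
      exact Ideal.mul_mem_mul hg' hg
  simpa using this n le_rfl 1 (by simp)

variable {b : ℕ → ℕ} {D : ∀ i, Matrix (Fin (b i)) (Fin (b (i + 1))) S} {I : Ideal S} {c : ℕ}
  {e₀ : Fin (b 0)}

lemma IsFreeRes.extVanish (h : IsFreeRes I c b D e₀) {d : ℕ} (hS : ExtVanish J S (c + d)) :
    ExtVanish J (S ⧸ I) d := by
  have h1 : ∀ k ≤ c, ExtVanish J ((Fin (b (c - k)) → S) ⧸ LinearMap.range (D (c - k)).mulVecLin)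
      (c + d - k) := by
    intro k
    induction k with
    | zero =>
      intro _
      have hs : Subsingleton (Fin (b (c + 1)) → S) :=
        ⟨fun x y => by rw [h.eq_zero (Nat.lt_succ_self c) x, h.eq_zero (Nat.lt_succ_self c) y]⟩
      refine ExtVanish.coker (d := c + d) (f := (D (c + 1)).mulVecLin) (h.exact c) ?_ (hS.pi _)
      exact ExtVanish.of_subsingleton _
    | succ k ih =>
      intro hk
      have ih := ih (by omega)
      rw [show c - k = (c - (k + 1)) + 1 by omega] at ih
      refine ExtVanish.coker (h.exact (c - (k + 1))) (ih.mono (by omega)) ((hS.pi _).mono (by omega))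
  have h2 := h1 c le_rfl
  rw [Nat.sub_self, Nat.add_sub_cancel_left] at h2
  exact h2.of_equiv ((Submodule.quotEquivOfEq _ _ h.exact_aug.linearMap_ker_eq.symm).trans
    ((aug I e₀).quotKerEquivOfSurjective (IsFreeRes.aug_surjective I e₀)))

lemma IsFreeRes.extVanish_dual {c' : ℕ} {D : ∀ i, Matrix (Fin (b i)) (Fin (b (i + 1))) S}
    {d : ℕ} (hS : ExtVanish J S (c' + 1 + d))
    (h0 : Function.Injective (D 0).mulVecLin.dualMap)
    (h : ∀ i < c', Function.Exact (D i).mulVecLin.dualMap (D (i + 1)).mulVecLin.dualMap) :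
    ExtVanish J (Module.Dual S (Fin (b (c' + 1)) → S) ⧸ LinearMap.range (D c').mulVecLin.dualMap)
      d := by
  have hD : ∀ n, ExtVanish J (Module.Dual S (Fin n → S)) (c' + 1 + d) := fun n =>
    (hS.pi n).of_equiv ((Pi.basisFun S (Fin n)).toDualEquiv)
  have h1 : ∀ k ≤ c', ExtVanish J (Module.Dual S (Fin (b (k + 1)) → S) ⧸
      LinearMap.range (D k).mulVecLin.dualMap) (c' - k + d) := by
    intro k
    induction k with
    | zero =>
      intro _
      exact ExtVanish.quotient h0 ((hD _).mono (by omega)) ((hD _).mono (by omega))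
    | succ k ih =>
      intro hk
      exact ExtVanish.coker (h k (by omega)) ((ih (by omega)).mono (by omega))
        ((hD _).mono (by omega))
  exact (h1 c' le_rfl).mono (by omega)

end ExtVanish

section Extend

lemma exists_sum_equiv {r p : ℕ} {f : Fin r → Fin (r + p)} (hf : Function.Injective f) :
    ∃ ρ : Fin r ⊕ Fin p ≃ Fin (r + p), ρ ∘ Sum.inl = f := by
  classical
  let e : {x // x ∈ Set.range (Fin.castAdd p : Fin r → Fin (r + p))} ≃ {x // x ∈ Set.range f} :=
    (Equiv.ofInjective _ (Fin.castAdd_injective r p)).symm.trans (Equiv.ofInjective f hf)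
  refine ⟨finSumFinEquiv.trans e.extendSubtype, funext fun i => ?_⟩
  have h1 := e.extendSubtype_apply_of_mem (Fin.castAdd p i) ⟨i, rfl⟩
  have h2 : e ⟨Fin.castAdd p i, ⟨i, rfl⟩⟩ = ⟨f i, ⟨i, rfl⟩⟩ := by
    have : (Equiv.ofInjective _ (Fin.castAdd_injective r p)).symm
        ⟨Fin.castAdd p i, ⟨i, rfl⟩⟩ = i := Equiv.ofInjective_symm_apply _ i
    simp only [e, Equiv.trans_apply, this]
    rfl
  rw [h2] at h1
  exact h1

end Extend

section PivotEval

variable {K : Type} [Field K] {a m r : ℕ} {β β' : Type} [Fintype β] [DecidableEq β]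
  [Fintype β'] [DecidableEq β'] (ρ : Fin r ⊕ β ≃ Fin a) (γ : Fin r ⊕ β' ≃ Fin m)

/-- The columns of the identity matrix singled out by a chart. -/
def chartU (K : Type) [Field K] (ρ : Fin r ⊕ β ≃ Fin a) : Matrix (Fin a) (Fin r) K :=
  (1 : Matrix (Fin a) (Fin a) K).submatrix id (ρ ∘ Sum.inl)

lemma evalM_chart (f : Fin r → Fin a) (g : Fin r → Fin m) :
    evalM (chartU K ρ * (chartU K γ)ᵀ) ((gmat K a m).submatrix f g).det =
      ((chartU K ρ).submatrix f id).det * ((chartU K γ).submatrix g id).det := by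
  rw [evalM_det, submatrix_mul _ _ _ id _ Function.bijective_id, det_mul]
  congr 1
  rw [← det_transpose]
  rfl

lemma chartU_submatrix : (chartU K ρ).submatrix (ρ ∘ Sum.inl) id = 1 := by
  ext i j
  simp [chartU, Matrix.one_apply]

lemma evalM_chart_pivot :
    evalM (chartU K ρ * (chartU K γ)ᵀ) (pivot (gmat K a m) ρ γ) = 1 := by
  rw [pivot, evalM_chart, chartU_submatrix, chartU_submatrix, det_one, one_mul]

lemma pivot_notMem : pivot (gmat K a m) ρ γ ∉ minorIdeal K a m (r + 1) := fun h => by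
  have := evalM_eq_zero_of_mem h (chartU K ρ) (chartU K γ)ᵀ
  rw [evalM_chart_pivot] at this
  exact one_ne_zero this

lemma pivot_mul_sub_mem [Infinite K] (hr : r ≤ m) (f f' : Fin r → Fin a) (g g' : Fin r → Fin m) :
    ((gmat K a m).submatrix f g).det * ((gmat K a m).submatrix f' g').det -
      ((gmat K a m).submatrix f g').det * ((gmat K a m).submatrix f' g).det ∈
        minorIdeal K a m (r + 1) := by
  refine mem_minorIdeal_of_evalM hr fun U V => ?_
  have h : ∀ (f : Fin r → Fin a) (g : Fin r → Fin m),
      evalM (U * V) ((gmat K a m).submatrix f g).det =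
        (U.submatrix f id).det * (V.submatrix id g).det := fun f g => by
    rw [evalM_det, submatrix_mul _ _ _ id _ Function.bijective_id, det_mul]
  rw [map_sub, map_mul, map_mul, h, h, h, h]
  ring

lemma coeffFun_schur_mem [Infinite K] (hr : r ≤ m) (v : β × β' → GS K a m) :
    coeffFun (schur (gmat K a m) ρ γ) v ∈ minorIdeal K a m (r + 1) := by
  have h : ∀ i j, schur (gmat K a m) ρ γ i j ∈ minorIdeal K a m (r + 1) := fun i j => by
    refine mem_minorIdeal_of_evalM hr fun U V => ?_
    have h1 : (gmat K a m).map (evalM (U * V)) = U * V := by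
      ext i j
      simp [gmat, evalM]
    have h2 := schur_map (evalM (U * V)) (gmat K a m) ρ γ
    rw [h1, schur_mul_eq_zero] at h2
    exact (congrFun (congrFun h2 i) j).symm
  rw [coeffFun_apply]
  exact Ideal.sum_mem _ fun i _ => Ideal.sum_mem _ fun j _ => Ideal.mul_mem_left _ _ (h i j)

lemma exists_pow_mul_eq_coeffFun {f : GS K a m} (hf : f ∈ minorIdeal K a m (r + 1)) :
    ∃ (n : ℕ) (v : β × β' → GS K a m),
      pivot (gmat K a m) ρ γ ^ n * f = coeffFun (schur (gmat K a m) ρ γ) v := by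
  suffices h : minorIdeal K a m (r + 1) ≤
      (LinearMap.range (coeffFun (schur (gmat K a m) ρ γ))).comap
        (LinearMap.mulLeft (GS K a m) (pivot (gmat K a m) ρ γ ^ (r + 1))) by
    obtain ⟨v, hv⟩ := h hf
    exact ⟨r + 1, v, hv.symm⟩
  refine Submodule.span_le.2 ?_
  rintro _ ⟨f, g, -, rfl⟩
  exact exists_pow_mul_det_eq _ ρ γ f g

end PivotEval

section Transition

variable {K : Type} [Field K] [Infinite K] {r p c : ℕ}

instance fact_le_add {r q : ℕ} : Fact (r ≤ r + q) := ⟨Nat.le_add_right r q⟩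

/-- The standard basis of the module of `p × (p+1)` matrices. -/
def chartBasis (S : Type) [CommRing S] (hc : p * (p + 1) = c + 1) :
    Module.Basis (Fin (c + 1)) S (Fin p × Fin (p + 1) → S) :=
  (Pi.basisFun S (Fin p × Fin (p + 1))).reindex (finProdFinEquiv.trans (finCongr hc))

/-- The ideal of the generic determinantal variety. -/
abbrev genIdeal (K : Type) [Field K] (r p : ℕ) : Ideal (GS K (r + p) (r + (p + 1))) :=
  minorIdeal K (r + p) (r + (p + 1)) (r + 1)

variable {hc : p * (p + 1) = c + 1} {b : ℕ → ℕ}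
  {D : ∀ i, Matrix (Fin (b i)) (Fin (b (i + 1))) (GS K (r + p) (r + (p + 1)))} {e₀ : Fin (b 0)}
  {ρ ρ' : Fin r ⊕ Fin p ≃ Fin (r + p)} {γ γ' : Fin r ⊕ Fin (p + 1) ≃ Fin (r + (p + 1))}
  {w w' : Fin (b (c + 1)) → GS K (r + p) (r + (p + 1))}

local notation "Yg" => gmat K (r + p) (r + (p + 1))

variable (hc D e₀ ρ γ w) in
/-- A chart vector of the chart given by a pivot of the generic matrix. -/
abbrev IsPivotVec : Prop :=
  IsChartVec D e₀ (chartBasis (GS K (r + p) (r + (p + 1))) hc) (coeffFun (schur Yg ρ γ)) w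

lemma mem_of_pow_mul {x y : GS K (r + p) (r + (p + 1))} (n : ℕ)
    (hy : y ∉ genIdeal K r p) (h : y ^ n * x ∈ genIdeal K r p) : x ∈ genIdeal K r p :=
  ((minorIdeal_isPrime.mem_or_mem h).resolve_left
    fun h' => hy (minorIdeal_isPrime.mem_of_pow_mem _ h'))

lemma transition_row (h : IsFreeRes (genIdeal K r p) (c + 1) b D e₀)
    (hp : 0 < p) (hw : IsPivotVec hc D e₀ ρ γ w)
    (hw' : IsPivotVec hc D e₀ ρ' γ w') : ∃ ε : GS K (r + p) (r + (p + 1)), IsUnit ε ∧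
      ∀ j, pivot Yg ρ γ ^ (p * p - 1) * w' j - ε * pivot Yg ρ' γ ^ (p * p - 1) * w j ∈
        genIdeal K r p := by
  obtain ⟨s, hs⟩ := Nat.exists_eq_succ_of_ne_zero hp.ne'
  set Δ := pivot Yg ρ γ with hΔ
  set Δ' := pivot Yg ρ' γ with hΔ'
  set T := trans ((Yg).submatrix id (γ ∘ Sum.inl)) ρ ρ' with hT
  have hne : Δ' ≠ 0 := fun h0 => pivot_notMem ρ' γ (by
    change Δ' ∈ _
    rw [h0]
    exact zero_mem _)
  obtain ⟨ε, hε, hdet⟩ := det_trans ((Yg).submatrix id (γ ∘ Sum.inl)) ρ ρ'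
  have hdet' : T.det = ε * (Δ' ^ s * Δ) := by
    refine mul_left_cancel₀ hne (hdet.trans ?_)
    have hpow : Δ' ^ p = Δ' ^ s * Δ' := by
      rw [← pow_succ]
      exact congrArg (Δ' ^ ·) hs
    rw [Fintype.card_fin]
    change ε * (Δ' ^ p * Δ) = Δ' * (ε * (Δ' ^ s * Δ))
    rw [hpow]
    ring
  have hF : Δ • coeffFun (schur Yg ρ' γ) =
      coeffFun (schur Yg ρ γ) ∘ₗ (kroneckerMap (· * ·) Tᵀ 1).toLin' := by
    rw [← coeffFun_smul, smul_schur, coeffFun_mul_left]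
  have h1 := hw'.smul Δ
  have h2 := hw.comp (kroneckerMap (· * ·) Tᵀ 1).toLin'
  rw [← hF, det_kron_left, Fintype.card_fin, hdet'] at h2
  refine ⟨ε ^ (p + 1), hε.pow _, fun j => ?_⟩
  refine mem_of_pow_mul (p + 1) (pivot_notMem ρ γ) ?_
  have h3 := IsChartVec.sub_mem h
    (fun v => Ideal.mul_mem_left _ _ (coeffFun_schur_mem ρ' γ (Nat.le_add_right _ _) v)) h1 h2 j
  simp only [Pi.smul_apply, smul_eq_mul, ← hc] at h3
  have h4 : p * p - 1 = s * (p + 1) := by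
    rw [hs]
    exact Nat.sub_eq_of_eq_add (by simp only [Nat.succ_eq_add_one]; ring)
  have h5 : p * (p + 1) = p * p - 1 + (p + 1) := by
    rw [h4, hs]
    simp only [Nat.succ_eq_add_one]
    ring
  rw [h5, mul_pow, mul_pow, ← pow_mul, ← h4] at h3
  convert h3 using 1
  ring

lemma transition_col (h : IsFreeRes (genIdeal K r p) (c + 1) b D e₀)
    (hw : IsPivotVec hc D e₀ ρ γ w)
    (hw' : IsPivotVec hc D e₀ ρ γ' w') : ∃ ε : GS K (r + p) (r + (p + 1)), IsUnit ε ∧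
      ∀ j, pivot Yg ρ γ ^ (p * p) * w' j - ε * pivot Yg ρ γ' ^ (p * p) * w j ∈
        genIdeal K r p := by
  set Δ := pivot Yg ρ γ with hΔ
  set Δ' := pivot Yg ρ γ' with hΔ'
  set T := trans ((Yg)ᵀ.submatrix id (ρ ∘ Sum.inl)) γ γ' with hT
  have hne : Δ' ≠ 0 := fun h0 => pivot_notMem ρ γ' (by
    change Δ' ∈ _
    rw [h0]
    exact zero_mem _)
  obtain ⟨ε, hε, hdet⟩ := det_trans ((Yg)ᵀ.submatrix id (ρ ∘ Sum.inl)) γ γ'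
  have hp1 : (((Yg)ᵀ.submatrix id (ρ ∘ Sum.inl)).submatrix (γ ∘ Sum.inl) id).det = Δ :=
    pivot_transpose Yg ρ γ
  have hp2 : (((Yg)ᵀ.submatrix id (ρ ∘ Sum.inl)).submatrix (γ' ∘ Sum.inl) id).det = Δ' :=
    pivot_transpose Yg ρ γ'
  rw [hp1, hp2] at hdet
  have hdet' : T.det = ε * (Δ' ^ p * Δ) := by
    refine mul_left_cancel₀ hne (hdet.trans ?_)
    rw [Fintype.card_fin, pow_succ]
    ring
  have hF : Δ • coeffFun (schur Yg ρ γ') =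
      coeffFun (schur Yg ρ γ) ∘ₗ (kroneckerMap (· * ·) 1 Tᵀ).toLin' := by
    have h1 := congrArg Matrix.transpose (smul_schur γ γ' (Yg)ᵀ ρ)
    rw [pivot_transpose, schur_transpose, schur_transpose, transpose_smul, transpose_mul,
      transpose_transpose, transpose_transpose] at h1
    rw [← coeffFun_smul, h1, coeffFun_mul_right]
  have h1 := hw'.smul Δ
  have h2 := hw.comp (kroneckerMap (· * ·) 1 Tᵀ).toLin'
  rw [← hF, det_kron_right, det_transpose, Fintype.card_fin, hdet'] at h2
  refine ⟨ε ^ p, hε.pow _, fun j => ?_⟩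
  refine mem_of_pow_mul p (pivot_notMem ρ γ) ?_
  have h3 := IsChartVec.sub_mem h
    (fun v => Ideal.mul_mem_left _ _ (coeffFun_schur_mem ρ γ' (Nat.le_add_right _ _) v)) h1 h2 j
  simp only [Pi.smul_apply, smul_eq_mul, ← hc] at h3
  convert h3 using 1
  rw [← hΔ]
  ring

lemma transition (h : IsFreeRes (genIdeal K r p) (c + 1) b D e₀)
    (hp : 0 < p) {w₁ : Fin (b (c + 1)) → GS K (r + p) (r + (p + 1))}
    (hw₁ : IsPivotVec hc D e₀ ρ' γ w₁) (hw : IsPivotVec hc D e₀ ρ γ w)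
    (hw' : IsPivotVec hc D e₀ ρ' γ' w') : ∃ ε : GS K (r + p) (r + (p + 1)), IsUnit ε ∧
      ∀ j, pivot Yg ρ γ ^ (p * p - 1) * pivot Yg ρ' γ * w' j -
        ε * pivot Yg ρ' γ' ^ (p * p) * w j ∈ genIdeal K r p := by
  obtain ⟨ε₁, hε₁, h1⟩ := transition_row h hp hw hw₁
  obtain ⟨ε₂, hε₂, h2⟩ := transition_col h hw₁ hw'
  refine ⟨ε₂ * ε₁, hε₂.mul hε₁, fun j => mem_of_pow_mul (p * p - 1) (pivot_notMem ρ' γ) ?_⟩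
  have h3 := Ideal.add_mem _ (Ideal.mul_mem_left _ (pivot Yg ρ γ ^ (p * p - 1)) (h2 j))
    (Ideal.mul_mem_left _ (ε₂ * pivot Yg ρ' γ' ^ (p * p)) (h1 j))
  have h4 : pivot Yg ρ' γ ^ (p * p) = pivot Yg ρ' γ ^ (p * p - 1) * pivot Yg ρ' γ := by
    rw [← pow_succ, Nat.sub_add_cancel (Nat.mul_pos hp hp)]
  rw [h4] at h3
  convert h3 using 1
  ring

end Transition

section MinorDepth

variable {K : Type} [Field K] [Infinite K] {a m r : ℕ}

lemma isPerf_minorIdeal (ha : r ≤ a) (hm : r ≤ m) :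
    IsPerf (minorIdeal K a m (r + 1)) ((a - r) * (m - r)) := by
  have hc : rsCodim a m 0 (Finset.range r) 0 = (a - r) * (m - r) := by
    obtain ⟨d, rfl⟩ := Nat.exists_eq_add_of_le hm
    rw [rsCodim, Finset.sum_range_add, Finset.sum_eq_zero, cnt_zero]
    · have : ∀ x ∈ Finset.range d, (if r + x ∈ Finset.range r then 0 else
          a - 0 - cnt (Finset.range r) (r + x)) = a - r := fun x _ => by
        rw [if_neg (by simp), cnt_range, min_eq_right (by omega), Nat.sub_zero]
      rw [Finset.sum_congr rfl this, Finset.sum_const, Finset.card_range, smul_eq_mul,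
        Nat.add_sub_cancel_left]
      ring
    · exact fun x hx => if_pos hx
  rw [← rsIdeal_range hm, ← hc]
  rcases Nat.eq_zero_or_pos r with rfl | hr
  · rw [Finset.range_zero]
    exact isPerf_rsIdeal_empty 0 0 (Nat.zero_le _)
  · exact isPerf_rsIdeal 0 (Nat.zero_le _) 0 (Nat.zero_le _) _
      (fun w hw => (Finset.mem_range.1 hw).trans_le hm) (by simpa using ha)
      (Or.inl (Finset.mem_range.2 hr))

open RingTheory.Sequence in
lemma IsPerf.exists_isRegular {σ : Type} [Finite σ] {J : Ideal (MvPolynomial σ K)} {g : ℕ}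
    (h : IsPerf J g) (hJ : J ≠ ⊤) :
    ∃ fs : List (MvPolynomial σ K), fs.length = g ∧ (∀ f ∈ fs, f ∈ J) ∧
      IsRegular (MvPolynomial σ K) fs := by
  refine ModuleCat.exists_isRegular_of_exists_subsingleton_ext J g
    (ModuleCat.of (MvPolynomial σ K) (MvPolynomial σ K)) ?_
    (ModuleCat.of (MvPolynomial σ K) (MvPolynomial σ K ⧸ J)) ?_ fun i hi => ?_
  · rw [smul_eq_mul, Ideal.mul_top]
    exact lt_top_iff_ne_top.2 hJ
  · rw [Module.support_eq_zeroLocus, Ideal.annihilator_quotient]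
  · exact subsingleton_of_forall_eq 0 (h.self i hi)

lemma extVanish_minorIdeal {p : ℕ} :
    ExtVanish (minorIdeal K (r + p) (r + (p + 1)) r) (GS K (r + p) (r + (p + 1)))
      (p * (p + 1) + 2) := by
  intro i hi
  cases r with
  | zero =>
    have h1 : minorIdeal K (0 + p) (0 + (p + 1)) 0 = ⊤ := by
      rw [Ideal.eq_top_iff_one]
      have := det_mem_minorIdeal (K := K) (a := 0 + p) (m := 0 + (p + 1))
        (Fin.elim0 : Fin 0 → Fin (0 + p)) Fin.elim0
      rwa [det_isEmpty] at this
    rw [h1]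
    intro e
    have h : (𝟙 (ModuleCat.of (GS K (0 + p) (0 + (p + 1)))
        (GS K (0 + p) (0 + (p + 1)) ⧸ (⊤ : Ideal (GS K (0 + p) (0 + (p + 1))))))) = 0 := by
      ext
      exact Subsingleton.elim
        (α := GS K (0 + p) (0 + (p + 1)) ⧸ (⊤ : Ideal (GS K (0 + p) (0 + (p + 1))))) _ _
    rw [← Abelian.Ext.mk₀_id_comp e, h, Abelian.Ext.mk₀_zero, Abelian.Ext.zero_comp]
  | succ r =>
    refine (isPerf_minorIdeal (r := r) (by omega) (by omega)).self i ?_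
    rw [show r + 1 + p - r = p + 1 by omega, show r + 1 + (p + 1) - r = p + 2 by omega]
    nlinarith

end MinorDepth

section Saturation

variable {K : Type} [Field K] {a m r : ℕ}

lemma cnt_skip (r j : ℕ) : cnt (insert (r + 1) (Finset.range r)) j =
    if j ≤ r then j else if j = r + 1 then r else r + 1 := by
  induction j with
  | zero => simp [cnt_zero]
  | succ j ih =>
    rw [cnt_succ, ih]
    simp only [Finset.mem_insert, Finset.mem_range]
    split_ifs <;> omega

lemma colMinors_le_rsIdeal_skip :
    colMinors K a m (r + 1) (r + 1) ⊆ rsIdeal K a m 0 (insert (r + 1) (Finset.range r)) 0 :=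
  fun f hf => by
    refine colMinors_subset _ _ _ (r + 1) ?_
    rwa [cnt_skip, if_neg (by omega), if_pos rfl]

lemma minorIdeal_le_rsIdeal_skip (hm : r + 1 < m) :
    minorIdeal K a m (r + 2) ≤ rsIdeal K a m 0 (insert (r + 1) (Finset.range r)) 0 :=
  Ideal.span_le.2 fun f hf => by
    refine colMinors_subset _ _ _ m ?_
    rwa [cnt_skip, if_neg (by omega), if_neg (by omega)]

lemma rsIdeal_skip_le :
    rsIdeal K a m 0 (insert (r + 1) (Finset.range r)) 0 ≤
      minorIdeal K a m (r + 2) ⊔ Ideal.span (colMinors K a m (r + 1) (r + 1)) := by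
  refine rsIdeal_le ?_ fun j f hf => ?_
  · rintro f ⟨i, j, h, -⟩
    omega
  · rw [cnt_skip] at hf
    split_ifs at hf with h1 h2
    · rw [colMinors_eq_zero (Nat.lt_succ_self j) hf]
      exact zero_mem _
    · exact Ideal.mem_sup_right (Ideal.subset_span (h2 ▸ hf))
    · obtain ⟨ρ, γ, -, rfl⟩ := hf
      exact Ideal.mem_sup_left (det_mem_minorIdeal ρ γ)

lemma mem_rsIdeal_skip_of_mul [Infinite K] (hr : r + 1 < m) (ha : 0 < a) {f g : GS K a m}
    (h : f * g ∈ rsIdeal K a m 0 (insert (r + 1) (Finset.range r)) 0) :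
    f ∈ rsIdeal K a m 0 (insert (r + 1) (Finset.range r)) 0 ∨
      g ∈ rsIdeal K a m 0 (insert (r + 1) (Finset.range r)) 0 := by
  have hD : ∀ w ∈ insert (r + 1) (Finset.range r), w < m := by
    intro w hw
    rw [Finset.mem_insert, Finset.mem_range] at hw
    omega
  rcases Nat.eq_zero_or_pos r with rfl | hr0
  · rw [rsIdeal_first_pivot (u := 1) ha (by simp)] at h ⊢
    exact mem_rsIdeal_of_mul (Nat.zero_le _) hr hD (by simp) h
  · exact mem_rsIdeal_of_mul (Nat.zero_le _) (by omega) hD (by simp [hr0]) h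

lemma evalM_eq_zero_of_mem_skip {f : GS K a m}
    (hf : f ∈ minorIdeal K a m (r + 2) ⊔ Ideal.span (colMinors K a m (r + 1) (r + 1)))
    (U : Matrix (Fin a) (Fin (r + 1)) K) (V : Matrix (Fin (r + 1)) (Fin m) K)
    (hV : ∀ j : Fin m, (j : ℕ) < r + 1 → V (Fin.last r) j = 0) : evalM (U * V) f = 0 := by
  have h : minorIdeal K a m (r + 2) ⊔ Ideal.span (colMinors K a m (r + 1) (r + 1)) ≤
      RingHom.ker (evalM (U * V)) := by
    refine sup_le (fun f hf => evalM_eq_zero_of_mem hf U V) (Ideal.span_le.2 ?_)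
    rintro _ ⟨ρ, γ, hγ, rfl⟩
    change evalM (U * V) _ = 0
    rw [evalM_det, submatrix_mul _ _ _ id _ Function.bijective_id, det_mul,
      det_eq_zero_of_row_eq_zero (A := V.submatrix id γ) (Fin.last r) (fun j => hV _ (hγ j)),
      mul_zero]
  exact h hf

end Saturation

section TopDual

variable {K : Type} [Field K] {r p : ℕ}

local notation "Yg" => gmat K (r + p) (r + (p + 1))
local notation "Sg" => GS K (r + p) (r + (p + 1))

lemma eq_zero_or_pivot (f : Fin r → Fin (r + p)) (g : Fin r → Fin (r + (p + 1))) :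
    ((Yg).submatrix f g).det = 0 ∨
      ∃ (ρ : Fin r ⊕ Fin p ≃ Fin (r + p)) (γ : Fin r ⊕ Fin (p + 1) ≃ Fin (r + (p + 1))),
        ρ ∘ Sum.inl = f ∧ γ ∘ Sum.inl = g := by
  by_cases hf : Function.Injective f
  · by_cases hg : Function.Injective g
    · obtain ⟨ρ, hρ⟩ := exists_sum_equiv hf
      obtain ⟨γ, hγ⟩ := exists_sum_equiv hg
      exact Or.inr ⟨ρ, γ, hρ, hγ⟩
    · obtain ⟨x, y, hxy, hne⟩ := Function.not_injective_iff.1 hg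
      exact Or.inl (det_zero_of_column_eq hne fun i => by simp [hxy])
  · obtain ⟨x, y, hxy, hne⟩ := Function.not_injective_iff.1 hf
    exact Or.inl (det_zero_of_row_eq hne (funext fun i => by simp [hxy]))

lemma ExtVanish.eq_zero_of_pivot {M : Type} [AddCommGroup M] [Module Sg M]
    (h : ExtVanish (minorIdeal K (r + p) (r + (p + 1)) r) M 1) {x : M}
    (hx : ∀ (ρ : Fin r ⊕ Fin p ≃ Fin (r + p)) (γ : Fin r ⊕ Fin (p + 1) ≃ Fin (r + (p + 1))),
      ∃ n : ℕ, pivot Yg ρ γ ^ n • x = 0) : x = 0 := by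
  refine h.eq_zero rfl (x := x) ?_
  rintro _ ⟨f, g, -, rfl⟩
  obtain h0 | ⟨ρ, γ, rfl, rfl⟩ := eq_zero_or_pivot (K := K) f g
  · exact ⟨1, by rw [h0, pow_one, zero_smul]⟩
  · exact hx ρ γ

variable (K r p) in
/-- The ideal of the coordinate ring of the determinantal variety generated by the minors of the
first columns. -/
def colSub : Submodule Sg (Sg ⧸ genIdeal K r p) :=
  Submodule.span Sg (Set.range fun f : Fin r → Fin (r + p) =>
    (genIdeal K r p).mkQ ((Yg).submatrix f (Fin.castAdd (p + 1))).det)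

lemma mkQ_mem_colSub {s : Sg} : (genIdeal K r p).mkQ s ∈ colSub K r p ↔
    s ∈ genIdeal K r p ⊔ Ideal.span (colMinors K (r + p) (r + (p + 1)) r r) := by
  have h1 : Ideal.span (colMinors K (r + p) (r + (p + 1)) r r) =
      Ideal.span (Set.range fun f : Fin r → Fin (r + p) =>
        ((Yg).submatrix f (Fin.castAdd (p + 1))).det) := by
    apply le_antisymm <;> rw [Ideal.span_le]
    · rintro _ ⟨f, g, hg, rfl⟩
      by_cases hi : Function.Injective g
      · let σ : Fin r → Fin r := fun l => ⟨g l, hg l⟩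
        have hσ : Function.Bijective σ := Finite.injective_iff_bijective.1 fun x y hxy =>
          hi (Fin.ext (Fin.mk.inj_iff.1 hxy))
        have := det_permute' (Equiv.ofBijective σ hσ) ((Yg).submatrix f (Fin.castAdd (p + 1)))
        have h2 : (((Yg).submatrix f (Fin.castAdd (p + 1))).submatrix id
            (Equiv.ofBijective σ hσ)) = (Yg).submatrix f g := rfl
        rw [h2] at this
        rw [this]
        exact Ideal.mul_mem_left _ _ (Ideal.subset_span ⟨f, rfl⟩)
      · obtain ⟨x, y, hxy, hne⟩ := Function.not_injective_iff.1 hi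
        have : ((Yg).submatrix f g).det = 0 :=
          det_zero_of_column_eq hne fun i => by simp [hxy]
        rw [this]
        exact zero_mem _
    · rintro _ ⟨f, rfl⟩
      exact Ideal.subset_span ⟨f, Fin.castAdd (p + 1), fun l => l.2, rfl⟩
  have h2 : colSub K r p =
      Submodule.map (genIdeal K r p).mkQ (Ideal.span (colMinors K (r + p) (r + (p + 1)) r r)) := by
    rw [h1, Ideal.span, Submodule.map_span, ← Set.range_comp]
    rfl
  rw [← Submodule.mem_comap, h2, Submodule.comap_map_mkQ]

lemma mem_colSub_of_pivot [Infinite K] (hp : 0 < p) {y : Sg ⧸ genIdeal K r p}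
    (hy : ∀ (ρ : Fin r ⊕ Fin p ≃ Fin (r + p)) (γ : Fin r ⊕ Fin (p + 1) ≃ Fin (r + (p + 1))),
      ∃ n : ℕ, pivot Yg ρ γ ^ n • y ∈ colSub K r p) : y ∈ colSub K r p := by
  obtain ⟨s, rfl⟩ := Submodule.mkQ_surjective _ y
  cases r with
  | zero =>
    obtain ⟨n, hn⟩ := hy finSumFinEquiv finSumFinEquiv
    rwa [pivot, det_isEmpty, one_pow, one_smul] at hn
  | succ r =>
    let g : Fin (r + 1) → Fin (r + 1 + (p + 1)) :=
      Equiv.swap (Fin.castAdd (p + 1) (Fin.last r)) (Fin.natAdd (r + 1) 0) ∘ Fin.castAdd (p + 1)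
    obtain ⟨γ, hγ⟩ := exists_sum_equiv (f := g)
      ((Equiv.injective _).comp (Fin.castAdd_injective _ _))
    let ρ : Fin (r + 1) ⊕ Fin p ≃ Fin (r + 1 + p) := finSumFinEquiv
    obtain ⟨n, hn⟩ := hy ρ γ
    rw [← map_smul, mkQ_mem_colSub, smul_eq_mul] at hn
    rw [mkQ_mem_colSub]
    have hle : genIdeal K (r + 1) p ⊔
        Ideal.span (colMinors K (r + 1 + p) (r + 1 + (p + 1)) (r + 1) (r + 1)) ≤
        rsIdeal K (r + 1 + p) (r + 1 + (p + 1)) 0 (insert (r + 1) (Finset.range r)) 0 :=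
      sup_le (minorIdeal_le_rsIdeal_skip (by omega)) (Ideal.span_le.2 colMinors_le_rsIdeal_skip)
    have hev : ∀ f ∈ genIdeal K (r + 1) p ⊔
        Ideal.span (colMinors K (r + 1 + p) (r + 1 + (p + 1)) (r + 1) (r + 1)),
        evalM (chartU K ρ * (chartU K γ)ᵀ) f = 0 := fun f hf =>
      evalM_eq_zero_of_mem_skip hf _ _ fun j hj => by
        have hl : γ (Sum.inl (Fin.last r)) = Fin.natAdd (r + 1) 0 :=
          (congrFun hγ (Fin.last r)).trans (Equiv.swap_apply_left _ _)
        have hne : j ≠ γ (Sum.inl (Fin.last r)) := fun h => by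
          rw [h, hl] at hj
          simp at hj
        simp [chartU, hne]
    have hpr : ∀ k, pivot (gmat K (r + 1 + p) (r + 1 + (p + 1))) ρ γ ^ k ∉
        rsIdeal K (r + 1 + p) (r + 1 + (p + 1)) 0 (insert (r + 1) (Finset.range r)) 0 :=
      fun k hk => by
        have := hev _ (rsIdeal_skip_le hk)
        rw [map_pow, evalM_chart_pivot, one_pow] at this
        exact one_ne_zero this
    exact rsIdeal_skip_le
      ((mem_rsIdeal_skip_of_mul (by omega) (by omega) (hle hn)).resolve_left (hpr n))

open RingTheory.Sequence in
lemma IsFreeRes.dual_exact {S : Type} [CommRing S] {J : Ideal S} {c : ℕ} {b : ℕ → ℕ}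
    {D : ∀ i, Matrix (Fin (b i)) (Fin (b (i + 1))) S} {e₀ : Fin (b 0)}
    (h : IsFreeRes J (c + 1) b D e₀) (fs : List S) (hreg : IsWeaklyRegular S fs)
    (hlen : fs.length = c + 1) (hfs : ∀ f ∈ fs, f ∈ J) :
    Function.Injective (D 0).mulVecLin.dualMap ∧
      ∀ i < c, Function.Exact (D i).mulVecLin.dualMap (D (i + 1)).mulVecLin.dualMap := by
  have := dual_exact_of_contraction (P := fun i => Fin (b i) → S) fs (fun i => (D i).mulVecLin)
    h.mulVec_mulVec_eq_zero (fun i => isWeaklyRegular_of_flat _ hreg)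
    (fun f hf k => h.exists_isContraction (hfs f hf) k)
  exact ⟨this.1 (by omega), fun i hi => this.2 i (by omega)⟩

variable [Infinite K] {c : ℕ} {b : ℕ → ℕ}

lemma smul_mkQ_eq_zero_iff {n : ℕ} {Δ : Sg} (hΔ : Δ ∉ genIdeal K r p)
    {y : Sg ⧸ genIdeal K r p} : Δ ^ n • y = 0 ↔ y = 0 := by
  refine ⟨fun h => ?_, fun h => by rw [h, smul_zero]⟩
  obtain ⟨s, rfl⟩ := Submodule.mkQ_surjective _ y
  rw [← map_smul, ← LinearMap.mem_ker, Submodule.ker_mkQ] at h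
  rw [← LinearMap.mem_ker, Submodule.ker_mkQ]
  exact mem_of_pow_mul n hΔ h

lemma lsmul_pow_injective {n : ℕ} {Δ : Sg} (hΔ : Δ ∉ genIdeal K r p) :
    Function.Injective (LinearMap.lsmul Sg (Sg ⧸ genIdeal K r p) (Δ ^ n)) := by
  exact (injective_iff_map_eq_zero _).2 fun y hy => (smul_mkQ_eq_zero_iff hΔ).1 hy

lemma dual_apply_mem {S : Type} [CommRing S] {J : Ideal S} {n : ℕ} {v : Fin n → S}
    (hv : ∀ j, v j ∈ J) (μ : Module.Dual S (Fin n → S)) : μ v ∈ J := by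
  rw [LinearMap.pi_apply_eq_sum_univ μ v]
  exact Ideal.sum_mem _ fun j _ => Ideal.mul_mem_right _ _ (hv j)

/-- The top dual cokernel of a resolution of the generic determinantal ring. -/
theorem nonempty_dualCoker_equiv_colSub
    {D : ∀ i, Matrix (Fin (b i)) (Fin (b (i + 1))) Sg} {e₀ : Fin (b 0)} (hp : 0 < p) (hc : p * (p + 1) = c + 1)
    (h : IsFreeRes (genIdeal K r p) (c + 1) b D e₀) :
    Nonempty ((Module.Dual Sg (Fin (b (c + 1)) → Sg) ⧸
      LinearMap.range (LinearMap.dualMap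
        ((D c).mulVecLin : (Fin (b (c + 1)) → Sg) →ₗ[Sg] Fin (b c) → Sg))) ≃ₗ[Sg] colSub K r p) := by
  have hperf : IsPerf (genIdeal K r p) (c + 1) := by
    have := isPerf_minorIdeal (K := K) (a := r + p) (m := r + (p + 1)) (r := r) (by omega)
      (by omega)
    rwa [Nat.add_sub_cancel_left, Nat.add_sub_cancel_left, hc] at this
  obtain ⟨fs, hlen, hfs, hreg⟩ := hperf.exists_isRegular minorIdeal_isPrime.ne_top
  have hreg := hreg.toIsWeaklyRegular
  obtain ⟨hinj, hex⟩ := h.dual_exact fs hreg hlen hfs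
  have hS := extVanish_minorIdeal (K := K) (r := r) (p := p)
  rw [hc] at hS
  have hE := IsFreeRes.extVanish_dual (d := 2) hS hinj hex
  have hB := h.extVanish hS
  have hF : ∀ (ρ : Fin r ⊕ Fin p ≃ Fin (r + p)) (γ : Fin r ⊕ Fin (p + 1) ≃ Fin (r + (p + 1)))
      v, coeffFun (schur Yg ρ γ) v ∈ genIdeal K r p := fun ρ γ =>
    coeffFun_schur_mem ρ γ (Nat.le_add_right _ _)
  have hw : ∀ (ρ : Fin r ⊕ Fin p ≃ Fin (r + p)) (γ : Fin r ⊕ Fin (p + 1) ≃ Fin (r + (p + 1))),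
      ∃ w, IsPivotVec hc D e₀ ρ γ w := fun ρ γ => exists_isChartVec h _ (hF ρ γ)
  choose w hw using hw
  let ρ₀ : Fin r ⊕ Fin p ≃ Fin (r + p) := finSumFinEquiv
  let γ₀ : Fin r ⊕ Fin (p + 1) ≃ Fin (r + (p + 1)) := finSumFinEquiv
  have hev := fun ρ γ => (hw ρ γ).dual_eval h (hF ρ γ) (pivot Yg ρ γ)
    (fun f hf => exists_pow_mul_eq_coeffFun ρ γ hf) fs hreg hlen hfs
  set k := p * p - 1
  set Δ₀ := pivot Yg ρ₀ γ₀
  have hΔ₀ : Δ₀ ∉ genIdeal K r p := pivot_notMem _ _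
  let π := (genIdeal K r p).mkQ
  let ψ : Module.Dual Sg (Fin (b (c + 1)) → Sg) →ₗ[Sg] Sg ⧸ genIdeal K r p :=
    π ∘ₗ Module.Dual.eval Sg _ (w ρ₀ γ₀)
  have hπ : ∀ s, π s = 0 ↔ s ∈ genIdeal K r p := fun s => by
    rw [← LinearMap.mem_ker, Submodule.ker_mkQ]
  have htr : ∀ ρ γ, ∃ ε η : Sg, η * ε = 1 ∧ ∀ μ : Module.Dual Sg (Fin (b (c + 1)) → Sg),
      pivot Yg ρ γ ^ (p * p) • ψ μ =
        Δ₀ ^ k • (η * μ (w ρ γ)) • π (pivot Yg ρ γ₀) := by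
    intro ρ γ
    obtain ⟨ε, hε, h1⟩ := transition h hp (hw ρ γ₀) (hw ρ₀ γ₀) (hw ρ γ)
    obtain ⟨η, hη⟩ := hε.exists_left_inv
    refine ⟨ε, η, hη, fun μ => ?_⟩
    have h2 := dual_apply_mem (J := genIdeal K r p) (v := (Δ₀ ^ k * pivot Yg ρ γ₀) • w ρ γ -
      (ε * pivot Yg ρ γ ^ (p * p)) • w ρ₀ γ₀) (fun j => h1 j) μ
    have h3 := (genIdeal K r p).mul_mem_left η h2
    rw [← hπ] at h3
    symm
    rw [← sub_eq_zero, ← h3]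
    change _ • _ • _ - _ • π (μ _) = _
    rw [← map_smul, ← map_smul, ← map_smul, ← map_sub]
    congr 1
    simp only [map_sub, map_smul, smul_eq_mul]
    linear_combination (pivot Yg ρ γ ^ (p * p) * μ (w ρ₀ γ₀)) * hη
  have hker : LinearMap.ker ψ = LinearMap.range (D c).mulVecLin.dualMap := by
    apply le_antisymm
    · intro μ hμ
      rw [← Submodule.ker_mkQ (LinearMap.range (D c).mulVecLin.dualMap), LinearMap.mem_ker]
      refine (hE.mono one_le_two).eq_zero_of_pivot fun ρ γ => ?_
      obtain ⟨ε, η, hε, hη⟩ := htr ρ γ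
      have h1 := hη μ
      rw [LinearMap.mem_ker.1 hμ, smul_zero, ← map_smul, ← map_smul, eq_comm, hπ] at h1
      have h2 : ε * (η * μ (w ρ γ)) ∈ genIdeal K r p :=
        (genIdeal K r p).mul_mem_left ε ((minorIdeal_isPrime.mem_or_mem
          (mem_of_pow_mul k hΔ₀ h1)).resolve_right (pivot_notMem _ _))
      have h3 : μ (w ρ γ) ∈ genIdeal K r p := by
        convert h2 using 1
        linear_combination -μ (w ρ γ) * hε
      obtain ⟨N, hN⟩ := (hev ρ γ).2 μ h3
      exact ⟨N, by rwa [← map_smul, ← LinearMap.mem_ker, Submodule.ker_mkQ]⟩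
    · rintro _ ⟨ν, rfl⟩
      exact (hπ _).2 ((hw ρ₀ γ₀).dual_mem (hF ρ₀ γ₀) ν)
  have hrange : LinearMap.range ψ =
      (colSub K r p).map (LinearMap.lsmul Sg (Sg ⧸ genIdeal K r p) (Δ₀ ^ k)) := by
    apply le_antisymm
    · rintro _ ⟨μ, rfl⟩
      have h1 : ψ μ ∈ LinearMap.range (LinearMap.lsmul Sg (Sg ⧸ genIdeal K r p) (Δ₀ ^ k)) := by
        rw [← Submodule.ker_mkQ (LinearMap.range _), LinearMap.mem_ker]
        refine ((ExtVanish.quotient (d := 1) (lsmul_pow_injective hΔ₀) hB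
          (hB.mono one_le_two))).eq_zero_of_pivot fun ρ γ => ?_
        obtain ⟨ε, η, -, hη⟩ := htr ρ γ
        refine ⟨p * p, ?_⟩
        rw [← map_smul, hη, ← LinearMap.mem_ker, Submodule.ker_mkQ]
        exact ⟨_, rfl⟩
      obtain ⟨y, hy⟩ := h1
      refine ⟨y, mem_colSub_of_pivot hp fun ρ γ => ?_, hy⟩
      obtain ⟨ε, η, -, hη⟩ := htr ρ γ
      refine ⟨p * p, ?_⟩
      have h2 : pivot Yg ρ γ ^ (p * p) • y = (η * μ (w ρ γ)) • π (pivot Yg ρ γ₀) := by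
        refine lsmul_pow_injective (n := k) hΔ₀ ?_
        rw [map_smul, hy, hη]
        rfl
      rw [h2]
      exact Submodule.smul_mem _ _ (Submodule.subset_span ⟨ρ ∘ Sum.inl, rfl⟩)
    · rw [colSub, Submodule.map_span, Submodule.span_le]
      rintro _ ⟨_, ⟨f, rfl⟩, rfl⟩
      obtain h0 | ⟨ρ, γ', rfl, -⟩ := eq_zero_or_pivot (K := K) f (Fin.castAdd (p + 1))
      · simp only [h0, map_zero]
        exact zero_mem _
      · change LinearMap.lsmul Sg (Sg ⧸ genIdeal K r p) (Δ₀ ^ k) (π (pivot Yg ρ γ₀)) ∈ _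
        rw [← Submodule.ker_mkQ (LinearMap.range ψ), SetLike.mem_coe, LinearMap.mem_ker]
        have hA : ExtVanish (minorIdeal K (r + p) (r + (p + 1)) r) (LinearMap.range ψ) 2 :=
          hE.of_equiv ((Submodule.quotEquivOfEq _ _ hker.symm).trans ψ.quotKerEquivRange)
        have hq := ExtVanish.quotient (d := 1) (LinearMap.range ψ).subtype_injective hA
          (hB.mono one_le_two)
        rw [Submodule.range_subtype] at hq
        refine hq.eq_zero_of_pivot fun ρ' γ => ?_
        obtain ⟨N, hN⟩ := (hev ρ' γ).1
        obtain ⟨μ, hμ⟩ := hN (pivot Yg ρ γ)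
        obtain ⟨ε, η, hε, hη⟩ := htr ρ' γ
        refine ⟨N + 1, ?_⟩
        rw [← map_smul, ← LinearMap.mem_ker, Submodule.ker_mkQ]
        refine ⟨ε • pivot Yg ρ' γ ^ (p * p) • μ, ?_⟩
        rw [map_smul, map_smul, hη, LinearMap.lsmul_apply]
        simp only [← map_smul]
        rw [← sub_eq_zero, ← map_sub, hπ]
        have h1 := pivot_mul_sub_mem (K := K) (r := r) (a := r + p) (m := r + (p + 1))
          (Nat.le_add_right _ _) (ρ' ∘ Sum.inl) (ρ ∘ Sum.inl) (γ ∘ Sum.inl) (γ₀ ∘ Sum.inl)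
        have h2 := add_mem ((genIdeal K r p).mul_mem_left (Δ₀ ^ k * pivot Yg ρ' γ₀) hμ)
          ((genIdeal K r p).mul_mem_left (-(Δ₀ ^ k * pivot Yg ρ' γ ^ N)) h1)
        convert h2 using 1
        simp only [smul_eq_mul, pivot]
        linear_combination (Δ₀ ^ k * μ (w ρ' γ) *
          ((Yg).submatrix (ρ' ∘ Sum.inl) (γ₀ ∘ Sum.inl)).det) * hε
  exact ⟨(Submodule.quotEquivOfEq _ _ hker.symm).trans (ψ.quotKerEquivRange.trans
    ((LinearEquiv.ofEq _ _ hrange).trans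
      (Submodule.equivMapOfInjective _ (lsmul_pow_injective hΔ₀) _).symm))⟩

end TopDual

section Contraction

variable {S : Type} [CommRing S] {M : Type} [AddCommGroup M] [Module S M]

lemma ctr_mul (F : Module.Dual S M) {n : ℕ} {x : ExteriorAlgebra S M} (hx : x ∈ ⋀[S]^n M)
    (y : ExteriorAlgebra S M) : ctr F (x * y) = ctr F x * y + (-1 : S) ^ n • (x * ctr F y) := by
  refine exteriorPower_induction (C := fun n x => ctr F (x * y) =
    ctr F x * y + (-1 : S) ^ n • (x * ctr F y)) (fun s => ?_) (fun n x z h h' => ?_)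
    (fun n v x _ h => ?_) n x hx
  · rw [ctr_algebraMap, zero_mul, zero_add, pow_zero, one_smul, ← Algebra.smul_def, map_smul,
      Algebra.smul_def]
  · rw [add_mul, map_add, h, h', map_add, add_mul, add_mul, smul_add]
    abel
  · rw [mul_assoc, ctr_ι_mul, h, ctr_ι_mul, sub_mul, mul_add, pow_succ, mul_neg_one, neg_smul,
      mul_smul_comm, smul_mul_assoc, ← mul_assoc, ← mul_assoc]
    abel

lemma ι_mul_comm (v : M) {n : ℕ} {x : ExteriorAlgebra S M} (hx : x ∈ ⋀[S]^n M) :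
    ExteriorAlgebra.ι S v * x = (-1 : S) ^ n • (x * ExteriorAlgebra.ι S v) := by
  refine exteriorPower_induction (C := fun n x => ExteriorAlgebra.ι S v * x =
    (-1 : S) ^ n • (x * ExteriorAlgebra.ι S v)) (fun s => ?_) (fun n x z h h' => ?_)
    (fun n w x _ h => ?_) n x hx
  · rw [pow_zero, one_smul, Algebra.commutes]
  · rw [mul_add, h, h', add_mul, smul_add]
  · have h1 : ExteriorAlgebra.ι S v * ExteriorAlgebra.ι S w =
        -(ExteriorAlgebra.ι S w * ExteriorAlgebra.ι S v) :=
      eq_neg_of_add_eq_zero_left (ExteriorAlgebra.ι_add_mul_swap v w)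
    rw [← mul_assoc, h1, neg_mul, mul_assoc, h, pow_succ, mul_neg_one, neg_smul, mul_smul_comm,
      mul_assoc]

lemma ctr_ιMulti (F : Module.Dual S M) (q : ℕ) (v : Fin (q + 1) → M) :
    ctr F (ExteriorAlgebra.ιMulti S (q + 1) v) =
      ∑ j : Fin (q + 1), ((-1 : S) ^ (j : ℕ) * F (v j)) •
        ExteriorAlgebra.ιMulti S q (v ∘ j.succAbove) := by
  induction q with
  | zero =>
    rw [ExteriorAlgebra.ιMulti_succ_apply, ctr_ι_mul, ExteriorAlgebra.ιMulti_zero_apply]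
    have : ctr F (1 : ExteriorAlgebra S M) = 0 := by
      rw [← map_one (algebraMap S _), ctr_algebraMap]
    simp [this]
  | succ q ih =>
    rw [ExteriorAlgebra.ιMulti_succ_apply, ctr_ι_mul, ih]
    conv_rhs => rw [Fin.sum_univ_succ]
    simp only [Fin.val_zero, pow_zero, one_mul, sub_eq_add_neg]
    congr 1
    rw [Finset.mul_sum, ← Finset.sum_neg_distrib]
    refine Finset.sum_congr rfl fun j _ => ?_
    rw [ExteriorAlgebra.ιMulti_succ_apply, Fin.val_succ, pow_succ, mul_neg_one, neg_mul, neg_smul,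
      mul_smul_comm]
    have h1 : vecTail (v ∘ j.succ.succAbove) = vecTail v ∘ j.succAbove := by
      ext i
      simp [Matrix.vecTail]
    rw [h1]
    rfl

end Contraction

section Star

variable {S : Type} [CommRing S] {t : ℕ}

/-- The exterior algebra of a standard free module. -/
abbrev EA (S : Type) [CommRing S] (t : ℕ) : Type := ExteriorAlgebra S (Fin t → S)

/-- A product of standard basis vectors. -/
def eJ (S : Type) [CommRing S] {t q : ℕ} (J : Fin q → Fin t) : EA S t :=
  ExteriorAlgebra.ιMulti S q fun l => Pi.single (J l) 1

/-- The functional given by the dot product. -/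
def dotF (u : Fin t → S) : Module.Dual S (Fin t → S) := dotProductEquiv S (Fin t) u

lemma dotF_apply (u v : Fin t → S) : dotF u v = u ⬝ᵥ v := rfl

lemma ctr_add (F G : Module.Dual S (Fin t → S)) (x : EA S t) :
    ctr (F + G) x = ctr F x + ctr G x := by
  simp [ctr]

lemma ctr_smul (s : S) (F : Module.Dual S (Fin t → S)) (x : EA S t) :
    ctr (s • F) x = s • ctr F x := by
  simp [ctr]

/-- The homogeneous elements are combinations of products of standard basis vectors. -/
lemma exists_eq_sum_eJ {q : ℕ} {x : EA S t} (hx : x ∈ ⋀[S]^q (Fin t → S)) :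
    ∃ a : (Fin q → Fin t) → S, x = ∑ J, a J • eJ S J := by
  have key : ⋀[S]^q (Fin t → S) ≤ Submodule.span S (Set.range (eJ S (t := t) (q := q))) := by
    intro x hx
    refine exteriorPower_induction (C := fun q x => x ∈
      Submodule.span S (Set.range (eJ S (t := t) (q := q)))) (fun s => ?_)
      (fun n x z h h' => add_mem h h') (fun n v x _ h => ?_) q x hx
    · rw [Algebra.algebraMap_eq_smul_one]
      refine Submodule.smul_mem _ _ (Submodule.subset_span ⟨Fin.elim0, ?_⟩)
      rw [eJ, ExteriorAlgebra.ιMulti_zero_apply]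
    · have hv : ExteriorAlgebra.ι S v = ∑ i, v i • ExteriorAlgebra.ι S (Pi.single i (1 : S)) := by
        conv_lhs => rw [pi_eq_sum_univ' v]
        simp [map_sum, map_smul]
      rw [hv, Finset.sum_mul]
      refine Submodule.sum_mem _ fun i _ => ?_
      rw [smul_mul_assoc]
      refine Submodule.smul_mem _ _ ?_
      have := Submodule.mem_map_of_mem (f := LinearMap.mulLeft S
        (ExteriorAlgebra.ι S (Pi.single i (1 : S) : Fin t → S))) h
      rw [Submodule.map_span] at this
      refine Submodule.span_mono ?_ this
      rintro _ ⟨_, ⟨J, rfl⟩, rfl⟩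
      refine ⟨Fin.cons i J, ?_⟩
      rw [eJ, ExteriorAlgebra.ιMulti_succ_apply]
      rfl
  obtain ⟨a, ha⟩ := (Submodule.mem_span_range_iff_exists_fun S).1 (key hx)
  exact ⟨a, ha.symm⟩

lemma eJ_mem {q : ℕ} (J : Fin q → Fin t) : eJ S J ∈ ⋀[S]^q (Fin t → S) :=
  ExteriorAlgebra.ιMulti_range S q ⟨_, rfl⟩

/-- Iterated contraction. -/
def cit : (q : ℕ) → (Fin q → Fin t → S) → EA S t →ₗ[S] EA S t
  | 0, _ => LinearMap.id
  | q + 1, u => cit q (fun i => u i.succ) ∘ₗ ctr (dotF (u 0))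

lemma cit_succ (q : ℕ) (u : Fin (q + 1) → Fin t → S) (x : EA S t) :
    cit (q + 1) u x = cit q (fun i => u i.succ) (ctr (dotF (u 0)) x) := rfl

lemma cit_ιMulti (q : ℕ) (u v : Fin q → Fin t → S) :
    cit q u (ExteriorAlgebra.ιMulti S q v) =
      algebraMap S _ (Matrix.of fun i j => u i ⬝ᵥ v j).det := by
  induction q with
  | zero => simp [cit]
  | succ q ih =>
    rw [cit_succ, ctr_ιMulti, map_sum, det_succ_row_zero, map_sum]
    refine Finset.sum_congr rfl fun j _ => ?_
    rw [map_smul, ih, Algebra.smul_def, ← map_mul]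
    rfl

lemma cit_eJ (q : ℕ) (u : Fin q → Fin t → S) (J : Fin q → Fin t) :
    cit q u (eJ S J) = algebraMap S _ (Matrix.of fun i j => u i (J j)).det := by
  rw [eJ, cit_ιMulti]
  simp

lemma algebraMap_det_eq {q : ℕ} (u : Fin q → Fin t → S) {x : EA S t}
    (a : (Fin q → Fin t) → S) (hx : x = ∑ J, a J • eJ S J) :
    cit q u x = algebraMap S _ (∑ J, a J * (Matrix.of fun i j => u i (J j)).det) := by
  rw [hx, map_sum, map_sum]
  refine Finset.sum_congr rfl fun J _ => ?_
  rw [map_smul, cit_eJ, Algebra.smul_def, ← map_mul]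

variable (S t) in
/-- The volume element. -/
def vol : EA S t := eJ S (id : Fin t → Fin t)

/-- The action of the exterior algebra on itself by contractions. -/
def actE : EA S t →ₐ[S] Module.End S (EA S t) :=
  ExteriorAlgebra.lift S ⟨
    { toFun := fun v => ctr (dotF v)
      map_add' := fun v w => LinearMap.ext fun x => by
        rw [dotF, map_add]; exact ctr_add _ _ _
      map_smul' := fun s w => LinearMap.ext fun x => by
        rw [dotF, map_smul]; exact ctr_smul _ _ _ }, fun v => LinearMap.ext fun x => ctr_ctr _ x⟩

/-- The star operator. -/
def star : EA S t →ₗ[S] EA S t := (LinearMap.applyₗ (vol S t)) ∘ₗ actE.toLinearMap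

lemma star_ι_mul (v : Fin t → S) (x : EA S t) :
    star (ExteriorAlgebra.ι S v * x) = ctr (dotF v) (star x) := by
  change actE _ _ = _
  rw [map_mul, actE, ExteriorAlgebra.lift_ι_apply]
  rfl

lemma star_algebraMap (s : S) : star (algebraMap S (EA S t) s) = s • vol S t := by
  change actE _ _ = _
  rw [AlgHom.commutes]
  rfl

lemma star_mem {q : ℕ} {x : EA S t} (hx : x ∈ ⋀[S]^q (Fin t → S)) :
    star x ∈ ⋀[S]^(t - q) (Fin t → S) := by
  refine exteriorPower_induction (C := fun q x => star x ∈ ⋀[S]^(t - q) (Fin t → S))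
    (fun s => ?_) (fun n x z h h' => ?_) (fun n v x _ h => ?_) q x hx
  · rw [star_algebraMap]
    exact Submodule.smul_mem _ _ (eJ_mem _)
  · rw [map_add]
    exact add_mem h h'
  · rw [star_ι_mul, ← Nat.sub_sub]
    exact (ctr_mem _ _ _ h).1

lemma ι_mul_vol (v : Fin t → S) : ExteriorAlgebra.ι S v * vol S t = 0 := by
  have h1 := exteriorPower_succ_eq_zero (Pi.basisFun S (Fin t))
    (wedgeL v t ⟨vol S t, eJ_mem _⟩)
  exact congrArg Subtype.val h1

lemma star_ctr (v : Fin t → S) (x : EA S t) :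
    star (ctr (dotF v) x) = ExteriorAlgebra.ι S v * star x := by
  induction x using CliffordAlgebra.left_induction with
  | algebraMap s =>
    change star (ctr (dotF v) (algebraMap S _ s)) = _ * star (algebraMap S (EA S t) s)
    rw [ctr_algebraMap, map_zero, star_algebraMap, mul_smul_comm, ι_mul_vol, smul_zero]
  | add x y hx hy => simp only [map_add, hx, hy, mul_add]
  | ι_mul x u hx =>
    change star (ctr (dotF v) (ExteriorAlgebra.ι S u * x)) =
      _ * star (ExteriorAlgebra.ι S u * x)
    have h1 := ctr_ι_mul (dotF u) v (star x)
    rw [ctr_ι_mul, map_sub, map_smul, star_ι_mul, hx, star_ι_mul, h1, dotF_apply, dotF_apply,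
      dotProduct_comm u v, sub_sub_cancel]

lemma star_star (x : EA S t) : star (star x) = x * star (vol S t) := by
  induction x using CliffordAlgebra.left_induction with
  | algebraMap s =>
    change star (star (algebraMap S (EA S t) s)) = algebraMap S (EA S t) s * _
    rw [star_algebraMap, map_smul, Algebra.smul_def]
  | add x y hx hy => simp only [map_add, hx, hy, add_mul]
  | ι_mul x u hx =>
    change star (star (ExteriorAlgebra.ι S u * x)) = ExteriorAlgebra.ι S u * x * _
    rw [star_ι_mul, star_ctr, hx, mul_assoc]

lemma cit_star (q : ℕ) (u : Fin q → Fin t → S) (x : EA S t) :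
    cit q u (star x) =
      star ((List.ofFn fun i => ExteriorAlgebra.ι S (u i)).reverse.prod * x) := by
  induction q generalizing x with
  | zero => simp [cit]
  | succ q ih =>
    rw [cit_succ, ← star_ι_mul, ih, List.ofFn_succ, List.reverse_cons, List.prod_append,
      List.prod_singleton, mul_assoc]

lemma exists_star_vol : ∃ δ : S, δ * δ = 1 ∧ star (vol S t) = algebraMap S _ δ := by
  have h1 := cit_star t (fun i => Pi.single i.rev (1 : S)) (1 : EA S t)
  have h2 : star (1 : EA S t) = vol S t := by
    rw [← map_one (algebraMap S _), star_algebraMap, one_smul]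
  have h3 : (List.ofFn fun i : Fin t => ExteriorAlgebra.ι S (Pi.single i.rev (1 : S) :
      Fin t → S)).reverse = List.ofFn fun i : Fin t => ExteriorAlgebra.ι S (Pi.single i (1 : S) :
      Fin t → S) := by
    refine List.ext_getElem (by simp) fun i _ _ => ?_
    simp only [List.getElem_reverse, List.getElem_ofFn, List.length_ofFn]
    congr 2
    ext
    simp only [Fin.val_rev]
    simp only [List.length_ofFn] at *
    omega
  rw [h2, vol, cit_eJ, mul_one, h3] at h1
  refine ⟨_, ?_, (h1.trans ?_).symm⟩
  · rw [← det_mul]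
    convert det_one (n := Fin t) (R := S)
    ext i j
    simp only [id, mul_apply, of_apply, Pi.single_apply, one_apply]
    rw [Finset.sum_eq_single i.rev (by intros; simp_all) (by simp)]
    simp [eq_comm]
  · rw [vol, eJ, ExteriorAlgebra.ιMulti_apply]
    rfl

end Star

section Polarization

variable {S : Type} [CommRing S] {t : ℕ}

/-- Polynomials in auxiliary vectors indexed by the natural numbers. -/
abbrev PB (S : Type) [CommRing S] (t : ℕ) : Type := MvPolynomial (Fin t × ℕ) S

/-- The exterior algebra with coefficients in the auxiliary polynomial ring. -/
abbrev PA (S : Type) [CommRing S] (t : ℕ) : Type := PB S t ⊗[S] EA S t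

/-- A standard basis vector. -/
abbrev eV (S : Type) [CommRing S] {t : ℕ} (i : Fin t) : Fin t → S := Pi.single i 1

/-- Contraction by a vector with polynomial entries. -/
def cB (u : Fin t → PB S t) : PA S t →ₗ[S] PA S t :=
  ∑ i, TensorProduct.map (LinearMap.mulLeft S (u i)) (ctr (dotF (eV S i)))

lemma cB_tmul (u : Fin t → PB S t) (b : PB S t) (x : EA S t) :
    cB u (b ⊗ₜ[S] x) = ∑ i, (u i * b) ⊗ₜ[S] ctr (dotF (eV S i)) x := by
  simp [cB, LinearMap.sum_apply]

/-- Contraction by a standard basis vector. -/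
def cE (i : Fin t) : PA S t →ₗ[S] PA S t :=
  TensorProduct.map LinearMap.id (ctr (dotF (eV S i)))

/-- The partial derivative of the coefficients. -/
def dB (i : Fin t) (s : ℕ) : PA S t →ₗ[S] PA S t :=
  TensorProduct.map (MvPolynomial.pderiv (i, s)).toLinearMap LinearMap.id

/-- Exterior multiplication by a standard basis vector. -/
def mE (i : Fin t) : PA S t →ₗ[S] PA S t :=
  TensorProduct.map LinearMap.id (LinearMap.mulLeft S (ExteriorAlgebra.ι S (eV S i)))

@[simp] lemma cE_tmul (i : Fin t) (b : PB S t) (x : EA S t) :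
    cE i (b ⊗ₜ[S] x) = b ⊗ₜ[S] ctr (dotF (eV S i)) x := rfl

@[simp] lemma dB_tmul (i : Fin t) (s : ℕ) (b : PB S t) (x : EA S t) :
    dB i s (b ⊗ₜ[S] x) = MvPolynomial.pderiv (i, s) b ⊗ₜ[S] x := rfl

@[simp] lemma mE_tmul (i : Fin t) (b : PB S t) (x : EA S t) :
    mE i (b ⊗ₜ[S] x) = b ⊗ₜ[S] (ExteriorAlgebra.ι S (eV S i) * x) := rfl

/-- The polarization operator. -/
def pol (s : ℕ) : PA S t →ₗ[S] PA S t := ∑ i, mE i ∘ₗ dB i s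

lemma pol_apply (s : ℕ) (x : PA S t) : pol s x = ∑ i, mE i (dB i s x) := by
  simp [pol, LinearMap.sum_apply]

/-- The elements whose exterior part is homogeneous. -/
def PG (S : Type) [CommRing S] (t q : ℕ) : Submodule S (PA S t) :=
  LinearMap.range (LinearMap.lTensor (PB S t) (⋀[S]^q (Fin t → S)).subtype)

lemma tmul_mem_PG {q : ℕ} (b : PB S t) {x : EA S t} (hx : x ∈ ⋀[S]^q (Fin t → S)) :
    b ⊗ₜ[S] x ∈ PG S t q := ⟨b ⊗ₜ ⟨x, hx⟩, rfl⟩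

lemma PG_induction {q : ℕ} {C : PA S t → Prop}
    (tmul : ∀ b : PB S t, ∀ x ∈ ⋀[S]^q (Fin t → S), C (b ⊗ₜ x))
    (zero : C 0) (add : ∀ x y, C x → C y → C (x + y)) {x : PA S t} (hx : x ∈ PG S t q) : C x := by
  obtain ⟨z, rfl⟩ := hx
  induction z using TensorProduct.induction_on with
  | zero => rwa [map_zero]
  | tmul b x => exact tmul b x x.2
  | add x y h h' => rw [map_add]; exact add _ _ h h'

lemma cB_mem_PG {q : ℕ} (u : Fin t → PB S t) {x : PA S t} (hx : x ∈ PG S t q) :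
    cB u x ∈ PG S t (q - 1) := by
  refine PG_induction (C := fun x => cB u x ∈ PG S t (q - 1)) (fun b x hx => ?_) (by simp)
    (fun x y h h' => ?_) hx
  · rw [cB_tmul]
    exact Submodule.sum_mem _ fun i _ => tmul_mem_PG _ (ctr_mem _ _ _ hx).1
  · rw [map_add]
    exact add_mem h h'

lemma sum_ι_mul_ctr {q : ℕ} {x : EA S t} (hx : x ∈ ⋀[S]^q (Fin t → S)) :
    ∑ i, ExteriorAlgebra.ι S (eV S i) * ctr (dotF (eV S i)) x = (q : S) • x := by
  refine exteriorPower_induction (C := fun q x => ∑ i, ExteriorAlgebra.ι S (eV S i) *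
    ctr (dotF (eV S i)) x = (q : S) • x) (fun s => ?_) (fun n x z h h' => ?_)
    (fun n v x _ h => ?_) q x hx
  · simp [ctr_algebraMap]
  · simp only [map_add, mul_add, Finset.sum_add_distrib, h, h', smul_add]
  · have h1 : ∀ i : Fin t, ExteriorAlgebra.ι S (eV S i) *
        ctr (dotF (eV S i)) (ExteriorAlgebra.ι S v * x) =
        v i • (ExteriorAlgebra.ι S (eV S i) * x) +
        ExteriorAlgebra.ι S v * (ExteriorAlgebra.ι S (eV S i) * ctr (dotF (eV S i)) x) := by
      intro i
      have h2 : ExteriorAlgebra.ι S (eV S i) * ExteriorAlgebra.ι S v =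
          -(ExteriorAlgebra.ι S v * ExteriorAlgebra.ι S (eV S i)) :=
        eq_neg_of_add_eq_zero_left (ExteriorAlgebra.ι_add_mul_swap _ v)
      rw [ctr_ι_mul, mul_sub, ← mul_assoc, h2, dotF_apply, single_one_dotProduct, mul_smul_comm,
        neg_mul, sub_neg_eq_add, mul_assoc]
    have hv : ExteriorAlgebra.ι S v = ∑ i, v i • ExteriorAlgebra.ι S (eV S i) := by
      conv_lhs => rw [pi_eq_sum_univ' v]
      simp [map_sum, map_smul, eV]
    simp only [h1, Finset.sum_add_distrib, ← Finset.mul_sum, h, ← smul_mul_assoc]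
    rw [← Finset.sum_mul, ← hv, Nat.cast_succ, add_smul, one_smul, add_comm, mul_smul_comm,
      add_mul, smul_mul_assoc]

lemma sum_mE_cE {q : ℕ} {x : PA S t} (hx : x ∈ PG S t q) :
    ∑ i, mE i (cE i x) = (q : S) • x := by
  refine PG_induction (C := fun x => ∑ i, mE i (cE i x) = (q : S) • x) (fun b x hx => ?_)
    (by simp) (fun x y h h' => ?_) hx
  · simp only [cE_tmul, mE_tmul, ← TensorProduct.tmul_sum, sum_ι_mul_ctr hx,
      TensorProduct.tmul_smul]
  · simp only [map_add, Finset.sum_add_distrib, h, h', smul_add]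

lemma cE_cB (i : Fin t) (u : Fin t → PB S t) (x : PA S t) : cE i (cB u x) = -cB u (cE i x) := by
  induction x using TensorProduct.induction_on with
  | zero => simp
  | tmul b x =>
    simp only [cB_tmul, map_sum, cE_tmul, ← Finset.sum_neg_distrib, ← TensorProduct.tmul_neg]
    exact Finset.sum_congr rfl fun j _ => by rw [ctr_comm]
  | add x y h h' => rw [map_add, map_add, h, h', map_add, map_add]; abel

lemma dB_cB (i : Fin t) (s : ℕ) (u : Fin t → PB S t) (x : PA S t) :
    dB i s (cB u x) = cB (fun j => MvPolynomial.pderiv (i, s) (u j)) x + cB u (dB i s x) := by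
  induction x using TensorProduct.induction_on with
  | zero => simp
  | tmul b x =>
    simp only [cB_tmul, map_sum, dB_tmul, ← Finset.sum_add_distrib, ← TensorProduct.add_tmul]
    refine Finset.sum_congr rfl fun j _ => ?_
    rw [Derivation.leibniz, smul_eq_mul, smul_eq_mul, mul_comm b, add_comm]
  | add x y h h' => simp only [map_add, h, h']; abel

lemma cB_zero (x : PA S t) : cB (fun _ => 0) x = 0 := by simp [cB]

lemma cB_single (i : Fin t) (x : PA S t) :
    cB (fun j => if j = i then 1 else 0) x = cE i x := by
  rw [cB, LinearMap.sum_apply, Finset.sum_eq_single i]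
  · rw [if_pos rfl, cE, LinearMap.mulLeft_one]
  · intro j _ hj
    simp [hj]
  · simp

variable (S t) in
/-- The auxiliary vectors. -/
def wB (s : ℕ) : Fin t → PB S t := fun i => MvPolynomial.X (i, s)

lemma dB_cB_wB (i : Fin t) (s s' : ℕ) (x : PA S t) :
    dB i s (cB (wB S t s') x) = (if s' = s then cE i x else 0) + cB (wB S t s') (dB i s x) := by
  rw [dB_cB]
  congr 1
  split_ifs with h
  · rw [← cB_single]
    congr 1
    congr 1
    ext1 j
    rw [wB, MvPolynomial.pderiv_X, h, Pi.single_apply]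
    simp [Prod.ext_iff]
  · rw [← cB_zero x]
    congr 1
    congr 1
    ext1 j
    rw [wB, MvPolynomial.pderiv_X, Pi.single_apply]
    simp [Prod.ext_iff, h]

lemma dB_cB_C (i : Fin t) (s : ℕ) (u : Fin t → S) (x : PA S t) :
    dB i s (cB (fun j => MvPolynomial.C (u j)) x) =
      cB (fun j => MvPolynomial.C (u j)) (dB i s x) := by
  rw [dB_cB]
  simp only [MvPolynomial.pderiv_C, cB_zero, zero_add]

variable {m : ℕ} (y : Fin m → Fin t → S)

/-- The given vectors together with the auxiliary ones. -/
def colB : Fin m ⊕ ℕ → Fin t → PB S t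
  | Sum.inl j => fun i => MvPolynomial.C (y j i)
  | Sum.inr s => wB S t s

/-- The iterated contractions of the homogeneous elements of degree `q`. -/
def PX (q : ℕ) : ℕ → Submodule S (PA S t)
  | 0 => Submodule.map (TensorProduct.mk S (PB S t) (EA S t) 1) (⋀[S]^q (Fin t → S))
  | k + 1 => ⨆ j, Submodule.map (cB (colB y j)) (PX q k)

variable {y}

lemma PX_succ_induction {q k : ℕ} {C : PA S t → Prop}
    (con : ∀ j, ∀ x ∈ PX y q k, C (cB (colB y j) x))
    (zero : C 0) (add : ∀ x z, C x → C z → C (x + z)) {x : PA S t} (hx : x ∈ PX y q (k + 1)) :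
    C x := by
  refine Submodule.iSup_induction _ (motive := C) hx (fun j z hz => ?_) zero add
  obtain ⟨x, hx, rfl⟩ := hz
  exact con j x hx

lemma cB_mem_PX {q k : ℕ} (j : Fin m ⊕ ℕ) {x : PA S t} (hx : x ∈ PX y q k) :
    cB (colB y j) x ∈ PX y q (k + 1) :=
  Submodule.mem_iSup_of_mem j ⟨x, hx, rfl⟩

lemma PX_le_PG (q k : ℕ) : PX y q k ≤ PG S t (q - k) := by
  induction k with
  | zero =>
    rintro _ ⟨x, hx, rfl⟩
    exact tmul_mem_PG 1 hx
  | succ k ih =>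
    intro x hx
    refine PX_succ_induction (fun j z hz => ?_) (zero_mem _) (fun _ _ => add_mem) hx
    rw [← Nat.sub_sub]
    exact cB_mem_PG _ (ih hz)

lemma dB_eq_zero_of_mem_PX {q : ℕ} {x : PA S t} (hx : x ∈ PX y q 0) (i : Fin t) (s : ℕ) :
    dB i s x = 0 := by
  obtain ⟨x, hx, rfl⟩ := hx
  simp [TensorProduct.mk_apply]

lemma exists_dB_eq_cE {q k : ℕ} (s : ℕ) {x : PA S t} (hx : x ∈ PX y q (k + 1)) :
    ∃ z ∈ PX y q k, ∀ i, dB i s x = cE i z := by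
  induction k generalizing x with
  | zero =>
    refine PX_succ_induction (C := fun x => ∃ z ∈ PX y q 0, ∀ i, dB i s x = cE i z)
      (fun j z hz => ?_) ⟨0, zero_mem _, by simp⟩ ?_ hx
    · rcases j with j | s'
      · refine ⟨0, zero_mem _, fun i => ?_⟩
        rw [colB, dB_cB_C, dB_eq_zero_of_mem_PX hz, map_zero, map_zero]
      · refine ⟨if s' = s then z else 0, ?_, fun i => ?_⟩
        · split_ifs
          exacts [hz, zero_mem _]
        · rw [colB, dB_cB_wB, dB_eq_zero_of_mem_PX hz, map_zero, add_zero]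
          split_ifs
          exacts [rfl, (map_zero _).symm]
    · rintro x z ⟨x', hx', h⟩ ⟨z', hz', h'⟩
      exact ⟨x' + z', add_mem hx' hz', fun i => by rw [map_add, map_add, h, h']⟩
  | succ k ih =>
    refine PX_succ_induction (C := fun x => ∃ z ∈ PX y q (k + 1), ∀ i, dB i s x = cE i z)
      (fun j z hz => ?_) ⟨0, zero_mem _, by simp⟩ ?_ hx
    · obtain ⟨z', hz', h⟩ := ih hz
      rcases j with j | s'
      · refine ⟨-cB (colB y (Sum.inl j)) z', neg_mem (cB_mem_PX _ hz'), fun i => ?_⟩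
        rw [colB, dB_cB_C, h, map_neg, cE_cB, neg_neg]
      · refine ⟨(if s' = s then z else 0) - cB (colB y (Sum.inr s')) z',
          sub_mem ?_ (cB_mem_PX _ hz'), fun i => ?_⟩
        · split_ifs
          exacts [hz, zero_mem _]
        · rw [colB, dB_cB_wB, h, map_sub, cE_cB, sub_neg_eq_add]
          split_ifs
          exacts [rfl, by rw [map_zero]]
    · rintro x z ⟨x', hx', h⟩ ⟨z', hz', h'⟩
      exact ⟨x' + z', add_mem hx' hz', fun i => by rw [map_add, map_add, h, h']⟩

variable (y) in
/-- The products of homogeneous elements and iterated contractions with a given defect. -/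
def PQ (q d : ℕ) : Submodule S (PA S t) :=
  Submodule.span S {z | ∃ (j k : ℕ) (b : PB S t) (x : EA S t) (x' : PA S t), d + k = j + q ∧
    x ∈ ⋀[S]^j (Fin t → S) ∧ x' ∈ PX y q k ∧ z = b ⊗ₜ[S] x * x'}

lemma dB_mul (i : Fin t) (s : ℕ) (b : PB S t) (x : EA S t) (z : PA S t) :
    dB i s (b ⊗ₜ[S] x * z) =
      (MvPolynomial.pderiv (i, s) b) ⊗ₜ[S] x * z + b ⊗ₜ[S] x * dB i s z := by
  induction z using TensorProduct.induction_on with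
  | zero => simp
  | tmul b' x' =>
    simp only [Algebra.TensorProduct.tmul_mul_tmul, dB_tmul, ← TensorProduct.add_tmul]
    rw [Derivation.leibniz, smul_eq_mul, smul_eq_mul, mul_comm b', add_comm]
  | add x y h h' => simp only [mul_add, map_add, h, h']; abel

lemma mE_mul (i : Fin t) (b : PB S t) (x : EA S t) (z : PA S t) :
    mE i (b ⊗ₜ[S] x * z) = b ⊗ₜ[S] (ExteriorAlgebra.ι S (eV S i) * x) * z := by
  induction z using TensorProduct.induction_on with
  | zero => simp
  | tmul b' x' =>
    simp only [Algebra.TensorProduct.tmul_mul_tmul, mE_tmul, mul_assoc]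
  | add x y h h' => simp only [mul_add, map_add, h, h']

lemma mE_mul_comm (i : Fin t) (b : PB S t) {j : ℕ} {x : EA S t} (hx : x ∈ ⋀[S]^j (Fin t → S))
    (z : PA S t) :
    mE i (b ⊗ₜ[S] x * z) = (-1 : S) ^ j • (b ⊗ₜ[S] x * mE i z) := by
  induction z using TensorProduct.induction_on with
  | zero => simp
  | tmul b' x' =>
    simp only [Algebra.TensorProduct.tmul_mul_tmul, mE_tmul, ← mul_assoc, ι_mul_comm _ hx,
      smul_mul_assoc, TensorProduct.tmul_smul]
  | add x y h h' => simp only [mul_add, map_add, h, h', smul_add]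

lemma pol_mem_PQ {q d : ℕ} (s : ℕ) {x : PA S t} (hx : x ∈ PQ y q d) :
    pol s x ∈ PQ y q (d + 1) := by
  induction hx using Submodule.span_induction with
  | zero => rw [map_zero]; exact zero_mem _
  | add x z _ _ h h' => rw [map_add]; exact add_mem h h'
  | smul c x _ h => rw [map_smul]; exact Submodule.smul_mem _ _ h
  | mem x h =>
    obtain ⟨j, k, b, x, x', hd, hx, hx', rfl⟩ := h
    simp only [pol_apply, dB_mul, map_add, Finset.sum_add_distrib]
    refine add_mem (Submodule.sum_mem _ fun i _ => ?_) ?_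
    · rw [mE_mul]
      exact Submodule.subset_span ⟨j + 1, k, _, _, x', by omega, ι_mul_mem _ _ hx, hx', rfl⟩
    · simp only [mE_mul_comm _ _ hx, ← Finset.smul_sum, ← Finset.mul_sum]
      refine Submodule.smul_mem _ _ ?_
      cases k with
      | zero => simp [dB_eq_zero_of_mem_PX hx']
      | succ k =>
        obtain ⟨z, hz, h⟩ := exists_dB_eq_cE s hx'
        simp only [h]
        rw [sum_mE_cE (PX_le_PG _ _ hz), mul_smul_comm]
        exact Submodule.smul_mem _ _ (Submodule.subset_span
          ⟨j, k, b, x, z, by omega, hx, hz, rfl⟩)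

end Polarization

section Polarization

variable {S : Type} [CommRing S] {t m : ℕ} {y : Fin m → Fin t → S}

/-- Iterated contraction by vectors with polynomial entries. -/
def citB : (q : ℕ) → (Fin q → Fin t → PB S t) → PA S t →ₗ[S] PA S t
  | 0, _ => LinearMap.id
  | q + 1, u => citB q (fun i => u i.succ) ∘ₗ cB (u 0)

lemma citB_succ (q : ℕ) (u : Fin (q + 1) → Fin t → PB S t) (x : PA S t) :
    citB (q + 1) u x = citB q (fun i => u i.succ) (cB (u 0) x) := rfl

lemma cB_tmul_eJ {q : ℕ} (u : Fin t → PB S t) (b : PB S t) (J : Fin (q + 1) → Fin t) :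
    cB u (b ⊗ₜ[S] eJ S J) =
      ∑ j : Fin (q + 1), ((-1) ^ (j : ℕ) * u (J j) * b) ⊗ₜ[S] eJ S (J ∘ j.succAbove) := by
  simp only [cB_tmul, eJ, ctr_ιMulti, TensorProduct.tmul_sum]
  rw [Finset.sum_comm]
  refine Finset.sum_congr rfl fun j _ => ?_
  rw [Finset.sum_eq_single (J j)]
  · rw [dotF_apply, single_one_dotProduct, Pi.single_eq_same, mul_one, TensorProduct.tmul_smul,
      TensorProduct.smul_tmul', MvPolynomial.smul_eq_C_mul, map_pow, map_neg, map_one, ← mul_assoc]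
    rfl
  · intro i _ hi
    rw [dotF_apply, single_one_dotProduct, Pi.single_eq_of_ne hi, mul_zero, zero_smul,
      TensorProduct.tmul_zero]
  · simp

lemma citB_eJ (q : ℕ) (u : Fin q → Fin t → PB S t) (b : PB S t) (J : Fin q → Fin t) :
    citB q u (b ⊗ₜ[S] eJ S J) = ((Matrix.of fun i j => u i (J j)).det * b) ⊗ₜ[S] 1 := by
  induction q generalizing b with
  | zero =>
    rw [det_fin_zero, one_mul, eJ, ExteriorAlgebra.ιMulti_zero_apply]
    rfl
  | succ q ih =>
    rw [citB_succ, cB_tmul_eJ, map_sum, det_succ_row_zero, Finset.sum_mul, TensorProduct.sum_tmul]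
    refine Finset.sum_congr rfl fun j _ => ?_
    rw [ih]
    congr 1
    simp only [of_apply]
    change (Matrix.of fun i j' => u i.succ (J (j.succAbove j'))).det * _ =
      _ * (Matrix.of fun i j' => u i.succ (J (j.succAbove j'))).det * b
    ring

lemma citB_mem_PX {q k : ℕ} (l : ℕ) (κ : Fin l → Fin m ⊕ ℕ) {x : PA S t} (hx : x ∈ PX y q k) :
    citB l (fun i => colB y (κ i)) x ∈ PX y q (k + l) := by
  induction l generalizing x k with
  | zero => exact hx
  | succ l ih =>
    rw [citB_succ]
    have h := ih (fun i => κ i.succ) (cB_mem_PX (κ 0) hx)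
    rwa [Nat.add_assoc, Nat.add_comm 1] at h

lemma mem_PQ_of_citB_mem (hS : ∀ n : ℕ, IsUnit ((n + 1 : ℕ) : S)) {Q d q : ℕ} (a : ℕ) {x : PA S t}
    (hx : x ∈ PG S t q) (hd : ∀ s, a ≤ s → ∀ i, dB i s x = 0)
    (h : citB q (fun i => wB S t (a + i)) x ∈ PQ y Q d) : x ∈ PQ y Q (d + q) := by
  induction q generalizing a x with
  | zero => exact h
  | succ q ih =>
    have h1 : cB (wB S t a) x ∈ PQ y Q (d + q) := by
      have hx' : cB (wB S t a) x ∈ PG S t q := by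
        have h' := cB_mem_PG (wB S t a) hx
        rwa [Nat.add_sub_cancel] at h'
      refine ih (a + 1) hx' (fun s hs i => ?_) ?_
      · rw [dB_cB_wB, hd s (by omega), map_zero, if_neg (by omega), add_zero]
      · have e : (fun i : Fin q => wB S t (a + 1 + i)) = fun i => wB S t (a + (i.succ : ℕ)) :=
          funext fun i => congrArg (wB S t) (by rw [Fin.val_succ]; omega)
        have h' : citB q (fun i => wB S t (a + (i.succ : ℕ))) (cB (wB S t a) x) ∈ PQ y Q d := h
        rwa [e]
    have h2 := pol_mem_PQ a h1
    have h3 : pol a (cB (wB S t a) x) = ((q + 1 : ℕ) : S) • x := by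
      rw [pol_apply, ← sum_mE_cE hx]
      refine Finset.sum_congr rfl fun i _ => ?_
      rw [dB_cB_wB, hd a le_rfl, map_zero, if_pos rfl, add_zero]
    rw [h3] at h2
    exact (Submodule.smul_mem_iff_of_isUnit _ (hS q)).1 h2

lemma tmul_one_mul_mem_PQ {q d : ℕ} (b : PB S t) {x : PA S t} (hx : x ∈ PQ y q d) :
    b ⊗ₜ[S] (1 : EA S t) * x ∈ PQ y q d := by
  induction hx using Submodule.span_induction with
  | zero => rw [mul_zero]; exact zero_mem _
  | add x z _ _ h h' => rw [mul_add]; exact add_mem h h'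
  | smul c x _ h => rw [mul_smul_comm]; exact Submodule.smul_mem _ _ h
  | mem x h =>
    obtain ⟨j, k, b', x, x', hd, hx, hx', rfl⟩ := h
    refine Submodule.subset_span ⟨j, k, b * b', x, x', hd, hx, hx', ?_⟩
    rw [← mul_assoc, Algebra.TensorProduct.tmul_mul_tmul, one_mul]

variable (y) in
/-- The ideal of minors of the given vectors together with the auxiliary ones. -/
def minB (q : ℕ) : Ideal (PB S t) :=
  Ideal.span {g | ∃ (κ : Fin q → Fin m ⊕ ℕ) (J : Fin q → Fin t),
    g = (Matrix.of fun i j => colB y (κ i) (J j)).det}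

lemma tmul_one_mem_PQ {q : ℕ} {f : PB S t} (hf : f ∈ minB y q) :
    f ⊗ₜ[S] (1 : EA S t) ∈ PQ y q 0 := by
  induction hf using Submodule.span_induction with
  | zero => rw [TensorProduct.zero_tmul]; exact zero_mem _
  | add x z _ _ h h' => rw [TensorProduct.add_tmul]; exact add_mem h h'
  | smul c x _ h =>
    have := tmul_one_mul_mem_PQ c h
    rwa [Algebra.TensorProduct.tmul_mul_tmul, one_mul] at this
  | mem x h =>
    obtain ⟨κ, J, rfl⟩ := h
    have h1 : (1 : PB S t) ⊗ₜ[S] eJ S J ∈ PX y q 0 := ⟨eJ S J, eJ_mem J, rfl⟩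
    have h2 := citB_mem_PX q κ h1
    rw [citB_eJ, mul_one] at h2
    refine Submodule.subset_span ⟨0, 0 + q, 1, 1, _, by omega, ?_, h2, ?_⟩
    · rw [ExteriorAlgebra.exteriorPower, pow_zero]
      exact Submodule.one_le.1 le_rfl
    · rw [Algebra.TensorProduct.tmul_mul_tmul, one_mul, one_mul]

/-- Iterated sums of contractions by the given vectors. -/
def PY (y : Fin m → Fin t → S) : ℕ → Submodule S (EA S t)
  | 0 => ⊤
  | k + 1 => ⨆ j, Submodule.map (ctr (dotF (y j))) (PY y k)

lemma PY_succ_induction {k : ℕ} {C : EA S t → Prop}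
    (con : ∀ j, ∀ x ∈ PY y k, C (ctr (dotF (y j)) x))
    (zero : C 0) (add : ∀ x z, C x → C z → C (x + z)) {x : EA S t} (hx : x ∈ PY y (k + 1)) :
    C x := by
  refine Submodule.iSup_induction _ (motive := C) hx (fun j z hz => ?_) zero add
  obtain ⟨x, hx, rfl⟩ := hz
  exact con j x hx

lemma ctr_mem_PY {k : ℕ} (j : Fin m) {x : EA S t} (hx : x ∈ PY y k) :
    ctr (dotF (y j)) x ∈ PY y (k + 1) :=
  Submodule.mem_iSup_of_mem j ⟨x, hx, rfl⟩

lemma mul_mem_PY_one {j k : ℕ} (hjk : j < k) {x z : EA S t} (hx : x ∈ ⋀[S]^j (Fin t → S))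
    (hz : z ∈ PY y k) : x * z ∈ PY y 1 := by
  induction k generalizing j x z with
  | zero => omega
  | succ k ih =>
    refine PY_succ_induction (C := fun z => x * z ∈ PY y 1) (fun l z hz => ?_) (by simp)
      (fun _ _ h h' => by rw [mul_add]; exact add_mem h h') hz
    have h1 := ctr_mul (dotF (y l)) hx z
    have h2 : ctr (dotF (y l)) x * z ∈ PY y 1 := by
      rcases Nat.eq_zero_or_pos j with h0 | h0
      · rw [(ctr_mem _ _ _ hx).2 h0, zero_mul]
        exact zero_mem _
      · exact ih (by omega) (ctr_mem _ _ _ hx).1 hz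
    have h3 : (-1 : S) ^ j • (x * ctr (dotF (y l)) z) ∈ PY y 1 := by
      rw [← sub_eq_iff_eq_add'.2 h1]
      exact sub_mem (ctr_mem_PY (k := 0) l trivial) h2
    rwa [Submodule.smul_mem_iff_of_isUnit _ (isUnit_one.neg.pow j)] at h3

variable (S t) in
/-- Specialization of the auxiliary vectors to zero. -/
def evB : PA S t →ₐ[S] EA S t :=
  Algebra.TensorProduct.lift ((Algebra.ofId S (EA S t)).comp (MvPolynomial.aeval 0))
    (AlgHom.id S _) fun b x => show Commute (((Algebra.ofId S (EA S t)).comp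
      (MvPolynomial.aeval 0)) b) (AlgHom.id S (EA S t) x) from
        Algebra.commutes (MvPolynomial.aeval (0 : Fin t × ℕ → S) b) x

lemma evB_tmul (b : PB S t) (x : EA S t) :
    evB S t (b ⊗ₜ[S] x) = MvPolynomial.aeval (0 : Fin t × ℕ → S) b • x := by
  rw [evB, Algebra.TensorProduct.lift_tmul, Algebra.smul_def]
  rfl

lemma evB_cB (u : Fin t → PB S t) (x : PA S t) : evB S t (cB u x) =
    ctr (dotF fun i => MvPolynomial.aeval (0 : Fin t × ℕ → S) (u i)) (evB S t x) := by
  induction x using TensorProduct.induction_on with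
  | zero => simp
  | add x y h h' => simp only [map_add, h, h']
  | tmul b x =>
    have h1 : ∀ v : Fin t → S, ctr (dotF v) x = ∑ i, v i • ctr (dotF (eV S i)) x := by
      intro v
      have h2 : dotF v = ∑ i, v i • dotF (eV S i) := by
        conv_lhs => rw [pi_eq_sum_univ' v]
        simp [dotF, map_sum, map_smul, eV]
      rw [h2]
      simp only [ctr, map_sum, map_smul, LinearMap.sum_apply, LinearMap.smul_apply]
    rw [cB_tmul, map_sum, evB_tmul, map_smul, h1, Finset.smul_sum]
    refine Finset.sum_congr rfl fun i _ => ?_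
    rw [evB_tmul, map_mul, mul_comm, mul_smul]

lemma evB_mem_PY {q k : ℕ} {x : PA S t} (hx : x ∈ PX y q k) : evB S t x ∈ PY y k := by
  induction k generalizing x with
  | zero => exact Submodule.mem_top
  | succ k ih =>
    refine PX_succ_induction (C := fun x => evB S t x ∈ PY y (k + 1)) (fun j z hz => ?_) (by simp)
      (fun _ _ h h' => by rw [map_add]; exact add_mem h h') hx
    rw [evB_cB]
    rcases j with j | s
    · have h1 := ctr_mem_PY j (ih hz)
      have h2 : (fun i => MvPolynomial.aeval (0 : Fin t × ℕ → S) (colB y (Sum.inl j) i)) = y j := by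
        ext1 i
        simp [colB]
      rwa [h2]
    · have h1 : (fun i => MvPolynomial.aeval (0 : Fin t × ℕ → S) (colB y (Sum.inr s) i)) = 0 := by
        ext1 i
        simp [colB, wB]
      rw [h1, dotF, map_zero]
      simp [ctr]

lemma evB_mem_PY_one {q d : ℕ} (hd : d < q) {x : PA S t} (hx : x ∈ PQ y q d) :
    evB S t x ∈ PY y 1 := by
  induction hx using Submodule.span_induction with
  | zero => rw [map_zero]; exact zero_mem _
  | add x z _ _ h h' => rw [map_add]; exact add_mem h h'
  | smul c x _ h => rw [map_smul]; exact Submodule.smul_mem _ _ h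
  | mem x h =>
    obtain ⟨j, k, b, x, x', hd, hx, hx', rfl⟩ := h
    rw [map_mul, evB_tmul, smul_mul_assoc]
    exact Submodule.smul_mem _ _ (mul_mem_PY_one (by omega) hx (evB_mem_PY hx'))

/-- If the polarization of the contractions of a homogeneous element is a combination of minors,
then the element is a combination of contractions. -/
lemma mem_PY_one_of_mem_minB (hS : ∀ n : ℕ, IsUnit ((n + 1 : ℕ) : S)) {q : ℕ}
    (a : (Fin q → Fin t) → S)
    (h : ∑ J, MvPolynomial.C (a J) * (Matrix.of fun i j => wB S t ((i : Fin q) : ℕ) (J j)).det ∈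
      minB y (q + 1)) : ∑ J, a J • eJ S J ∈ PY y 1 := by
  have h1 := tmul_one_mem_PQ h
  have h2 : (1 : PB S t) ⊗ₜ[S] (∑ J, a J • eJ S J) ∈ PQ y (q + 1) (0 + q) := by
    refine mem_PQ_of_citB_mem hS 0 (tmul_mem_PG _ (Submodule.sum_mem _ fun J _ =>
      Submodule.smul_mem _ _ (eJ_mem J))) (fun s _ i => by simp) ?_
    convert h1 using 1
    simp only [zero_add, TensorProduct.tmul_sum, map_sum, TensorProduct.tmul_smul, map_smul,
      TensorProduct.sum_tmul, citB_eJ]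
    refine Finset.sum_congr rfl fun J _ => ?_
    rw [TensorProduct.smul_tmul', MvPolynomial.smul_eq_C_mul, mul_one]
  have h3 := evB_mem_PY_one (by omega) h2
  rwa [evB_tmul, map_one, one_smul] at h3

end Polarization

section GenericWedge

variable {K : Type} [Field K] {r p : ℕ}

variable (K r p) in
/-- The columns of the generic matrix. -/
def yg (j : Fin (r + (p + 1))) : Fin (r + p) → GS K (r + p) (r + (p + 1)) :=
  fun i => MvPolynomial.X (i, j)

/-- The columns of an enlarged generic matrix, as given and auxiliary vectors. -/
def splitCol (r p : ℕ) (c : Fin (r + (p + 1 + r))) : Fin (r + (p + 1)) ⊕ ℕ :=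
  if h : (c : ℕ) < r + (p + 1) then Sum.inl ⟨c, h⟩ else Sum.inr (c - (r + (p + 1)))

/-- Specialization of the enlarged generic matrix. -/
def enl : GS K (r + p) (r + (p + 1 + r)) →+* PB (GS K (r + p) (r + (p + 1))) (r + p) :=
  MvPolynomial.eval₂Hom (MvPolynomial.C.comp MvPolynomial.C)
    fun ij => colB (yg K r p) (splitCol r p ij.2) ij.1

lemma enl_det {q : ℕ} (f : Fin q → Fin (r + p)) (g : Fin q → Fin (r + (p + 1 + r))) :
    enl ((gmat K (r + p) (r + (p + 1 + r))).submatrix f g).det =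
      (Matrix.of fun i j => colB (yg K r p) (splitCol r p (g i)) (f j)).det := by
  rw [RingHom.map_det, ← det_transpose]
  congr 1
  ext1 i j
  simp [enl]

lemma enl_mem_minB {q : ℕ} {x : GS K (r + p) (r + (p + 1 + r))}
    (hx : x ∈ minorIdeal K (r + p) (r + (p + 1 + r)) q) : enl x ∈ minB (yg K r p) q := by
  have h : minorIdeal K (r + p) (r + (p + 1 + r)) q ≤ (minB (yg K r p) q).comap enl := by
    rw [minorIdeal, Ideal.span_le]
    rintro _ ⟨f, g, -, rfl⟩
    rw [SetLike.mem_coe, Ideal.mem_comap, enl_det]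
    exact Ideal.subset_span ⟨fun i => splitCol r p (g i), f, rfl⟩
  exact h hx

/-- The inclusion of the generic matrix into the enlarged one. -/
def incl : GS K (r + p) (r + (p + 1)) →ₐ[K] GS K (r + p) (r + (p + 1 + r)) :=
  MvPolynomial.rename fun ij => (ij.1, Fin.castLE (by omega) ij.2)

lemma enl_incl (x : GS K (r + p) (r + (p + 1))) : enl (incl x) = MvPolynomial.C x := by
  have h : (enl (K := K) (r := r) (p := p)).comp incl.toRingHom = MvPolynomial.C := by
    refine MvPolynomial.ringHom_ext (fun s => ?_) fun ij => ?_
    · simp [enl, incl]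
    · have h1 : splitCol r p (Fin.castLE (by omega) ij.2) = Sum.inl ij.2 := by
        rw [splitCol, dif_pos (by simp)]
        rfl
      simp [enl, incl, h1, colB, yg]
  exact DFunLike.congr_fun h x

lemma incl_det {q : ℕ} (f : Fin q → Fin (r + p)) (g : Fin q → Fin (r + (p + 1))) :
    incl ((gmat K (r + p) (r + (p + 1))).submatrix f g).det =
      ((gmat K (r + p) (r + (p + 1 + r))).submatrix f
        fun i => Fin.castLE (by omega) (g i)).det := by
  rw [AlgHom.map_det]
  congr 1
  ext1 i j
  simp [incl]

lemma incl_mem {q : ℕ} {x : GS K (r + p) (r + (p + 1))}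
    (hx : x ∈ minorIdeal K (r + p) (r + (p + 1)) q) :
    incl x ∈ minorIdeal K (r + p) (r + (p + 1 + r)) q := by
  have h : minorIdeal K (r + p) (r + (p + 1)) q ≤
      (minorIdeal K (r + p) (r + (p + 1 + r)) q).comap incl := by
    rw [minorIdeal, Ideal.span_le]
    rintro _ ⟨f, g, -, rfl⟩
    rw [SetLike.mem_coe, Ideal.mem_comap, incl_det]
    exact det_mem_minorIdeal _ _
  exact h hx

/-- A homogeneous element whose full contraction by the first columns vanishes modulo the minors
is a combination of contractions by columns. -/
lemma sum_mem_PY_one [CharZero K] (a : (Fin r → Fin (r + p)) → GS K (r + p) (r + (p + 1)))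
    (h : ∑ J, a J * ((gmat K (r + p) (r + (p + 1))).submatrix J (Fin.castAdd (p + 1))).det ∈
      genIdeal K r p) : ∑ J, a J • eJ _ J ∈ PY (yg K r p) 1 := by
  have hS : ∀ n : ℕ, IsUnit ((n + 1 : ℕ) : GS K (r + p) (r + (p + 1))) := fun n => by
    have h1 : IsUnit ((n + 1 : ℕ) : K) := isUnit_iff_ne_zero.2 (Nat.cast_ne_zero.2 n.succ_ne_zero)
    simpa using h1.map (MvPolynomial.C (σ := Fin (r + p) × Fin (r + (p + 1))))
  refine mem_PY_one_of_mem_minB hS a ?_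
  let M := gmat K (r + p) (r + (p + 1 + r))
  let I := minorIdeal K (r + p) (r + (p + 1 + r)) (r + 1)
  let wc : Fin r → Fin (r + (p + 1 + r)) := fun s => ⟨r + (p + 1) + s, by omega⟩
  let yc : Fin r → Fin (r + (p + 1 + r)) := fun i => Fin.castLE (by omega) (Fin.castAdd (p + 1) i)
  have hwc : ∀ s, splitCol r p (wc s) = Sum.inr (s : ℕ) := fun s => by
    rw [splitCol, dif_neg (by simp [wc])]
    simp [wc]
  have key : ∑ J, incl (a J) * (M.submatrix J wc).det ∈ I := by
    have : Fact (r ≤ r + (p + 1 + r)) := ⟨Nat.le_add_right _ _⟩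
    have hI : I.IsPrime := minorIdeal_isPrime
    have h1 := incl_mem h
    simp only [map_sum, map_mul, incl_det] at h1
    have hΔ : (M.submatrix (Fin.castAdd p) yc).det ∉ I :=
      pivot_notMem (K := K) (finSumFinEquiv (m := r) (n := p))
        (finSumFinEquiv (m := r) (n := p + 1 + r))
    refine (hI.mem_or_mem ?_).resolve_left hΔ
    have h2 : ∑ J, incl (a J) * ((M.submatrix (Fin.castAdd p) yc).det * (M.submatrix J wc).det -
        (M.submatrix (Fin.castAdd p) wc).det * (M.submatrix J yc).det) ∈ I :=
      Ideal.sum_mem _ fun J _ => Ideal.mul_mem_left _ _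
        (pivot_mul_sub_mem (Nat.le_add_right _ _) _ _ _ _)
    have h3 := add_mem h2 (I.mul_mem_left (M.submatrix (Fin.castAdd p) wc).det h1)
    convert h3 using 1
    rw [Finset.mul_sum, Finset.mul_sum, ← Finset.sum_add_distrib]
    refine Finset.sum_congr rfl fun J _ => ?_
    simp only [yc, M]
    ring
  have h4 := enl_mem_minB key
  simp only [map_sum, map_mul, enl_incl, M, enl_det, hwc] at h4
  exact h4

end GenericWedge

section Descent

variable {S : Type} [CommRing S] {M M' N : Type} [AddCommGroup M] [Module S M]
  [AddCommGroup M'] [Module S M'] [AddCommGroup N] [Module S N] {p : ℕ}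

lemma alternating_eq_of_map_eq (f : M →ₗ[S] M') (g : M [⋀^Fin p]→ₗ[S] N)
    (hg : ∀ v i, f (v i) = 0 → g v = 0) {v v' : Fin p → M} (h : ∀ i, f (v i) = f (v' i)) :
    g v = g v' := by
  classical
  have key : ∀ s : Finset (Fin p), g (s.piecewise v' v) = g v := by
    intro s
    induction s using Finset.induction_on with
    | empty => simp
    | insert a s ha ih =>
      rw [Finset.piecewise_insert, ← ih]
      have h1 : v' a = s.piecewise v' v a + (v' a - v a) := by
        rw [Finset.piecewise_eq_of_notMem _ _ _ ha, add_sub_cancel]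
      rw [h1, g.map_update_add, Function.update_eq_self, add_eq_left]
      refine hg _ a ?_
      rw [Function.update_self, map_sub, h, sub_self]
  rw [← key Finset.univ, Finset.piecewise_univ]

/-- Descent of an alternating map along a surjection. -/
lemma exists_alternating_descent (f : M →ₗ[S] M') (hf : Function.Surjective f)
    (g : M [⋀^Fin p]→ₗ[S] N) (hg : ∀ v i, f (v i) = 0 → g v = 0) :
    ∃ g' : M' [⋀^Fin p]→ₗ[S] N, ∀ v, g' (f ∘ v) = g v := by
  let σ := Function.surjInv hf
  have hσ : ∀ x, f (σ x) = x := Function.surjInv_eq hf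
  have hupd : ∀ [DecidableEq (Fin p)] (m : Fin p → M') (i : Fin p) (x : M') (z : M), f z = x →
      g (σ ∘ Function.update m i x) = g (Function.update (σ ∘ m) i z) := by
    intro _ m i x z hz
    refine alternating_eq_of_map_eq f g hg fun j => ?_
    by_cases hj : j = i
    · subst hj
      simp [hσ, hz]
    · simp [hj]
  refine ⟨
    { toFun := fun m => g (σ ∘ m)
      map_update_add' := fun m i x z => ?_
      map_update_smul' := fun m i c x => ?_
      map_eq_zero_of_eq' := fun v i j hv hij =>
        g.map_eq_zero_of_eq _ (by simp [hv]) hij }, fun v => ?_⟩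
  · rw [hupd m i (x + z) (σ x + σ z) (by rw [map_add, hσ, hσ]), hupd m i x (σ x) (hσ x),
      hupd m i z (σ z) (hσ z), g.map_update_add]
  · rw [hupd m i (c • x) (c • σ x) (by rw [map_smul, hσ]), hupd m i x (σ x) (hσ x),
      g.map_update_smul]
  · exact alternating_eq_of_map_eq f g hg fun i => by simp [hσ]

lemma exists_exteriorPower_descent (f : M →ₗ[S] M') (hf : Function.Surjective f)
    (g : M [⋀^Fin p]→ₗ[S] N) (hg : ∀ v i, f (v i) = 0 → g v = 0) :
    ∃ g' : (⋀[S]^p M') →ₗ[S] N, ∀ v, g' (exteriorPower.ιMulti S p (f ∘ v)) = g v := by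
  obtain ⟨g', h⟩ := exists_alternating_descent f hf g hg
  exact ⟨exteriorPower.alternatingMapLinearEquiv g', fun v => by
    rw [exteriorPower.alternatingMapLinearEquiv_apply_ιMulti, h]⟩

lemma alternating_eq_zero_of_first (f : M →ₗ[S] M') (g : M [⋀^Fin (p + 1)]→ₗ[S] N)
    (hg : ∀ v, f (v 0) = 0 → g v = 0) (v : Fin (p + 1) → M) (i : Fin (p + 1)) (h : f (v i) = 0) :
    g v = 0 := by
  by_cases hi : i = 0
  · subst hi
    exact hg v h
  · have h1 := g.map_swap v hi
    rw [hg _ (by simpa using h)] at h1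
    exact neg_eq_zero.1 h1.symm

lemma nonempty_equiv_range {L : Type*} [AddCommGroup L] [Module S L] {f : L →ₗ[S] M}
    (hf : Function.Surjective f) {g : L →ₗ[S] N} (h : LinearMap.ker g = LinearMap.ker f) :
    Nonempty (M ≃ₗ[S] LinearMap.range g) :=
  ⟨((LinearMap.quotKerEquivOfSurjective f hf).symm.trans
    (Submodule.quotEquivOfEq _ _ h.symm)).trans g.quotKerEquivRange⟩

end Descent

section GenericIso

variable {K : Type} [Field K] {r p : ℕ}

local notation "Yg" => gmat K (r + p) (r + (p + 1))
local notation "Sg" => GS K (r + p) (r + (p + 1))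

variable (K r p) in
/-- The full contraction by the first columns, modulo the minors. -/
def theta : EA Sg (r + p) →ₗ[Sg] (Sg ⧸ genIdeal K r p) :=
  (genIdeal K r p).mkQ ∘ₗ (ExteriorAlgebra.algebraMapInv (R := Sg)).toLinearMap ∘ₗ
    cit r fun i => yg K r p (Fin.castAdd (p + 1) i)

lemma theta_eq_mkQ {x : EA Sg (r + p)} {s : Sg}
    (h : cit r (fun i => yg K r p (Fin.castAdd (p + 1) i)) x = algebraMap Sg _ s) :
    theta K r p x = (genIdeal K r p).mkQ s := by
  rw [theta, LinearMap.comp_apply, LinearMap.comp_apply, h]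
  congr 1
  exact ExteriorAlgebra.algebraMap_leftInverse _ s

lemma det_yg {q : ℕ} (g : Fin q → Fin (r + (p + 1))) (J : Fin q → Fin (r + p)) :
    (Matrix.of fun i j => yg K r p (g i) (J j)).det = ((Yg).submatrix J g).det := by
  rw [← det_transpose]
  rfl

lemma theta_sum (a : (Fin r → Fin (r + p)) → Sg) :
    theta K r p (∑ J, a J • eJ Sg J) = (genIdeal K r p).mkQ
      (∑ J, a J * ((Yg).submatrix J (Fin.castAdd (p + 1))).det) := by
  refine theta_eq_mkQ ((algebraMap_det_eq _ a rfl).trans ?_)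
  simp only [det_yg]

lemma theta_ctr (j : Fin (r + (p + 1))) {x : EA Sg (r + p)}
    (hx : x ∈ ⋀[Sg]^(r + 1) (Fin (r + p) → Sg)) : theta K r p (ctr (dotF (yg K r p j)) x) = 0 := by
  obtain ⟨a, ha⟩ := exists_eq_sum_eJ hx
  let g : Fin (r + 1) → Fin (r + (p + 1)) := Fin.cons j (Fin.castAdd (p + 1))
  have h := algebraMap_det_eq (fun i => yg K r p (g i)) a ha
  rw [cit_succ] at h
  refine (theta_eq_mkQ h).trans ?_
  rw [← LinearMap.mem_ker, Submodule.ker_mkQ]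
  refine Ideal.sum_mem _ fun J _ => Ideal.mul_mem_left _ _ ?_
  rw [det_yg]
  exact det_mem_minorIdeal _ _

variable (K r p) in
/-- The cokernel of the generic matrix. -/
abbrev GC : Type := (Fin (r + p) → Sg) ⧸ LinearMap.range (Yg).mulVecLin

variable (K r p) in
/-- The map from the exterior power of the free module to the quotient by the minors. -/
def psi :
    (⋀[Sg]^p (Fin (r + p) → Sg)) →ₗ[Sg] (Sg ⧸ genIdeal K r p) :=
  theta K r p ∘ₗ star ∘ₗ (⋀[Sg]^p (Fin (r + p) → Sg)).subtype

lemma theta_star_mul (v : Fin (r + (p + 1)) → Sg) {q : ℕ} (hq : q + 1 = p) {x : EA Sg (r + p)}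
    (hx : x ∈ ⋀[Sg]^q (Fin (r + p) → Sg)) :
    theta K r p (star (ExteriorAlgebra.ι Sg ((Yg).mulVec v) * x)) = 0 := by
  have h1 : (Yg).mulVec v = ∑ j, v j • yg K r p j := by
    ext1 i
    simp [mulVec, dotProduct, yg, mul_comm]
  have h2 : star x ∈ ⋀[Sg]^(r + 1) (Fin (r + p) → Sg) := by
    have := star_mem hx
    rwa [show r + p - q = r + 1 by omega] at this
  rw [h1, map_sum, Finset.sum_mul, map_sum, map_sum]
  refine Finset.sum_eq_zero fun j _ => ?_
  rw [map_smul, smul_mul_assoc, map_smul, map_smul, star_ι_mul, theta_ctr j h2, smul_zero]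

lemma range_psi : LinearMap.range (psi K r p) = colSub K r p := by
  apply le_antisymm
  · rintro _ ⟨x, rfl⟩
    have h2 : star (x : EA Sg (r + p)) ∈ ⋀[Sg]^r (Fin (r + p) → Sg) := by
      have := star_mem x.2
      rwa [Nat.add_sub_cancel] at this
    obtain ⟨a, ha⟩ := exists_eq_sum_eJ h2
    change theta K r p (star (x : EA Sg (r + p))) ∈ _
    rw [ha, theta_sum, map_sum]
    refine Submodule.sum_mem _ fun J _ => ?_
    rw [← smul_eq_mul, map_smul]
    exact Submodule.smul_mem _ _ (Submodule.subset_span ⟨J, rfl⟩)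
  · rw [colSub, Submodule.span_le]
    rintro _ ⟨J, rfl⟩
    obtain ⟨δ, hδ, hv⟩ := exists_star_vol (S := Sg) (t := r + p)
    have h2 : star (eJ Sg J) ∈ ⋀[Sg]^p (Fin (r + p) → Sg) := by
      have := star_mem (eJ_mem (S := Sg) J)
      rwa [Nat.add_sub_cancel_left] at this
    refine ⟨δ • ⟨_, h2⟩, ?_⟩
    change theta K r p (star (δ • star (eJ Sg J))) = _
    rw [map_smul, star_star, hv, ← Algebra.commutes, ← Algebra.smul_def, smul_smul, hδ, one_smul]
    refine theta_eq_mkQ ?_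
    rw [cit_eJ, det_yg]

lemma map_eq_zero_of_theta [CharZero K] {x : EA Sg (r + p)}
    (hx : x ∈ ⋀[Sg]^p (Fin (r + p) → Sg)) (h : theta K r p (star x) = 0) :
    ExteriorAlgebra.map (LinearMap.range (Yg).mulVecLin).mkQ x = 0 := by
  have h2 : star x ∈ ⋀[Sg]^r (Fin (r + p) → Sg) := by
    have := star_mem hx
    rwa [Nat.add_sub_cancel] at this
  obtain ⟨a, ha⟩ := exists_eq_sum_eJ h2
  rw [ha, theta_sum, ← LinearMap.mem_ker, Submodule.ker_mkQ] at h
  have h3 := sum_mem_PY_one a h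
  rw [← ha] at h3
  obtain ⟨δ, hδ, hv⟩ := exists_star_vol (S := Sg) (t := r + p)
  have h4 : x = δ • star (star x) := by
    rw [star_star, hv, ← Algebra.commutes, ← Algebra.smul_def, smul_smul, hδ, one_smul]
  rw [h4, map_smul]
  have h5 : ExteriorAlgebra.map (LinearMap.range (Yg).mulVecLin).mkQ (star (star x)) = 0 := by
    refine PY_succ_induction (C := fun z => ExteriorAlgebra.map
      (LinearMap.range (Yg).mulVecLin).mkQ (star z) = 0) (fun j z _ => ?_) (by simp)
      (fun z z' hz hz' => by rw [map_add, map_add, hz, hz', add_zero]) h3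
    have h6 : (LinearMap.range (Yg).mulVecLin).mkQ (yg K r p j) = 0 := by
      rw [← LinearMap.mem_ker, Submodule.ker_mkQ]
      refine ⟨Pi.single j 1, ?_⟩
      rw [mulVecLin_apply, mulVec_single_one]
      rfl
    rw [star_ctr, map_mul, ExteriorAlgebra.map_apply_ι, h6, map_zero, zero_mul]
  rw [h5, smul_zero]

lemma ker_psi [CharZero K] (hp : 0 < p) : LinearMap.ker (psi K r p) =
    LinearMap.ker (exteriorPower.map p (LinearMap.range (Yg).mulVecLin).mkQ) := by
  apply le_antisymm
  · intro x hx
    rw [LinearMap.mem_ker, ← Submodule.coe_eq_zero, coe_exteriorPower_map]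
    exact map_eq_zero_of_theta x.2 hx
  · obtain ⟨q, rfl⟩ : ∃ q, p = q + 1 := ⟨p - 1, by omega⟩
    let g : (Fin (r + (q + 1)) → GS K (r + (q + 1)) (r + (q + 1 + 1))) [⋀^Fin (q + 1)]→ₗ[
        GS K (r + (q + 1)) (r + (q + 1 + 1))] _ :=
      (psi K r (q + 1)).compAlternatingMap (exteriorPower.ιMulti _ (q + 1))
    obtain ⟨g', hg'⟩ := exists_exteriorPower_descent (LinearMap.range
      (gmat K (r + (q + 1)) (r + (q + 1 + 1))).mulVecLin).mkQ (Submodule.mkQ_surjective _) g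
        (alternating_eq_zero_of_first _ g fun v hv => by
          rw [← LinearMap.mem_ker, Submodule.ker_mkQ] at hv
          obtain ⟨w, hw⟩ := hv
          change theta K r (q + 1) (star (ExteriorAlgebra.ιMulti _ (q + 1) v)) = 0
          rw [ExteriorAlgebra.ιMulti_succ_apply, ← hw]
          exact theta_star_mul w rfl (ExteriorAlgebra.ιMulti_range _ _ ⟨_, rfl⟩))
    have h1 : g' ∘ₗ exteriorPower.map (q + 1) (LinearMap.range
        (gmat K (r + (q + 1)) (r + (q + 1 + 1))).mulVecLin).mkQ = psi K r (q + 1) := by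
      refine exteriorPower.linearMap_ext ?_
      ext1 v
      change g' (exteriorPower.map _ _ (exteriorPower.ιMulti _ _ v)) = g v
      rw [exteriorPower.map_apply_ιMulti, hg']
    rw [← h1]
    exact LinearMap.ker_le_ker_comp _ _

/-- The exterior power of the generic cokernel is the submodule of maximal contractions. -/
lemma nonempty_exteriorPower_equiv_colSub [CharZero K] (hp : 0 < p) :
    Nonempty ((⋀[Sg]^p (GC K r p)) ≃ₗ[Sg] colSub K r p) := by
  have h := nonempty_equiv_range (exteriorPower.map_surjective (Submodule.mkQ_surjective _))
    (ker_psi (K := K) (r := r) hp)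
  rwa [range_psi] at h

end GenericIso

section Presentation

variable {T : Type} [CommRing T] {t m q : ℕ}

/-- The relations of the standard presentation of the exterior power of the cokernel of a
matrix. -/
def wedgeRel (Y : Matrix (Fin t) (Fin m) T) (q : ℕ) :
    Matrix (Fin (q + 1) → Fin t)
      (((Fin (q + 1) → Fin t) × Equiv.Perm (Fin (q + 1))) ⊕ ((Fin q → Fin t) × Fin m)) T :=
  Matrix.of fun L => Sum.elim
    (fun x => (if L = x.1 ∘ x.2 then 1 else 0) -
      ((Equiv.Perm.sign x.2 : ℤ) : T) * if L = x.1 then 1 else 0)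
    (fun x => ∑ l, Y l x.2 * if L = Fin.cons l x.1 then 1 else 0)

lemma wedgeRel_map {T' : Type} [CommRing T'] (φ : T →+* T') (Y : Matrix (Fin t) (Fin m) T) :
    (wedgeRel Y q).map φ = wedgeRel (Y.map φ) q := by
  ext L x
  rcases x with x | x <;> simp [wedgeRel, apply_ite φ]

/-- The cokernel of the standard relations. -/
abbrev WedgeCoker (Y : Matrix (Fin t) (Fin m) T) (q : ℕ) : Type :=
  ((Fin (q + 1) → Fin t) → T) ⧸ LinearMap.range (wedgeRel Y q).mulVecLin

/-- The class of a generator. -/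
def wcls (Y : Matrix (Fin t) (Fin m) T) (L : Fin (q + 1) → Fin t) : WedgeCoker Y q :=
  (LinearMap.range (wedgeRel Y q).mulVecLin).mkQ (Pi.single L 1)

lemma mkQ_eq_sum_wcls (Y : Matrix (Fin t) (Fin m) T) (v : (Fin (q + 1) → Fin t) → T) :
    (LinearMap.range (wedgeRel Y q).mulVecLin).mkQ v = ∑ L, v L • wcls Y L := by
  conv_lhs => rw [pi_eq_sum_univ' v]
  simp only [map_sum, map_smul]
  refine Finset.sum_congr rfl fun L _ => ?_
  rw [wcls]

lemma sum_wedgeRel_smul_wcls (Y : Matrix (Fin t) (Fin m) T)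
    (x : ((Fin (q + 1) → Fin t) × Equiv.Perm (Fin (q + 1))) ⊕ ((Fin q → Fin t) × Fin m)) :
    ∑ L, wedgeRel Y q L x • wcls Y L = 0 := by
  rw [← mkQ_eq_sum_wcls, ← LinearMap.mem_ker, Submodule.ker_mkQ]
  exact ⟨Pi.single x 1, by rw [mulVecLin_apply, mulVec_single_one]; rfl⟩

lemma wcls_perm (Y : Matrix (Fin t) (Fin m) T) (L : Fin (q + 1) → Fin t)
    (σ : Equiv.Perm (Fin (q + 1))) :
    wcls Y (L ∘ σ) = ((Equiv.Perm.sign σ : ℤ) : T) • wcls Y L := by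
  have h := sum_wedgeRel_smul_wcls Y (Sum.inl (L, σ))
  simpa [wedgeRel, sub_smul, Finset.sum_sub_distrib, sub_eq_zero, mul_smul] using h

lemma sum_smul_wcls_cons (Y : Matrix (Fin t) (Fin m) T) (L : Fin q → Fin t) (c : Fin m) :
    ∑ l, Y l c • wcls Y (Fin.cons l L : Fin (q + 1) → Fin t) = 0 := by
  have h := sum_wedgeRel_smul_wcls Y (Sum.inr (L, c))
  simp only [wedgeRel, of_apply, Sum.elim_inr, Finset.sum_smul] at h
  rw [Finset.sum_comm] at h
  simpa using h

/-- The multilinear map sending vectors to the class of their tensor product. -/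
def wmul (Y : Matrix (Fin t) (Fin m) T) (q : ℕ) :
    MultilinearMap T (fun _ : Fin (q + 1) => Fin t → T) (WedgeCoker Y q) :=
  ∑ L : Fin (q + 1) → Fin t, ((MultilinearMap.mkPiAlgebra T (Fin (q + 1)) T).compLinearMap
    fun l => LinearMap.proj (L l)).smulRight (wcls Y L)

lemma wmul_apply (Y : Matrix (Fin t) (Fin m) T) (v : Fin (q + 1) → Fin t → T) :
    wmul Y q v = ∑ L : Fin (q + 1) → Fin t, (∏ l, v l (L l)) • wcls Y L := by
  simp [wmul]

lemma wmul_perm (Y : Matrix (Fin t) (Fin m) T) (v : Fin (q + 1) → Fin t → T)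
    (σ : Equiv.Perm (Fin (q + 1))) :
    wmul Y q (v ∘ σ) = ((Equiv.Perm.sign σ : ℤ) : T) • wmul Y q v := by
  rw [wmul_apply, wmul_apply, Finset.smul_sum,
    ← (σ.arrowCongr (Equiv.refl (Fin t))).symm.sum_comp]
  refine Finset.sum_congr rfl fun L _ => ?_
  have h1 : (σ.arrowCongr (Equiv.refl (Fin t))).symm L = L ∘ σ := rfl
  rw [h1, wcls_perm, smul_comm]
  congr 2
  exact Equiv.prod_comp σ fun l => v l (L l)

/-- The alternating version of `wmul`. -/
def walt (h2 : IsUnit (2 : T)) (Y : Matrix (Fin t) (Fin m) T) (q : ℕ) :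
    (Fin t → T) [⋀^Fin (q + 1)]→ₗ[T] (WedgeCoker Y q) :=
  { wmul Y q with
    map_eq_zero_of_eq' := fun v i j hv hij => by
      change wmul Y q v = 0
      have h := wmul_perm Y v (Equiv.swap i j)
      have hs : v ∘ Equiv.swap i j = v := by
        ext1 l
        rw [Function.comp_apply]
        rcases eq_or_ne l i with rfl | hi
        · rw [Equiv.swap_apply_left, hv]
        rcases eq_or_ne l j with rfl | hj
        · rw [Equiv.swap_apply_right, hv]
        · rw [Equiv.swap_apply_of_ne_of_ne hi hj]
      rw [hs, Equiv.Perm.sign_swap hij] at h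
      have h3 : (2 : T) • wmul Y q v = 0 := by
        rw [two_smul]
        nth_rewrite 1 [h]
        simp
      exact h2.smul_eq_zero.1 h3 }

lemma walt_apply (h2 : IsUnit (2 : T)) (Y : Matrix (Fin t) (Fin m) T)
    (v : Fin (q + 1) → Fin t → T) :
    walt h2 Y q v = ∑ L : Fin (q + 1) → Fin t, (∏ l, v l (L l)) • wcls Y L :=
  wmul_apply Y v

lemma walt_single (h2 : IsUnit (2 : T)) (Y : Matrix (Fin t) (Fin m) T) (L : Fin (q + 1) → Fin t) :
    walt h2 Y q (fun i => Pi.single (L i) 1) = wcls Y L := by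
  rw [walt_apply, Finset.sum_eq_single L]
  · simp
  · intro L' _ hL
    obtain ⟨i, hi⟩ := Function.ne_iff.1 hL
    rw [Finset.prod_eq_zero (Finset.mem_univ i), zero_smul]
    simp [hi]
  · simp

lemma walt_eq_zero (h2 : IsUnit (2 : T)) (Y : Matrix (Fin t) (Fin m) T)
    (v : Fin (q + 1) → Fin t → T) (hv : (LinearMap.range Y.mulVecLin).mkQ (v 0) = 0) :
    walt h2 Y q v = 0 := by
  rw [← LinearMap.mem_ker, Submodule.ker_mkQ] at hv
  obtain ⟨w, hw⟩ := hv
  rw [walt_apply, ← (Fin.consEquiv fun _ : Fin (q + 1) => Fin t).sum_comp,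
    Fintype.sum_prod_type_right]
  refine Finset.sum_eq_zero fun L _ => ?_
  simp only [Fin.consEquiv_apply, Fin.prod_univ_succ, Fin.cons_zero, Fin.cons_succ, ← hw,
    mulVecLin_apply, mulVec, dotProduct, mul_comm _ (∏ _, _), mul_smul, ← Finset.smul_sum]
  simp only [Finset.sum_smul]
  rw [Finset.sum_comm]
  have h : ∀ c, ∑ l, Y l c • wcls Y ((Fin.consEquiv fun _ : Fin (q + 1) => Fin t) (l, L)) = 0 :=
    sum_smul_wcls_cons Y L
  simp only [mul_comm (Y _ _), mul_smul, ← Finset.smul_sum, h, smul_zero, Finset.sum_const_zero]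

/-- The map from the free module onto the exterior power. -/
def wgen (Y : Matrix (Fin t) (Fin m) T) (q : ℕ) : ((Fin (q + 1) → Fin t) → T) →ₗ[T]
    ⋀[T]^(q + 1) ((Fin t → T) ⧸ LinearMap.range Y.mulVecLin) :=
  Fintype.linearCombination T fun L => exteriorPower.ιMulti T (q + 1)
    ((LinearMap.range Y.mulVecLin).mkQ ∘ fun i => Pi.single (L i) 1)

lemma wgen_single (Y : Matrix (Fin t) (Fin m) T) (L : Fin (q + 1) → Fin t) :
    wgen Y q (Pi.single L 1) = exteriorPower.ιMulti T (q + 1)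
      ((LinearMap.range Y.mulVecLin).mkQ ∘ fun i => Pi.single (L i) 1) := by
  rw [wgen, Fintype.linearCombination_apply_single, one_smul]

lemma range_wedgeRel_le (Y : Matrix (Fin t) (Fin m) T) (q : ℕ) :
    LinearMap.range (wedgeRel Y q).mulVecLin ≤ LinearMap.ker (wgen Y q) := by
  rw [LinearMap.range_le_ker_iff]
  refine LinearMap.pi_ext' fun x => ?_
  ext1
  rw [LinearMap.comp_apply, LinearMap.comp_apply, LinearMap.single_apply, mulVecLin_apply,
    mulVec_single_one, wgen, Fintype.linearCombination_apply]
  rcases x with ⟨L, σ⟩ | ⟨L, c⟩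
  · have h := (exteriorPower.ιMulti T (q + 1)).map_perm
      ((LinearMap.range Y.mulVecLin).mkQ ∘ fun i => Pi.single (L i) 1) σ
    simp only [wedgeRel, col_apply, of_apply, Sum.elim_inl, sub_smul, Finset.sum_sub_distrib,
      mul_smul, ← Finset.smul_sum, ite_smul, one_smul, zero_smul, Finset.sum_ite_eq',
      Finset.mem_univ, if_true]
    rw [LinearMap.comp_apply, LinearMap.zero_apply, sub_eq_zero]
    refine Eq.trans h ?_
    rw [Int.cast_smul_eq_zsmul]
    rfl
  · simp only [wedgeRel, col_apply, of_apply, Sum.elim_inr, Finset.sum_smul]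
    rw [Finset.sum_comm]
    simp only [mul_smul, ← Finset.smul_sum, ite_smul, one_smul, zero_smul, Finset.sum_ite_eq',
      Finset.mem_univ, if_true]
    let f := (exteriorPower.ιMulti T (q + 1)
      (M := (Fin t → T) ⧸ LinearMap.range Y.mulVecLin)).toMultilinearMap.curryLeft
    let u := (LinearMap.range Y.mulVecLin).mkQ ∘ fun i => Pi.single (L i) 1
    have h1 : ∀ l, exteriorPower.ιMulti T (q + 1) ((LinearMap.range Y.mulVecLin).mkQ ∘
        fun i => Pi.single ((Fin.cons l L : Fin (q + 1) → Fin t) i) 1) =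
        f ((LinearMap.range Y.mulVecLin).mkQ (Pi.single l 1)) u := by
      intro l
      change _ = exteriorPower.ιMulti T (q + 1) (Fin.cons _ u)
      congr 1
      ext1 i
      refine Fin.cases rfl (fun i => rfl) i
    have h2 : ∑ l, Y l c • (LinearMap.range Y.mulVecLin).mkQ (Pi.single l 1) = 0 := by
      simp only [← map_smul, ← map_sum]
      rw [← LinearMap.mem_ker, Submodule.ker_mkQ]
      refine ⟨Pi.single c 1, ?_⟩
      rw [mulVecLin_apply, mulVec_single_one]
      ext1 i
      simp [Finset.sum_apply, Pi.single_apply]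
    simp only [h1]
    have h3 := congrArg (fun z => f z u) h2
    refine Eq.trans (b := 0) ?_ rfl
    simpa only [map_sum, map_smul, _root_.sum_apply, _root_.smul_apply, map_zero,
      _root_.zero_apply] using h3

/-- The standard presentation of the exterior power of the cokernel of a matrix. -/
lemma nonempty_wedgeCoker_equiv (h2 : IsUnit (2 : T)) (Y : Matrix (Fin t) (Fin m) T) (q : ℕ) :
    Nonempty (WedgeCoker Y q ≃ₗ[T]
      ⋀[T]^(q + 1) ((Fin t → T) ⧸ LinearMap.range Y.mulVecLin)) := by
  obtain ⟨g, hg⟩ := exists_exteriorPower_descent (LinearMap.range Y.mulVecLin).mkQ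
    (Submodule.mkQ_surjective _) (walt h2 Y q)
      (alternating_eq_zero_of_first _ _ (walt_eq_zero h2 Y))
  let F : WedgeCoker Y q →ₗ[T] _ := Submodule.liftQ _ (wgen Y q) (range_wedgeRel_le Y q)
  have hF : ∀ L, F (wcls Y L) = _ := fun L =>
    (Submodule.liftQ_apply _ _ _).trans (wgen_single Y L)
  refine ⟨LinearEquiv.ofLinearMap F g ?_ ?_⟩
  · refine exteriorPower.linearMap_ext ?_
    have h1 : ((F ∘ₗ g).compAlternatingMap (exteriorPower.ιMulti T (q + 1))).compLinearMap
        (LinearMap.range Y.mulVecLin).mkQ = (exteriorPower.ιMulti T (q + 1)).compLinearMap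
        (LinearMap.range Y.mulVecLin).mkQ := by
      refine (Pi.basisFun T (Fin t)).ext_alternating fun L _ => ?_
      simp only [Pi.basisFun_apply]
      refine (congrArg F ((hg _).trans (walt_single h2 Y L))).trans (hF L)
    ext1 v
    obtain ⟨w, rfl⟩ : ∃ w, v = (LinearMap.range Y.mulVecLin).mkQ ∘ w :=
      ⟨fun i => (Submodule.mkQ_surjective _ (v i)).choose, funext fun i =>
        (Submodule.mkQ_surjective _ (v i)).choose_spec.symm⟩
    exact DFunLike.congr_fun h1 w
  · refine Submodule.linearMap_qext _ (LinearMap.pi_ext' fun L => ?_)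
    ext1
    change g (F (wcls Y L)) = wcls Y L
    rw [hF, hg, walt_single]

end Presentation

section DualVectors

variable {S : Type} [CommRing S]

lemma nonempty_dualCoker_equiv_transpose {m n : Type} [Fintype m] [Fintype n] [DecidableEq m]
    [DecidableEq n] (P : Matrix m n S) :
    Nonempty ((Module.Dual S (n → S) ⧸ LinearMap.range (LinearMap.dualMap P.mulVecLin)) ≃ₗ[S]
      ((n → S) ⧸ LinearMap.range Pᵀ.mulVecLin)) := by
  refine ⟨(Submodule.Quotient.equiv _ _ (dotProductEquiv S n) ?_).symm⟩
  have h : (dotProductEquiv S n).toLinearMap ∘ₗ Pᵀ.mulVecLin =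
      LinearMap.dualMap P.mulVecLin ∘ₗ (dotProductEquiv S m).toLinearMap := by
    refine LinearMap.ext fun x => LinearMap.ext fun y => ?_
    change Pᵀ *ᵥ x ⬝ᵥ y = x ⬝ᵥ P *ᵥ y
    rw [mulVec_transpose, dotProduct_mulVec]
  rw [← LinearMap.range_comp]
  refine (congrArg LinearMap.range h).trans ?_
  rw [LinearMap.range_comp, LinearEquiv.range, Submodule.map_top]

lemma range_dualMap_le {m n : Type} [Fintype n] [DecidableEq n] (I : Ideal S)
    (f : (n → S) →ₗ[S] (m → S)) (hf : LinearMap.range f ≤ I • (⊤ : Submodule S (m → S))) :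
    LinearMap.range f.dualMap ≤ I • (⊤ : Submodule S (Module.Dual S (n → S))) := by
  rintro _ ⟨z, rfl⟩
  have h : f.dualMap z = ∑ j, z (f (Pi.single j 1)) • LinearMap.proj j := by
    refine LinearMap.pi_ext' fun i => ?_
    ext1
    simp [Pi.single_apply]
  rw [h]
  refine Submodule.sum_mem _ fun j _ => Submodule.smul_mem_smul ?_ Submodule.mem_top
  have hz : I • (⊤ : Submodule S (m → S)) ≤ Submodule.comap z I :=
    Submodule.smul_le.2 fun a ha x _ => by
      rw [Submodule.mem_comap, map_smul, smul_eq_mul]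
      exact I.mul_mem_right _ ha
  exact hz (hf ⟨Pi.single j 1, rfl⟩)

/-- Self-duality of finite free resolutions of quotients by ideals of large depth. -/
lemma dual_exact_of_resolution {c : ℕ} (hc : 0 < c) {J : Ideal S} {fs : List S}
    (hfs : ∀ f ∈ fs, f ∈ J) (hlen : fs.length = c) (hreg : RingTheory.Sequence.IsWeaklyRegular S fs)
    (r : ℕ → ℕ) (d : ∀ i : ℕ, (Fin (r (i + 1)) → S) →ₗ[S] (Fin (r i) → S))
    (ε : (Fin (r 0) → S) →ₗ[S] (S ⧸ J)) (hr : ∀ i, c < i → r i = 0)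
    (hex0 : Function.Exact (d 0) ε) (hex : ∀ i, Function.Exact (d (i + 1)) (d i)) :
    Function.Injective (d 0).dualMap ∧
      ∀ i, i + 1 ≠ c → Function.Exact (d i).dualMap (d (i + 1)).dualMap := by
  have hdd : ∀ i z, d i (d (i + 1) z) = 0 := fun i z => (hex i _).2 ⟨z, rfl⟩
  obtain ⟨h1, h2⟩ := dual_exact_of_contraction (P := fun i => Fin (r i) → S) fs d hdd
    (fun i => isWeaklyRegular_of_flat _ hreg) fun f hf k =>
      exists_isContraction (P := fun i => Fin (r i) → S) d k f hdd
        (fun i _ => exactUpTo_one fun y hy => by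
          obtain ⟨x, hx⟩ := (hex i y).1 hy
          exact ⟨x, hx.symm⟩)
        (fun x => by
          obtain ⟨y, hy⟩ := (hex0 (f • x)).1 (by
            obtain ⟨s, hs⟩ := Submodule.mkQ_surjective J (ε x)
            rw [map_smul, ← hs, ← map_smul, ← LinearMap.mem_ker, Submodule.ker_mkQ, smul_eq_mul]
            exact Ideal.mul_mem_right _ _ (hfs f hf))
          exact ⟨y, hy.symm⟩)
  refine ⟨h1 (by omega), fun i hi => ?_⟩
  rcases lt_or_gt_of_ne hi with h | h
  · exact h2 i (by omega)
  · have hz : ∀ z : Module.Dual S (Fin (r (i + 1)) → S), z = 0 := fun z => by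
      ext j
      exact absurd j.2 (by have := hr _ h; omega)
    exact fun z => ⟨fun _ => ⟨0, by rw [hz z, map_zero]⟩, fun _ => by rw [hz z, map_zero]⟩

end DualVectors

section Transport

variable {K : Type} [Field K] [CharZero K] {r q c : ℕ}

local notation "Yg" => gmat K (r + (q + 1)) (r + (q + 1 + 1))
local notation "Sg" => GS K (r + (q + 1)) (r + (q + 1 + 1))

lemma nonempty_dualCoker_equiv_wedge {b : ℕ → ℕ} {D : ∀ i, Matrix (Fin (b i)) (Fin (b (i + 1))) Sg}
    {e₀ : Fin (b 0)} (hc : (q + 1) * (q + 1 + 1) = c + 1)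
    (h : IsFreeRes (genIdeal K r (q + 1)) (c + 1) b D e₀) :
    Nonempty (((Fin (b (c + 1)) → Sg) ⧸ LinearMap.range (D c)ᵀ.mulVecLin) ≃ₗ[Sg]
      WedgeCoker Yg q) := by
  obtain ⟨e1⟩ := nonempty_dualCoker_equiv_colSub (by omega) hc h
  obtain ⟨e2⟩ := nonempty_exteriorPower_equiv_colSub (K := K) (r := r) (p := q + 1) (by omega)
  obtain ⟨e3⟩ := nonempty_dualCoker_equiv_transpose (D c)
  have h2 : IsUnit (2 : Sg) := by
    have := (IsUnit.mk0 (2 : K) two_ne_zero).map (MvPolynomial.C : K →+* Sg)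
    rwa [map_ofNat] at this
  obtain ⟨e4⟩ := nonempty_wedgeCoker_equiv h2 Yg q
  exact ⟨e3.symm.trans (e1.trans (e2.symm.trans e4.symm))⟩

variable (K r q) in
lemma exists_isFreeRes_genIdeal (hc : (q + 1) * (q + 1 + 1) = c) :
    ∃ (b : ℕ → ℕ) (D : ∀ i, Matrix (Fin (b i)) (Fin (b (i + 1))) Sg) (e₀ : Fin (b 0)),
      IsFreeRes (genIdeal K r (q + 1)) c b D e₀ := by
  have h := isPerf_minorIdeal (K := K) (a := r + (q + 1)) (m := r + (q + 1 + 1)) (r := r)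
    (by omega) (by omega)
  rw [Nat.add_sub_cancel_left, Nat.add_sub_cancel_left, hc] at h
  refine exists_isFreeRes (by rw [← hc]; positivity) (fun f hf d => ?_) h
  rw [genIdeal, ← rsIdeal_range (by omega)] at hf ⊢
  exact rsIdeal_homogeneousComponent_mem f hf d

/-- The top dual cokernel of a resolution of a determinantal ring of maximal codimension is the
exterior power of the cokernel. -/
theorem nonempty_dualCoker_equiv_exteriorPower {T : Type} [CommRing T] (φ : Sg →+* T)
    (h2 : IsUnit (2 : T)) {fs : List T} (hc : (q + 1) * (q + 1 + 1) = c + 1)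
    (hlen : fs.length = c + 1) {J : Ideal T} (hJ : J = (genIdeal K r (q + 1)).map φ)
    (hfs : ∀ f ∈ fs, f ∈ J) (hreg : RingTheory.Sequence.IsWeaklyRegular T fs)
    (n : ℕ → ℕ) (d : ∀ i : ℕ, (Fin (n (i + 1)) → T) →ₗ[T] (Fin (n i) → T))
    (ε : (Fin (n 0) → T) →ₗ[T] (T ⧸ J)) (hn : ∀ i, c + 1 < i → n i = 0)
    (hsur : Function.Surjective ε)
    (hex0 : Function.Exact (d 0) ε) (hex : ∀ i, Function.Exact (d (i + 1)) (d i)) :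
    Nonempty ((Module.Dual T (Fin (n (c + 1)) → T) ⧸ LinearMap.range (d c).dualMap) ≃ₗ[T]
      ⋀[T]^(q + 1) ((Fin (r + (q + 1)) → T) ⧸ LinearMap.range (Matrix.mulVecLin ((Yg).map φ)))) := by
  subst hJ
  obtain ⟨b, D, e₀, h⟩ := exists_isFreeRes_genIdeal K r q hc
  obtain ⟨e1⟩ := nonempty_dualCoker_equiv_wedge hc h
  have h' := h.baseChange φ fs hlen hfs hreg
  obtain ⟨e2⟩ := nonempty_coker_map_equiv φ _ _ e1
  rw [wedgeRel_map] at e2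
  obtain ⟨e3⟩ := nonempty_wedgeCoker_equiv h2 ((Yg).map φ) q
  obtain ⟨e4⟩ := nonempty_dualCoker_equiv_transpose ((D c).map φ)
  obtain ⟨e5⟩ := nonempty_dualCoker_equiv (P := fun i => Fin (n i) → T)
    (Q := fun i => Fin (b i) → T) d (fun i => ((D i).map φ).mulVecLin) ε (IsFreeRes.aug _ e₀)
    hsur (IsFreeRes.aug_surjective _ e₀) hex0 h'.exact_aug hex h'.exact c
    (fun z => by
      ext j
      exact absurd j.2 (by have := hn (c + 2) (by omega); omega))
    (fun z => h'.eq_zero (by omega) z)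
  exact ⟨e5.trans (e4.trans (e2.trans e3))⟩

end Transport

section Specialization

variable {k : Type} [Field k] {n s q : ℕ}

/-- The specialization of the generic matrix to the transpose of a matrix. -/
def specialize (A : Matrix (Fin (s + (q + 1 + 1))) (Fin (s + (q + 1))) (RR k n)) :
    GS k (s + (q + 1)) (s + (q + 1 + 1)) →+* RR k n :=
  MvPolynomial.eval₂Hom MvPolynomial.C fun ij => A ij.2 ij.1

lemma gmat_map_specialize (A : Matrix (Fin (s + (q + 1 + 1))) (Fin (s + (q + 1))) (RR k n)) :
    (gmat k (s + (q + 1)) (s + (q + 1 + 1))).map (specialize A) = Aᵀ := by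
  ext1 i j
  simp [specialize]

lemma specialize_det (A : Matrix (Fin (s + (q + 1 + 1))) (Fin (s + (q + 1))) (RR k n)) {j : ℕ}
    (f : Fin j → Fin (s + (q + 1))) (g : Fin j → Fin (s + (q + 1 + 1))) :
    specialize A ((gmat k (s + (q + 1)) (s + (q + 1 + 1))).submatrix f g).det =
      (A.submatrix g f).det := by
  rw [RingHom.map_det, ← det_transpose (A.submatrix g f), transpose_submatrix,
    ← gmat_map_specialize A]
  rfl

lemma minors_eq_map_genIdeal (A : Matrix (Fin (s + (q + 1 + 1))) (Fin (s + (q + 1))) (RR k n))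
    {j : ℕ} (hj : j = s + 1) : minors A j = (genIdeal k s (q + 1)).map (specialize A) := by
  subst hj
  rw [genIdeal, minorIdeal, Ideal.map_span]
  apply le_antisymm <;> rw [minors, Ideal.span_le]
  · rintro _ ⟨g, f, -, -, rfl⟩
    exact Ideal.subset_span ⟨_, ⟨f, g, fun l => (g l).2, rfl⟩, specialize_det A f g⟩
  · rintro _ ⟨_, ⟨f, g, -, rfl⟩, rfl⟩
    rw [SetLike.mem_coe, specialize_det]
    by_cases hg : Function.Injective g
    · by_cases hf : Function.Injective f
      · exact Ideal.subset_span ⟨g, f, hg, hf, rfl⟩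
      · obtain ⟨x, y, hxy, hne⟩ : ∃ x y, f x = f y ∧ x ≠ y := by
          simpa [Function.Injective] using hf
        rw [det_zero_of_column_eq hne fun i => by simp [hxy]]
        exact Ideal.zero_mem _
    · obtain ⟨x, y, hxy, hne⟩ : ∃ x y, g x = g y ∧ x ≠ y := by
        simpa [Function.Injective] using hg
      rw [det_zero_of_row_eq hne (by ext i; simp [hxy])]
      exact Ideal.zero_mem _

end Specialization

/-- Theorem `BE's_guess`, first part; c = 2.
Assume `depth_{I_{t+1-p}(φ)} R = p(p+1)`.  Given any minimal graded free `R`-resolution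
`L•` (of length `p(p+1)`) of `R/I_{t+1-p}(φ)`, its `R`-dual `Hom_R(L•, R)` is a minimal
graded free `R`-resolution of `⋀^p M (pℓ)`: the dual complex is exact everywhere except
at the last spot, all its differentials are minimal, and the cokernel of its last
differential is isomorphic to `⋀^p M` (up to the twist `pℓ`, invisible on the
underlying modules). -/
theorem statement_2 {k : Type} [Field k] [IsAlgClosed k] [CharZero k]
    {n t p : ℕ} (hp : 1 ≤ p) (hpt : p ≤ t)
    (A : Matrix (Fin (t + 1)) (Fin t) (RR k n))
    (a : Fin (t + 1) → ℤ) (b : Fin t → ℤ)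
    (hhom : IsHomogMatrix A a b) (hmin : IsMinMatrix A)
    (hdepth : depthEQ (minors A (t + 1 - p)) (RR k n) (p * (p + 1)))
    -- data of a minimal graded free resolution `L•` of `B_{t+1-p}` of length `p(p+1)`:
    (r : ℕ → ℕ)
    (d : ∀ i : ℕ, (Fin (r (i + 1)) → RR k n) →ₗ[RR k n] (Fin (r i) → RR k n))
    (ε : (Fin (r 0) → RR k n) →ₗ[RR k n] (RR k n ⧸ minors A (t + 1 - p)))
    (hlen : ∀ i, p * (p + 1) < i → r i = 0)
    (hsur : Function.Surjective ε)
    (hex0 : Function.Exact (d 0) ε)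
    (hex : ∀ i, Function.Exact (d (i + 1)) (d i))
    (hminres : ∀ i, LinearMap.range (d i) ≤
      (mxI k n) • (⊤ : Submodule (RR k n) (Fin (r i) → RR k n))) :
    -- the dual complex is a minimal free resolution of `⋀^p M (pℓ)`:
    Function.Injective ((d 0).dualMap) ∧
    (∀ i, i + 1 ≠ p * (p + 1) → Function.Exact ((d i).dualMap) ((d (i + 1)).dualMap)) ∧
    (∀ i, LinearMap.range ((d i).dualMap) ≤
      (mxI k n) • (⊤ : Submodule (RR k n) (Module.Dual (RR k n) (Fin (r (i + 1)) → RR k n)))) ∧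
    Nonempty (((Module.Dual (RR k n) (Fin (r ((p * (p + 1) - 1) + 1)) → RR k n)) ⧸
        LinearMap.range ((d (p * (p + 1) - 1)).dualMap)) ≃ₗ[RR k n]
      (⋀[RR k n]^p (Mdl A))) := by
  obtain ⟨q, rfl⟩ : ∃ q, p = q + 1 := ⟨p - 1, by omega⟩
  obtain ⟨s, rfl⟩ : ∃ s, t = s + (q + 1) := ⟨t - (q + 1), by omega⟩
  have hc : (q + 1) * (q + 1 + 1) = (q + 1) * (q + 1 + 1) - 1 + 1 := by
    have : 0 < (q + 1) * (q + 1 + 1) := by positivity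
    omega
  obtain ⟨⟨fs, hfl, hfs, hreg⟩, -⟩ := hdepth
  have hdual := dual_exact_of_resolution (by positivity) hfs hfl hreg.toIsWeaklyRegular r d ε hlen
    hex0 hex
  refine ⟨hdual.1, hdual.2, fun i => range_dualMap_le _ _ (hminres i), ?_⟩
  have h2 : IsUnit (2 : RR k n) := by
    have := (IsUnit.mk0 (2 : k) two_ne_zero).map (MvPolynomial.C : k →+* RR k n)
    rwa [map_ofNat] at this
  have hA : (gmat k (s + (q + 1)) (s + (q + 1 + 1))).map (specialize A) = Aᵀ :=
    gmat_map_specialize A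
  have h := nonempty_dualCoker_equiv_exteriorPower (specialize A) h2 hc (hfl.trans hc)
    (minors_eq_map_genIdeal A (by omega)) hfs hreg.toIsWeaklyRegular r d ε
    (fun i hi => hlen i (by omega)) hsur hex0 hex
  rw [hA] at h
  exact h

end KMR
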